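/- Let d > 1 be a squarefree integer and let p ≥ 5 be a prime with p ∣ d, say d = p·m. If p is d-regular and −m is a square modulo p, then the equation x^p + y^p = z^p has no non-trivial solutions with x, y, z ∈ ℚ(√d). -/

import Mathlib

open IntermediateField

/-- A prime `p` is `d`-regular if `p` does not divide the class number of the number field
`ℚ(√d, ζ_p)`, formalized here by quantifying over all number fields generated over `ℚ` by a
square root of `d` and a primitive `p`-th root of unity. -/
def IsRegularFor (d : ℤ) (p : ℕ) : Prop :=
  ∀ (L : Type) [Field L] [NumberField L] (s ζ : L),
    s ^ 2 = (d : L) → IsPrimitiveRoot ζ p →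
    IntermediateField.adjoin ℚ ({s, ζ} : Set L) = ⊤ →
    ¬ (p ∣ NumberField.classNumber L)

set_option linter.unusedSectionVars false

section

open Module

/-- The index of `pM` in a finitely generated abelian group `M`. -/
lemma index_range_nsmul_eq (M : Type*) [AddCommGroup M] [Module.Finite ℤ M] (p : ℕ) :
    (nsmulAddMonoidHom (α := M) p).range.index =
      (nsmulAddMonoidHom (α := M) p).range.relIndex (Submodule.torsion ℤ M).toAddSubgroup *
        p ^ finrank ℤ M := by
  set R := (nsmulAddMonoidHom (α := M) p).range
  set T := Submodule.torsion ℤ M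
  have h1 : R.relIndex (R ⊔ T.toAddSubgroup) * (R ⊔ T.toAddSubgroup).index = R.index :=
    AddSubgroup.relIndex_mul_index le_sup_left
  rw [AddSubgroup.relIndex_sup_left] at h1
  rw [← h1]
  congr 1
  let f : M →+ M ⧸ T := T.mkQ.toAddMonoidHom
  have hf : Function.Surjective f := T.mkQ_surjective
  have hker : f.ker = T.toAddSubgroup := by
    ext x; simp [f, AddMonoidHom.mem_ker]
  have hmap : (R ⊔ T.toAddSubgroup).map f = (nsmulAddMonoidHom (α := M ⧸ T) p).range := by
    rw [AddSubgroup.map_sup, (AddSubgroup.map_eq_bot_iff _).2 hker.ge, sup_bot_eq]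
    ext y
    simp only [AddSubgroup.mem_map, AddMonoidHom.mem_range, nsmulAddMonoidHom_apply, R]
    constructor
    · rintro ⟨_, ⟨x, rfl⟩, rfl⟩
      exact ⟨f x, by simp⟩
    · rintro ⟨z, rfl⟩
      obtain ⟨x, rfl⟩ := hf z
      exact ⟨_, ⟨x, rfl⟩, by simp⟩
  rw [← AddSubgroup.index_map_eq (f := f) _ hf (by rw [hker]; exact le_sup_right), hmap]
  have : Module.Free ℤ (M ⧸ T) := inferInstance
  rw [AddSubgroup.index_range_nsmul]
  congr 1
  exact finrank_quotient_eq_of_le_torsion le_rfl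

/-- If every torsion element is divisible by `p`, then there is no `p`-torsion. -/
lemma eq_zero_of_torsion_le_range_nsmul (M : Type*) [AddCommGroup M] [Module.Finite ℤ M] (p : ℕ)
    (hp : p ≠ 0)
    (h : (Submodule.torsion ℤ M).toAddSubgroup ≤ (nsmulAddMonoidHom (α := M) p).range)
    (z : M) (hz : p • z = 0) : z = 0 := by
  set T := Submodule.torsion ℤ M
  have : Finite T := Module.finite_of_fg_torsion T (Submodule.torsion_isTorsion)
  have hmem : ∀ y : M, p • y ∈ T → y ∈ T := by
    intro y hy
    rw [Submodule.mem_torsion_iff] at hy ⊢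
    obtain ⟨a, ha⟩ := hy
    have h0 : (a : ℤ) * p ≠ 0 := mul_ne_zero (nonZeroDivisors.coe_ne_zero a) (by exact_mod_cast hp)
    refine ⟨⟨(a : ℤ) * p, mem_nonZeroDivisors_of_ne_zero h0⟩, ?_⟩
    rw [Submonoid.smul_def] at ha ⊢
    simpa [mul_smul] using ha
  have hsurj : Function.Surjective (fun t : T => p • t) := by
    rintro ⟨t, ht⟩
    obtain ⟨y, rfl⟩ := h (show t ∈ T.toAddSubgroup from ht)
    exact ⟨⟨y, hmem y ht⟩, rfl⟩
  have hinj := Finite.injective_iff_surjective.2 hsurj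
  have hzT : z ∈ T := hmem z (hz ▸ T.zero_mem)
  have := @hinj ⟨z, hzT⟩ 0 (by ext; simpa using hz)
  simpa using congrArg Subtype.val this

open Polynomial in
lemma exists_sub_one_pow_eq_geom_sum (p : ℕ) [hp : Fact p.Prime] :
    ∃ q : ℤ[X], (X - 1) ^ (p - 1) = ∑ i ∈ Finset.range p, X ^ i + (p : ℤ[X]) * q := by
  have h1 : ((X : (ZMod p)[X]) - 1) ^ (p - 1) = ∑ i ∈ Finset.range p, X ^ i := by
    have h2 : ((X : (ZMod p)[X]) - 1) ≠ 0 := X_sub_C_ne_zero 1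
    apply mul_right_cancel₀ h2
    rw [← pow_succ, Nat.sub_add_cancel hp.out.one_le, geom_sum_mul, sub_pow_char, one_pow]
  have h3 : ((p : ℤ) : ℤ[X]) ∣ ((X : ℤ[X]) - 1) ^ (p - 1) - ∑ i ∈ Finset.range p, X ^ i := by
    rw [← Polynomial.C_eq_intCast, C_dvd_iff_dvd_coeff]
    intro i
    refine (ZMod.intCast_zmod_eq_zero_iff_dvd _ _).1 ?_
    rw [← eq_intCast (Int.castRingHom (ZMod p)), ← coeff_map]
    simp [Polynomial.map_sum, h1]
  obtain ⟨q, hq⟩ := h3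
  refine ⟨q, ?_⟩
  push_cast at hq
  rw [← hq]; ring

lemma relIndex_range_comp_dvd {B : Type*} [AddCommGroup B] (f g : B →+ B) :
    (f.comp g).range.relIndex f.range ∣ g.range.index := by
  have e1 : (f.comp g).range = g.range.map f := (AddMonoidHom.map_range _ _).symm
  have e2 : f.range = (⊤ : AddSubgroup B).map f := AddMonoidHom.range_eq_map _
  rw [e1, e2, AddSubgroup.relIndex_map_map, top_sup_eq, AddSubgroup.relIndex_top_right]
  exact AddSubgroup.index_dvd_of_le le_sup_left

lemma index_range_pow_dvd {B : Type*} [AddCommGroup B] (f : AddMonoid.End B) (k : ℕ) :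
    (AddMonoidHom.range (f ^ k : AddMonoid.End B)).index ∣ (AddMonoidHom.range f).index ^ k := by
  induction k with
  | zero =>
    have : (AddMonoidHom.range (1 : AddMonoid.End B)) = ⊤ :=
      AddMonoidHom.range_eq_top.2 fun x => ⟨x, rfl⟩
    simp [this]
  | succ k ih =>
    have hle : AddMonoidHom.range (f ^ (k + 1) : AddMonoid.End B) ≤
        AddMonoidHom.range (f ^ k : AddMonoid.End B) := by
      rintro _ ⟨x, rfl⟩
      exact ⟨f x, by rw [pow_succ]; rfl⟩
    rw [← AddSubgroup.relIndex_mul_index hle, pow_succ, mul_comm]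
    exact mul_dvd_mul ih (relIndex_range_comp_dvd _ _)

lemma end_sum_apply {A ι : Type*} [AddCommGroup A] (s : Finset ι) (f : ι → AddMonoid.End A)
    (a : A) : (∑ i ∈ s, f i) a = ∑ i ∈ s, f i a :=
  AddMonoidHom.finsetSum_apply _ _ _

/-- A Herbrand-quotient style count: if the fixed points `A^σ` satisfy `[A^σ : pA^σ] ∣ p ^ r`, while
the kernel of the norm has rank at least `(p - 1) r` and nontrivial `p`-torsion, then the kernel of
the norm is not contained in the range of `σ - 1`. -/
lemma exists_mem_ker_norm_not_mem_range {A : Type*} [AddCommGroup A] [Module.Finite ℤ A]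
    (p : ℕ) [hp : Fact p.Prime] (σ : AddMonoid.End A) (r : ℕ) (hσ : σ ^ p = 1)
    (hfix : (nsmulAddMonoidHom (α := AddMonoidHom.ker (σ - 1)) p).range.index ∣ p ^ r)
    (hrank : (p - 1) * r ≤
      finrank ℤ (AddMonoidHom.ker (∑ i ∈ Finset.range p, σ ^ i : AddMonoid.End A)))
    (z : A) (hz0 : z ≠ 0) (hz1 : p • z = 0)
    (hz2 : (∑ i ∈ Finset.range p, σ ^ i : AddMonoid.End A) z = 0) :
    ∃ b : A, (∑ i ∈ Finset.range p, σ ^ i : AddMonoid.End A) b = 0 ∧ ∀ a : A, σ a - a ≠ b := by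
  by_contra! hcon
  set N : AddMonoid.End A := ∑ i ∈ Finset.range p, σ ^ i with hN
  set B : AddSubgroup A := AddMonoidHom.ker N
  have hfin : Module.Finite ℤ B := inferInstanceAs (Module.Finite ℤ B.toIntSubmodule)
  have hcomm : ∀ a, N (σ a) = σ (N a) := by
    have : Commute N σ := Commute.sum_left _ _ _ fun i _ => (Commute.refl σ).pow_left i
    intro a
    exact DFunLike.congr_fun this.eq a
  have hNσ : ∀ a, σ (N a) = N a := by
    intro a
    have h1 : (σ - 1) * N = 0 := by rw [hN, mul_geom_sum, hσ, sub_self]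
    have := DFunLike.congr_fun h1 a
    exact sub_eq_zero.1 this
  have hNfix : ∀ a, σ a = a → N a = p • a := by
    intro a ha
    have : ∀ i, (σ ^ i : AddMonoid.End A) a = a := by
      intro i
      induction i with
      | zero => rfl
      | succ i ih => rw [pow_succ']; exact (congrArg σ ih).trans ha
    rw [hN, end_sum_apply]
    simp [this]
  -- the restriction of `σ` to `B`
  let τ : AddMonoid.End B := (AddMonoidHom.comp σ B.subtype).codRestrict B fun b => by
    have : N b = 0 := b.2
    show N (σ b) = 0
    rw [hcomm, this, map_zero]
  have hτ : ∀ b : B, ((τ b : B) : A) = σ b := fun b => rfl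
  have hτpow : ∀ (i : ℕ) (b : B), (((τ ^ i : AddMonoid.End B) b : B) : A) =
      (σ ^ i : AddMonoid.End A) b := by
    intro i
    induction i with
    | zero => intro b; rfl
    | succ i ih => intro b; rw [pow_succ', pow_succ']; exact congrArg σ (ih b)
  -- first inequality
  have hindex1 : (AddMonoidHom.range (τ - 1)).index ∣ p ^ r := by
    let g : A →+ B := (AddMonoidHom.codRestrict (σ - 1) B fun a => by
      show N (σ a - a) = 0
      rw [map_sub, hcomm, hNσ, sub_self])
    have hg : Function.Surjective g := by
      rintro ⟨b, hb⟩
      obtain ⟨a, ha⟩ := hcon b hb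
      exact ⟨a, Subtype.ext ha⟩
    have h1 : ((AddMonoidHom.range (τ - 1)).comap g).index = (AddMonoidHom.range (τ - 1)).index :=
      AddSubgroup.index_comap_of_surjective _ hg
    rw [← h1]
    let F := AddMonoidHom.ker (σ - 1)
    let n : A →+ F := AddMonoidHom.codRestrict N F fun a => sub_eq_zero.2 (hNσ a)
    have hle : (nsmulAddMonoidHom (α := F) p).range.comap n ≤
        (AddMonoidHom.range (τ - 1)).comap g := by
      rintro a ⟨⟨c, hc⟩, hca⟩
      have hc' : σ c = c := sub_eq_zero.1 hc
      have hca' : p • c = N a := congrArg Subtype.val hca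
      have hb : a - c ∈ B := by
        show N (a - c) = 0
        rw [map_sub, hNfix c hc', hca', sub_self]
      refine ⟨⟨a - c, hb⟩, Subtype.ext ?_⟩
      show σ (a - c) - (a - c) = σ a - a
      rw [map_sub, hc']; abel
    refine (AddSubgroup.index_dvd_of_le hle).trans ?_
    rw [AddSubgroup.index_comap]
    exact (AddSubgroup.relIndex_dvd_index_of_normal _ _).trans hfix
  -- second inequality
  have hle2 : AddMonoidHom.range ((τ - 1) ^ (p - 1) : AddMonoid.End B) ≤
      (nsmulAddMonoidHom (α := B) p).range := by
    obtain ⟨q, hq⟩ := exists_sub_one_pow_eq_geom_sum p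
    have h1 := congrArg (Polynomial.aeval τ) hq
    simp only [map_pow, map_sub, Polynomial.aeval_X, map_one, map_add, map_sum, map_mul,
      map_natCast] at h1
    rintro _ ⟨b, rfl⟩
    refine ⟨Polynomial.aeval τ q b, ?_⟩
    have h2 : (∑ i ∈ Finset.range p, τ ^ i : AddMonoid.End B) b = 0 := by
      apply Subtype.ext
      rw [end_sum_apply, AddSubgroup.val_finsetSum]
      simp only [hτpow]
      rw [← end_sum_apply]
      exact b.2
    rw [h1]
    refine Eq.trans ?_ (congrArg₂ (· + ·) h2 rfl :
      _ + ((p : AddMonoid.End B) * Polynomial.aeval τ q) b = _).symm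
    rw [zero_add]
    rfl
  have hdvd : (nsmulAddMonoidHom (α := B) p).range.index ∣ p ^ ((p - 1) * r) := by
    refine (AddSubgroup.index_dvd_of_le hle2).trans ((index_range_pow_dvd _ _).trans ?_)
    rw [mul_comm, pow_mul]
    exact pow_dvd_pow_of_dvd hindex1 _
  rw [index_range_nsmul_eq] at hdvd
  have hrel : (nsmulAddMonoidHom (α := B) p).range.relIndex
      (Submodule.torsion ℤ B).toAddSubgroup = 1 := by
    have h1 := hdvd.trans (pow_dvd_pow p hrank)
    have hpos : 0 < p ^ finrank ℤ B := pow_pos hp.out.pos _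
    have h2 :=
      Nat.dvd_of_mul_dvd_mul_right hpos (h1.trans (by rw [one_mul]) : _ ∣ 1 * p ^ finrank ℤ B)
    exact Nat.dvd_one.1 h2
  have := eq_zero_of_torsion_le_range_nsmul B p hp.out.ne_zero
    (AddSubgroup.relIndex_eq_one.1 hrel) ⟨z, hz2⟩ (Subtype.ext hz1)
  exact hz0 (congrArg Subtype.val this)

end

section

open Module NumberField

section Units

variable {L : Type*} [Field L] [NumberField L]

lemma exists_ringOfIntegers_eq {x : L} (hx : IsIntegral ℤ x) :
    ∃ y : 𝓞 L, algebraMap (𝓞 L) L y = x :=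
  ⟨⟨x, hx⟩, rfl⟩

/-- The index of the `p`-th powers in the unit group of a number field divides
`p ^ (rank + 1)`. -/
lemma index_units_pow_dvd (p : ℕ) :
    (nsmulAddMonoidHom (α := Additive (𝓞 L)ˣ) p).range.index ∣ p ^ (Units.rank L + 1) := by
  rw [index_range_nsmul_eq, Units.finrank_eq, pow_succ']
  refine mul_dvd_mul_right ?_ _
  set T := (Submodule.torsion ℤ (Additive (𝓞 L)ˣ)).toAddSubgroup with hT
  have : Finite T := Module.finite_of_fg_torsion (Submodule.torsion ℤ (Additive (𝓞 L)ˣ))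
    (Submodule.torsion_isTorsion)
  let T' : Subgroup (𝓞 L)ˣ := AddSubgroup.toSubgroup' T
  have : Finite T' := ‹Finite T›
  have hcyc : IsCyclic T' := inferInstance
  have h1 : (powMonoidHom p : T' →* T').range.index ∣ p := by
    rw [IsCyclic.index_powMonoidHom_range]
    exact Nat.gcd_dvd_right _ _
  have h2 : (nsmulAddMonoidHom (α := T) p).range.index ∣ p := h1
  refine (AddSubgroup.index_dvd_of_le ?_).trans h2
  rintro _ ⟨t, rfl⟩
  exact ⟨(t : Additive (𝓞 L)ˣ), rfl⟩

lemma rank_add_one_eq_of_isPrimitiveRoot {ζ : L} {p : ℕ} (hζ : IsPrimitiveRoot ζ p) (hp : 2 < p) :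
    2 * (Units.rank L + 1) = finrank ℚ L := by
  have h0 : InfinitePlace.nrRealPlaces L = 0 :=
    InfinitePlace.IsPrimitiveRoot.nrRealPlaces_eq_zero_of_two_lt hp hζ
  have h1 := InfinitePlace.card_add_two_mul_card_eq_rank L
  have h2 := InfinitePlace.card_eq_nrRealPlaces_add_nrComplexPlaces L
  have h3 : 0 < finrank ℚ L := finrank_pos
  rw [Units.rank, h2]
  omega

end Units

section Galois

variable {L E : Type} [Field L] [NumberField L] [Field E] [NumberField E] [Algebra L E]
  [IsGalois L E]

local notation "res" => galRestrict (𝓞 L) L E (𝓞 E)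

lemma coe_galRestrict (τ : Gal(E/L)) (x : 𝓞 E) :
    algebraMap (𝓞 E) E (res τ x) = τ (algebraMap (𝓞 E) E x) :=
  algebraMap_galRestrict_apply (𝓞 L) τ x

lemma exists_algebraMap_eq_sum_galRestrict (x : 𝓞 E) :
    ∃ y : 𝓞 L, algebraMap (𝓞 L) (𝓞 E) y = ∑ τ : Gal(E/L), res τ x := by
  obtain ⟨y, hy⟩ := exists_ringOfIntegers_eq (Algebra.isIntegral_trace (L := L) x.isIntegral_coe)
  refine ⟨y, RingOfIntegers.coe_injective ?_⟩
  rw [map_sum (algebraMap (𝓞 E) E)]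
  simp only [coe_galRestrict]
  rw [← trace_eq_sum_automorphisms (K := L) (x : E), ← hy]
  rfl

lemma exists_algebraMap_eq_of_fixed (x : 𝓞 E) (h : ∀ τ : Gal(E/L), res τ x = x) :
    ∃ y : 𝓞 L, algebraMap (𝓞 L) (𝓞 E) y = x := by
  have h1 : (x : E) ∈ Set.range (algebraMap L E) := by
    rw [IsGalois.mem_range_algebraMap_iff_fixed]
    intro τ
    rw [← coe_galRestrict, h]
  obtain ⟨y, hy⟩ := h1
  have hy' : IsIntegral ℤ y := by
    rw [← isIntegral_algebraMap_iff (algebraMap L E).injective, hy]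
    exact x.isIntegral_coe
  obtain ⟨y, rfl⟩ := exists_ringOfIntegers_eq hy'
  exact ⟨y, RingOfIntegers.ext hy⟩

open Polynomial in
/-- If the differences of conjugates of `β` are units, then every Galois-stable ideal is extended
from the base. -/
lemma map_comap_eq_of_stable (β : 𝓞 E) (hβ : ∀ τ : Gal(E/L), τ ≠ 1 → IsUnit (β - res τ β))
    (I : Ideal (𝓞 E)) (hI : ∀ (τ : Gal(E/L)), ∀ x ∈ I, res τ x ∈ I) :
    (I.comap (algebraMap (𝓞 L) (𝓞 E))).map (algebraMap (𝓞 L) (𝓞 E)) = I := by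
  classical
  refine le_antisymm Ideal.map_comap_le fun x hx => ?_
  let G := Finset.univ.erase (1 : Gal(E/L))
  obtain ⟨e, he⟩ : ∃ e : 𝓞 E, (∏ τ ∈ G, (β - res τ β)) * e = 1 := by
    refine isUnit_iff_exists_inv.1 ?_
    exact IsUnit.prod_iff.2 fun τ hτ => hβ τ (Finset.ne_of_mem_erase hτ)
  let g : (𝓞 E)[X] := (∏ τ ∈ G, (X - C (res τ β))) * C e
  have hg1 : g.eval β = 1 := by simpa [g, eval_prod] using he
  have hg2 : ∀ τ : Gal(E/L), τ ≠ 1 → g.eval (res τ β) = 0 := by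
    intro τ hτ
    simp only [g, eval_mul, eval_prod, eval_sub, eval_X, eval_C]
    rw [Finset.prod_eq_zero (Finset.mem_erase.2 ⟨hτ, Finset.mem_univ τ⟩) (sub_self _), zero_mul]
  have key : ∑ i ∈ Finset.range (g.natDegree + 1),
      g.coeff i * ∑ τ : Gal(E/L), res τ (β ^ i * x) = x := by
    simp_rw [Finset.mul_sum]
    rw [Finset.sum_comm]
    have : ∀ τ : Gal(E/L), ∑ i ∈ Finset.range (g.natDegree + 1), g.coeff i * res τ (β ^ i * x) =
        g.eval (res τ β) * res τ x := by
      intro τ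
      rw [eval_eq_sum_range, Finset.sum_mul]
      refine Finset.sum_congr rfl fun i _ => ?_
      rw [map_mul, map_pow]; ring
    simp_rw [this]
    rw [Finset.sum_eq_single 1]
    · simp [hg1]
    · intro τ _ hτ; rw [hg2 τ hτ, zero_mul]
    · simp
  rw [← key]
  refine Ideal.sum_mem _ fun i _ => Ideal.mul_mem_left _ _ ?_
  obtain ⟨y, hy⟩ := exists_algebraMap_eq_sum_galRestrict (L := L) (β ^ i * x)
  rw [← hy]
  refine Ideal.mem_map_of_mem _ ?_
  rw [Ideal.mem_comap, hy]
  exact Ideal.sum_mem _ fun τ _ => hI τ _ (Ideal.mul_mem_left _ _ hx)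

end Galois

end

section

open Module NumberField

lemma index_range_nsmul_congr {M M' : Type*} [AddCommGroup M] [AddCommGroup M'] (e : M ≃+ M')
    (p : ℕ) : (nsmulAddMonoidHom (α := M') p).range.index =
      (nsmulAddMonoidHom (α := M) p).range.index := by
  rw [← AddSubgroup.index_map_equiv _ e]
  congr 1
  ext y
  constructor
  · rintro ⟨x, rfl⟩
    exact ⟨p • e.symm x, ⟨e.symm x, rfl⟩, by simp⟩
  · rintro ⟨_, ⟨x, rfl⟩, rfl⟩
    exact ⟨e x, by simp⟩

section Galois

variable {L E : Type} [Field L] [NumberField L] [Field E] [NumberField E] [Algebra L E]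
  [IsGalois L E]

local notation "res" => galRestrict (𝓞 L) L E (𝓞 E)

lemma prod_eq_prod_range_of_generator {M : Type*} [CommMonoid M] {p : ℕ} {σ : Gal(E/L)}
    (hσ : ∀ τ, τ ∈ Subgroup.zpowers σ) (hdeg : finrank L E = p) (f : Gal(E/L) → M) :
    ∏ τ : Gal(E/L), f τ = ∏ i ∈ Finset.range p, f (σ ^ i) := by
  classical
  have ho : orderOf σ = p := by
    rw [orderOf_eq_card_of_forall_mem_zpowers hσ, IsGalois.card_aut_eq_finrank, hdeg]
  rw [← IsCyclic.image_range_orderOf hσ, Finset.prod_image, ho]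
  intro i hi j hj hij
  simp only [Finset.coe_range, Set.mem_Iio] at hi hj
  exact pow_injOn_Iio_orderOf hi hj hij

/-- In a cyclic extension of odd prime degree `p` of a number field containing the `p`-th roots of
unity, some unit of relative norm one is not of the form `σ a / a` with `a` a unit. -/
lemma exists_unit_norm_eq_one_not_coboundary {p : ℕ} [hp : Fact p.Prime] (hp2 : 2 < p) {ζ : L}
    (hζ : IsPrimitiveRoot ζ p) {σ : Gal(E/L)} (hσ : ∀ τ, τ ∈ Subgroup.zpowers σ)
    (hdeg : finrank L E = p) :
    ∃ η : (𝓞 E)ˣ, Algebra.norm L (algebraMap (𝓞 E) E η) = 1 ∧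
      ∀ a : (𝓞 E)ˣ, res σ (a : 𝓞 E) ≠ η * a := by
  have ho : orderOf σ = p := by
    rw [orderOf_eq_card_of_forall_mem_zpowers hσ, IsGalois.card_aut_eq_finrank, hdeg]
  let S : AddMonoid.End (Additive (𝓞 E)ˣ) :=
    MonoidHom.toAdditive (Units.map ((res σ : 𝓞 E →+* 𝓞 E) : 𝓞 E →* 𝓞 E))
  have hS : ∀ a : Additive (𝓞 E)ˣ, ((S a).toMul : 𝓞 E) = res σ (a.toMul : 𝓞 E) := fun a => rfl
  have hSpow : ∀ (i : ℕ) (a : Additive (𝓞 E)ˣ),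
      (((S ^ i : AddMonoid.End _) a).toMul : 𝓞 E) = res (σ ^ i) (a.toMul : 𝓞 E) := by
    intro i
    induction i with
    | zero => intro a; simp
    | succ i ih =>
      intro a
      rw [pow_succ', pow_succ', map_mul]
      exact (hS _).trans (congrArg _ (ih a))
  have hSp : S ^ p = 1 := by
    refine AddMonoidHom.ext fun a => ?_
    have := hSpow p (Additive.ofMul a)
    rw [← ho, pow_orderOf_eq_one, map_one] at this
    have h2 : (((S ^ orderOf σ : AddMonoid.End _) (Additive.ofMul a)).toMul) = a := Units.ext this
    rw [ho] at h2
    exact h2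
  have hN : ∀ a : Additive (𝓞 E)ˣ,
      algebraMap (𝓞 E) E ((∑ i ∈ Finset.range p, S ^ i : AddMonoid.End _) a).toMul =
        algebraMap L E (Algebra.norm L (algebraMap (𝓞 E) E a.toMul)) := by
    intro a
    rw [Algebra.norm_eq_prod_automorphisms, prod_eq_prod_range_of_generator hσ hdeg,
      end_sum_apply, toMul_sum, Units.coe_prod, map_prod (algebraMap (𝓞 E) E)]
    refine Finset.prod_congr rfl fun i _ => ?_
    rw [hSpow, coe_galRestrict]
  have hN0 : ∀ a : Additive (𝓞 E)ˣ, (∑ i ∈ Finset.range p, S ^ i : AddMonoid.End _) a = 0 ↔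
      Algebra.norm L (algebraMap (𝓞 E) E a.toMul) = 1 := by
    intro a
    rw [← (algebraMap L E).injective.eq_iff, ← hN, map_one]
    constructor
    · intro h; rw [h]; simp
    · intro h
      have h1 : ((∑ i ∈ Finset.range p, S ^ i : AddMonoid.End _) a).toMul = 1 :=
        Units.ext (RingOfIntegers.coe_injective (by simpa using h))
      exact h1
  -- units of the base are the fixed points
  let j : Additive (𝓞 L)ˣ →+ AddMonoidHom.ker (S - 1) :=
    AddMonoidHom.codRestrict
      (MonoidHom.toAdditive (Units.map (algebraMap (𝓞 L) (𝓞 E) : 𝓞 L →* 𝓞 E))) _ <| by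
        intro a
        refine sub_eq_zero.2 ?_
        refine congrArg Additive.ofMul (Units.ext ?_)
        exact (res σ).commutes _
  have hj : Function.Bijective j := by
    constructor
    · intro a b hab
      have h1 : algebraMap (𝓞 L) (𝓞 E) (a.toMul : 𝓞 L) = algebraMap (𝓞 L) (𝓞 E) (b.toMul : 𝓞 L) :=
        congrArg Units.val (congrArg Additive.toMul (congrArg Subtype.val hab))
      exact Units.ext (FaithfulSMul.algebraMap_injective (𝓞 L) (𝓞 E) h1)
    · rintro ⟨a, ha⟩
      have ha1 : S a = a := sub_eq_zero.1 ha
      have ha2 : ∀ i : ℕ, (S ^ i : AddMonoid.End _) a = a := by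
        intro i
        induction i with
        | zero => rfl
        | succ i ih => rw [pow_succ']; exact (congrArg S ih).trans ha1
      have hfix : ∀ b : Additive (𝓞 E)ˣ, (∀ i : ℕ, (S ^ i : AddMonoid.End _) b = b) →
          ∃ y : 𝓞 L, algebraMap (𝓞 L) (𝓞 E) y = (b.toMul : 𝓞 E) := by
        intro b hb
        refine exists_algebraMap_eq_of_fixed _ fun τ => ?_
        obtain ⟨i, rfl⟩ : ∃ i : ℕ, σ ^ i = τ := by
          simpa [mem_powers_iff_mem_zpowers.symm, Submonoid.mem_powers_iff] using hσ τ
        rw [← hSpow, hb]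
      obtain ⟨y, hy⟩ := hfix a ha2
      obtain ⟨y', hy'⟩ := hfix (-a) fun i => by rw [map_neg, ha2]
      have hyy : y * y' = 1 := by
        apply FaithfulSMul.algebraMap_injective (𝓞 L) (𝓞 E)
        rw [map_mul, hy, hy', map_one, toMul_neg, Units.mul_inv]
      exact ⟨Additive.ofMul (Units.mkOfMulEqOne y y' hyy), Subtype.ext (Units.ext hy)⟩
  let e := AddEquiv.ofBijective j hj
  have hrL := rank_add_one_eq_of_isPrimitiveRoot hζ hp2
  have hrE :=
    rank_add_one_eq_of_isPrimitiveRoot (hζ.map_of_injective (algebraMap L E).injective) hp2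
  have hmul : finrank ℚ L * p = finrank ℚ E := by rw [← hdeg, finrank_mul_finrank]
  have hrk : (p - 1) * (Units.rank L + 1) ≤
      finrank ℤ (AddMonoidHom.ker (∑ i ∈ Finset.range p, S ^ i : AddMonoid.End _)) := by
    let N : Additive (𝓞 E)ˣ →ₗ[ℤ] Additive (𝓞 E)ˣ :=
      AddMonoidHom.toIntLinearMap (∑ i ∈ Finset.range p, S ^ i : AddMonoid.End _)
    have h1 := Submodule.finrank_quotient_add_finrank (LinearMap.ker N)
    rw [LinearEquiv.finrank_eq N.quotKerEquivRange] at h1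
    have h2 : finrank ℤ (LinearMap.range N) ≤ Units.rank L := by
      let F := AddSubgroup.toIntSubmodule (AddMonoidHom.ker (S - 1))
      have hle : LinearMap.range N ≤ F := by
        rintro _ ⟨a, rfl⟩
        have h0 : (S - 1) * ∑ i ∈ Finset.range p, S ^ i = 0 :=
          (mul_geom_sum S p).trans (sub_eq_zero.2 hSp)
        exact DFunLike.congr_fun h0 a
      refine (Submodule.finrank_mono hle).trans ?_
      rw [← Units.finrank_eq]
      exact (LinearEquiv.finrank_eq e.toIntLinearEquiv).ge
    have h3 : finrank ℤ (AddMonoidHom.ker (∑ i ∈ Finset.range p, S ^ i : AddMonoid.End _)) =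
        finrank ℤ (LinearMap.ker N) := rfl
    rw [Units.finrank_eq] at h1
    have h4 : p * (Units.rank L + 1) = Units.rank E + 1 := by
      have : 2 * (p * (Units.rank L + 1)) = 2 * (Units.rank E + 1) := by
        rw [hrE, ← hmul, ← hrL]; ring
      omega
    rw [h3, Nat.sub_mul]
    omega
  -- the root of unity
  have hζi : IsIntegral ℤ (algebraMap L E ζ) := (hζ.isIntegral hp.out.pos).algebraMap
  obtain ⟨w, hw⟩ := exists_ringOfIntegers_eq hζi
  have hwp : w ^ p = 1 := RingOfIntegers.coe_injective (by
    rw [map_pow, hw, ← map_pow, hζ.pow_eq_one]; simp)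
  let z : (𝓞 E)ˣ := Units.ofPowEqOne w p hwp hp.out.ne_zero
  obtain ⟨b, hb1, hb2⟩ := exists_mem_ker_norm_not_mem_range p S (Units.rank L + 1) hSp
    (by rw [index_range_nsmul_congr e]; exact index_units_pow_dvd p) hrk
    (Additive.ofMul z) (by
      intro h
      have h1 : z = 1 := h
      have h2 : w = 1 := congrArg Units.val h1
      apply hζ.ne_one (by omega : 1 < p)
      apply (algebraMap L E).injective
      rw [← hw, h2]; simp)
    (by
      have : z ^ p = 1 := Units.ext (by simp [z])
      exact this)
    (by
      rw [hN0]
      show Algebra.norm L (algebraMap (𝓞 E) E w) = 1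
      rw [hw, Algebra.norm_algebraMap, hdeg, hζ.pow_eq_one])
  refine ⟨b.toMul, (hN0 b).1 hb1, fun a ha => hb2 (Additive.ofMul a) ?_⟩
  rw [sub_eq_iff_eq_add]
  exact Units.ext ha

/-- A cyclic extension of odd prime degree `p` of a number field containing the `p`-th roots of
unity, generated by an integer whose conjugates differ by units, forces `p` to divide the class
number. -/
theorem dvd_classNumber_of_cyclic {p : ℕ} [hp : Fact p.Prime] (hp2 : 2 < p) {ζ : L}
    (hζ : IsPrimitiveRoot ζ p) {σ : Gal(E/L)} (hσ : ∀ τ, τ ∈ Subgroup.zpowers σ)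
    (hdeg : finrank L E = p)
    (β : 𝓞 E) (hβ : ∀ τ : Gal(E/L), τ ≠ 1 → IsUnit (β - res τ β)) :
    p ∣ classNumber L := by
  obtain ⟨η, hη1, hη2⟩ := exists_unit_norm_eq_one_not_coboundary hp2 hζ hσ hdeg
  have : IsCyclic Gal(E/L) := ⟨σ, hσ⟩
  obtain ⟨ε, hε0, hε⟩ := groupCohomology.exists_mul_galRestrict_of_norm_eq_one (A := 𝓞 L) (K := L)
    (L := E) (B := 𝓞 E) hσ hη1
  set I : Ideal (𝓞 E) := Ideal.span {ε}
  have hstab : ∀ (τ : Gal(E/L)), ∀ x ∈ I, res τ x ∈ I := by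
    have h1 : ∀ x ∈ I, res σ x ∈ I := by
      intro x hx
      obtain ⟨c, rfl⟩ := Ideal.mem_span_singleton'.1 hx
      rw [map_mul]
      refine Ideal.mul_mem_left _ _ (Ideal.mem_span_singleton'.2 ⟨((η⁻¹ : (𝓞 E)ˣ) : 𝓞 E), ?_⟩)
      conv_lhs => rw [← hε]
      rw [Units.inv_mul_cancel_left]
    intro τ x hx
    obtain ⟨i, rfl⟩ : ∃ i : ℕ, σ ^ i = τ := by
      simpa [mem_powers_iff_mem_zpowers.symm, Submonoid.mem_powers_iff] using hσ τ
    induction i with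
    | zero => simpa using hx
    | succ i ih =>
      rw [pow_succ', map_mul]
      exact h1 _ ih
  set J := I.comap (algebraMap (𝓞 L) (𝓞 E)) with hJ
  have hIJ : J.map (algebraMap (𝓞 L) (𝓞 E)) = I := map_comap_eq_of_stable β hβ I hstab
  have hI0 : I ≠ ⊥ := by simpa [I] using hε0
  have hJ0 : J ≠ ⊥ := by
    rintro h
    rw [h, Ideal.map_bot] at hIJ
    exact hI0 hIJ.symm
  have hJp : (J ^ p).IsPrincipal := by
    have h1 := Ideal.relNorm_algebraMap (R := 𝓞 L) (𝓞 E) J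
    have h2 : finrank (𝓞 L) (𝓞 E) = p := by
      rw [← hdeg]
      exact (IsFractionRing.finrank_eq (𝓞 L) L (𝓞 E) E).symm
    rw [hIJ, Ideal.relNorm_singleton, h2] at h1
    rw [← h1]
    exact ⟨_, rfl⟩
  have hJnp : ¬ J.IsPrincipal := by
    rintro ⟨c, hc⟩
    have hc' : J = Ideal.span {c} := hc
    rw [hc', Ideal.map_span, Set.image_singleton, Ideal.span_singleton_eq_span_singleton] at hIJ
    obtain ⟨v, hv⟩ := hIJ
    have hc0 : algebraMap (𝓞 L) (𝓞 E) c ≠ 0 := by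
      intro h0
      rw [h0, zero_mul] at hv
      exact hε0 hv.symm
    apply hη2 v⁻¹
    have hv1 : (η : 𝓞 E) * res σ (v : 𝓞 E) = v := by
      rw [← hv, map_mul, AlgEquiv.commutes] at hε
      apply mul_left_cancel₀ hc0
      linear_combination hε
    have h2 : res σ (v : 𝓞 E) * res σ ((v⁻¹ : (𝓞 E)ˣ) : 𝓞 E) = 1 := by
      rw [← map_mul, Units.mul_inv, map_one]
    have h3 : (v : 𝓞 E) * ((v⁻¹ : (𝓞 E)ˣ) : 𝓞 E) = 1 := Units.mul_inv _
    have h4 : (η : 𝓞 E) * ((v⁻¹ : (𝓞 E)ˣ) : 𝓞 E) * (res σ (v : 𝓞 E)) = 1 := by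
      linear_combination h3 + ((v⁻¹ : (𝓞 E)ˣ) : 𝓞 E) * hv1
    linear_combination (-res σ ((v⁻¹ : (𝓞 E)ˣ) : 𝓞 E)) * h4 +
      (η : 𝓞 E) * ((v⁻¹ : (𝓞 E)ˣ) : 𝓞 E) * h2
  let J' : nonZeroDivisors (Ideal (𝓞 L)) := ⟨J, mem_nonZeroDivisors_of_ne_zero hJ0⟩
  have ho : orderOf (ClassGroup.mk0 J') = p := by
    refine orderOf_eq_prime ?_ ?_
    · rw [← map_pow, ClassGroup.mk0_eq_one_iff]
      exact hJp
    · rw [Ne, ClassGroup.mk0_eq_one_iff]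
      exact hJnp
  rw [← ho, classNumber]
  exact orderOf_dvd_card

end Galois

end

section

open Module NumberField Polynomial

section Cyclo

variable {R : Type*} [CommRing R] [IsDomain R] {p : ℕ} {ζ : R}

/-- `p` is, up to a unit, the `(p-1)`-st power of `ζ - 1`. -/
lemma associated_pow_sub_one_natCast (hp : p.Prime) (hζ : IsPrimitiveRoot ζ p) :
    Associated ((ζ - 1) ^ (p - 1)) (p : R) := by
  obtain ⟨n, rfl⟩ : ∃ n, p = n + 1 := ⟨p - 1, (Nat.sub_add_cancel hp.one_le).symm⟩
  have h := hζ.prod_one_sub_pow_eq_order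
  push_cast
  rw [← h]
  have h2 : (ζ - 1) ^ n = ∏ k ∈ Finset.range n, (ζ - 1) := by simp
  rw [h2]
  refine Associated.prod _ _ _ fun k hk => ?_
  have hk' : (k + 1).Coprime (n + 1) := by
    refine Nat.Coprime.symm ((Nat.Prime.coprime_iff_not_dvd hp).2 fun h => ?_)
    have := Nat.le_of_dvd (Nat.succ_pos k) h
    simp only [Finset.mem_range] at hk
    omega
  rw [← neg_sub (ζ ^ (k + 1)) 1]
  exact (hζ.associated_sub_one_pow_sub_one_of_coprime hk').neg_right

end Cyclo

lemma isIntegral_of_mul_add_pow_eq {A B : Type*} [CommRing A] [IsDomain A] [CommRing B] [IsDomain B]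
    [Algebra A B] [FaithfulSMul A B] {p : ℕ} (hp : p.Prime) {π u c : A} (hπ : π ≠ 0)
    (hπp : π ^ (p - 1) ∣ (p : A)) (hu : π ^ p ∣ u - c ^ p) {β : B}
    (hβ : (algebraMap A B π * β + algebraMap A B c) ^ p = algebraMap A B u) :
    IsIntegral A β := by
  obtain ⟨e, he⟩ := hu
  have hinj := FaithfulSMul.algebraMap_injective A B
  have h1 : ∀ k : ℕ, ∃ a : A, k ∈ Finset.Ioo 0 p → π ^ (p - k) * a = c ^ (p - k) * p.choose k := by
    intro k
    by_cases hk : k ∈ Finset.Ioo 0 p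
    · rw [Finset.mem_Ioo] at hk
      have h2 : π ^ (p - k) ∣ c ^ (p - k) * p.choose k := by
        refine Dvd.dvd.mul_left (((pow_dvd_pow π (by omega)).trans hπp).trans ?_) _
        exact_mod_cast Nat.cast_dvd_cast (α := A) (hp.dvd_choose_self (by omega) hk.2)
      obtain ⟨a, ha⟩ := h2
      exact ⟨a, fun _ => ha.symm⟩
    · exact ⟨0, fun h => absurd h hk⟩
  choose a ha using h1
  let Q : A[X] := ∑ k ∈ Finset.Ioo 0 p, C (a k) * X ^ k - C e
  have hQ : Q.degree < p := by
    refine (degree_sub_le _ _).trans_lt (max_lt ?_ (degree_C_le.trans_lt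
        (by exact_mod_cast hp.pos)))
    refine (degree_sum_le _ _).trans_lt ?_
    rw [Finset.sup_lt_iff (by exact_mod_cast WithBot.bot_lt_coe p)]
    intro k hk
    refine (degree_C_mul_X_pow_le _ _).trans_lt ?_
    exact_mod_cast (Finset.mem_Ioo.1 hk).2
  refine ⟨X ^ p + Q, monic_X_pow_add hQ, ?_⟩
  have hπB : algebraMap A B π ^ p ≠ 0 := pow_ne_zero _ (by
    rw [Ne, map_eq_zero_iff _ hinj]; exact hπ)
  apply mul_left_cancel₀ hπB
  rw [mul_zero]
  have hexp : (algebraMap A B π * β + algebraMap A B c) ^ p = algebraMap A B c ^ p +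
      algebraMap A B π ^ p * (β ^ p + ∑ k ∈ Finset.Ioo 0 p, algebraMap A B (a k) * β ^ k) := by
    rw [add_pow, Finset.sum_range_succ, Finset.range_eq_Ico, Finset.sum_eq_sum_Ico_succ_bot hp.pos]
    have h3 : Finset.Ico (0 + 1) p = Finset.Ioo 0 p := by
      ext; simp only [Finset.mem_Ico, Finset.mem_Ioo]; omega
    rw [h3, mul_add, Finset.mul_sum]
    have h4 : ∀ k ∈ Finset.Ioo 0 p, (algebraMap A B π * β) ^ k * algebraMap A B c ^ (p - k) *
        (p.choose k : B) = algebraMap A B π ^ p * (algebraMap A B (a k) * β ^ k) := by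
      intro k hk
      have h5 := congrArg (algebraMap A B) (ha k hk)
      simp only [map_mul, map_pow, map_natCast] at h5
      have h6 : algebraMap A B π ^ p = algebraMap A B π ^ k * algebraMap A B π ^ (p - k) := by
        rw [← pow_add, Nat.add_sub_cancel' (Finset.mem_Ioo.1 hk).2.le]
      rw [h6, mul_pow]
      linear_combination (-(algebraMap A B π ^ k * β ^ k)) * h5
    rw [Finset.sum_congr rfl h4]
    simp
    ring
  have he' := congrArg (algebraMap A B) he
  simp only [map_mul, map_pow, map_sub] at he'
  rw [hexp] at hβ
  simp only [Q, eval₂_add, eval₂_sub, eval₂_X_pow, eval₂_finsetSum, eval₂_mul, eval₂_C]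
  linear_combination he' + hβ

/-- **Kummer's lemma** for a number field containing the `p`-th roots of unity whose class number
is prime to `p`. -/
theorem exists_pow_eq_of_dvd_sub_pow {L : Type} [Field L] [NumberField L] {p : ℕ}
    [hp : Fact p.Prime] (hp2 : 2 < p) {ζ : 𝓞 L} (hζ : IsPrimitiveRoot ζ p)
    (hreg : ¬ p ∣ classNumber L) (u : (𝓞 L)ˣ) (c : 𝓞 L) (hc : (ζ - 1) ^ p ∣ (u : 𝓞 L) - c ^ p) :
    ∃ v : L, v ^ p = algebraMap (𝓞 L) L u := by
  by_contra! hcon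
  apply hreg
  have hζL : IsPrimitiveRoot (algebraMap (𝓞 L) L ζ) p :=
    hζ.map_of_injective RingOfIntegers.coe_injective
  have H := X_pow_sub_C_irreducible_of_prime hp.out hcon
  have hprim : (primitiveRoots p L).Nonempty := ⟨_, (mem_primitiveRoots hp.out.pos).2 hζL⟩
  let P : L[X] := X ^ p - C (algebraMap (𝓞 L) L u)
  let E := P.SplittingField
  have : IsSplittingField L E (X ^ p - C (algebraMap (𝓞 L) L u)) :=
    inferInstanceAs (IsSplittingField L P.SplittingField P)
  have : FiniteDimensional L E := IsSplittingField.finiteDimensional E P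
  have : NumberField E := NumberField.of_module_finite L E
  have hgal : IsGalois L E := isGalois_of_isSplittingField_X_pow_sub_C hprim H E
  obtain ⟨σ, hσ⟩ := isCyclic_of_isSplittingField_X_pow_sub_C hprim H E
  have hdeg : finrank L E = p := finrank_of_isSplittingField_X_pow_sub_C hprim H E
  let w : E := rootOfSplitsXPowSubC (NeZero.pos p) (algebraMap (𝓞 L) L u) E
  have hw : w ^ p = algebraMap L E (algebraMap (𝓞 L) L u) := rootOfSplitsXPowSubC_pow _ E
  have hπ0 : ζ - 1 ≠ 0 := sub_ne_zero.2 (hζ.ne_one hp.out.one_lt)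
  have hπE : algebraMap L E (algebraMap (𝓞 L) L (ζ - 1)) ≠ 0 := by
    rw [Ne, map_eq_zero_iff _ (algebraMap L E).injective,
      map_eq_zero_iff _ RingOfIntegers.coe_injective]
    exact hπ0
  let b : E :=
    (w - algebraMap L E (algebraMap (𝓞 L) L c)) / algebraMap L E (algebraMap (𝓞 L) L (ζ - 1))
  have hbint : IsIntegral (𝓞 L) b := by
    refine isIntegral_of_mul_add_pow_eq hp.out hπ0 (associated_pow_sub_one_natCast hp.out hζ).dvd
      hc (B := E) ?_
    rw [IsScalarTower.algebraMap_apply (𝓞 L) L E, IsScalarTower.algebraMap_apply (𝓞 L) L E,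
      IsScalarTower.algebraMap_apply (𝓞 L) L E (u : 𝓞 L), mul_div_cancel₀ _ hπE, sub_add_cancel, hw]
  obtain ⟨β, hβ⟩ := exists_ringOfIntegers_eq (isIntegral_trans (R := ℤ) b hbint)
  have hwint : IsIntegral ℤ w := by
    refine IsIntegral.of_pow hp.out.pos ?_
    rw [hw]
    exact (RingOfIntegers.isIntegral_coe _).algebraMap
  obtain ⟨w', hw'⟩ := exists_ringOfIntegers_eq hwint
  have hw'u : IsUnit w' := by
    rw [← isUnit_pow_iff hp.out.ne_zero]
    have : w' ^ p = algebraMap (𝓞 L) (𝓞 E) u := by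
      apply RingOfIntegers.coe_injective
      rw [map_pow, hw', hw]
      rfl
    rw [this]
    exact u.isUnit.map _
  refine dvd_classNumber_of_cyclic hp2 hζL hσ hdeg β fun τ hτ => ?_
  have hτw := autEquivRootsOfUnity_smul hprim H E hw τ
  set η := autEquivRootsOfUnity hprim H E τ with hη
  have hη1 : η ≠ 1 := by
    rw [hη, Ne, EmbeddingLike.map_eq_one_iff]
    exact hτ
  obtain ⟨i, hi, hi2⟩ := hζL.eq_pow_of_pow_eq_one
    (show ((η : Lˣ) : L) ^ p = 1 by
      have := η.2; rw [mem_rootsOfUnity] at this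
      rw [← Units.val_pow_eq_pow_val, this, Units.val_one])
  have hi0 : i ≠ 0 := by
    rintro rfl
    apply hη1
    ext
    simpa using hi2.symm
  have hcop : i.Coprime p := Nat.Coprime.symm ((Nat.Prime.coprime_iff_not_dvd hp.out).2
    fun h => absurd (Nat.le_of_dvd (Nat.pos_of_ne_zero hi0) h) (by omega))
  obtain ⟨v, hv⟩ := hζ.associated_sub_one_pow_sub_one_of_coprime hcop
  have key : β - galRestrict (𝓞 L) L E (𝓞 E) τ β = -(w' * algebraMap (𝓞 L) (𝓞 E) v) := by
    apply RingOfIntegers.coe_injective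
    have hτb : τ b = (algebraMap L E (η : Lˣ) * w - algebraMap L E (algebraMap (𝓞 L) L c)) /
        algebraMap L E (algebraMap (𝓞 L) L (ζ - 1)) := by
      simp only [b]
      rw [map_div₀, map_sub, AlgEquiv.commutes, AlgEquiv.commutes, ← hτw]
      rw [Subgroup.smul_def, Units.smul_def, Algebra.smul_def]
    have hvE : algebraMap (𝓞 E) E (algebraMap (𝓞 L) (𝓞 E) v) =
        algebraMap L E (algebraMap (𝓞 L) L v) :=
      rfl
    have hvv := congrArg (fun x => algebraMap L E (algebraMap (𝓞 L) L x)) hv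
    simp only [map_mul, map_pow, map_sub, map_one] at hvv
    rw [map_sub, coe_galRestrict, hβ, hτb, map_neg, map_mul, hw', hvE, ← hi2]
    simp only [b]
    rw [← sub_div, div_eq_iff hπE]
    simp only [map_sub, map_one, map_pow]
    linear_combination w * hvv
  rw [key]
  exact (hw'u.mul (v.isUnit.map _)).neg

end

section

open NumberField IsDedekindDomain

section Order

variable {L : Type} [Field L] [NumberField L]

/-- The (additive) order of `x` at the prime `q`, with the convention that `0` has order `0`. -/
noncomputable def ord (q : HeightOneSpectrum (𝓞 L)) (x : L) : ℤ :=
  -WithZero.log (q.valuation L x)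

/-- `x` has order at least `k` at the prime `q`; this holds for `x = 0`. -/
def OrdGe (q : HeightOneSpectrum (𝓞 L)) (k : ℤ) (x : L) : Prop :=
  q.valuation L x ≤ WithZero.exp (-k)

variable {q : HeightOneSpectrum (𝓞 L)} {x y : L} {k l : ℤ}

lemma valuation_ne_zero_of_ne_zero (hx : x ≠ 0) : q.valuation L x ≠ 0 :=
  (Valuation.ne_zero_iff _).2 hx

lemma ord_one : ord q (1 : L) = 0 := by simp [ord]

lemma ord_mul (hx : x ≠ 0) (hy : y ≠ 0) : ord q (x * y) = ord q x + ord q y := by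
  rw [ord, map_mul, WithZero.log_mul (valuation_ne_zero_of_ne_zero hx)
    (valuation_ne_zero_of_ne_zero hy), ord, ord]
  ring

lemma ord_pow (n : ℕ) : ord q (x ^ n) = n * ord q x := by
  rw [ord, map_pow, WithZero.log_pow, ord]
  simp

lemma ord_inv : ord q x⁻¹ = -ord q x := by
  rw [ord, map_inv₀, WithZero.log_inv, ord]

lemma ord_div (hx : x ≠ 0) (hy : y ≠ 0) : ord q (x / y) = ord q x - ord q y := by
  rw [div_eq_mul_inv, ord_mul hx (inv_ne_zero hy), ord_inv, sub_eq_add_neg]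

lemma ord_neg : ord q (-x) = ord q x := by
  rw [ord, Valuation.map_neg, ord]

lemma ord_prod {ι : Type*} (s : Finset ι) (f : ι → L) (h : ∀ i ∈ s, f i ≠ 0) :
    ord q (∏ i ∈ s, f i) = ∑ i ∈ s, ord q (f i) := by
  classical
  induction s using Finset.induction_on with
  | empty => simp [ord_one]
  | insert a s ha ih =>
    rw [Finset.prod_insert ha, Finset.sum_insert ha, ord_mul (h a (Finset.mem_insert_self a s))
      (Finset.prod_ne_zero_iff.2 fun i hi => h i (Finset.mem_insert_of_mem hi)),
      ih fun i hi => h i (Finset.mem_insert_of_mem hi)]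

lemma ord_eq_zero_of_pow_eq_one {n : ℕ} (hn : n ≠ 0) (h : x ^ n = 1) : ord q x = 0 := by
  have h1 := ord_pow (q := q) (x := x) n
  rw [h, ord_one, eq_comm, mul_eq_zero] at h1
  exact h1.resolve_left (by exact_mod_cast hn)

lemma ordGe_iff (hx : x ≠ 0) : OrdGe q k x ↔ k ≤ ord q x := by
  rw [OrdGe, ord, ← WithZero.log_le_iff_le_exp (valuation_ne_zero_of_ne_zero hx)]
  constructor <;> intro h <;> linarith

lemma ordGe_zero : OrdGe q k (0 : L) := by simp [OrdGe]

lemma OrdGe.mono (h : OrdGe q k x) (hlk : l ≤ k) : OrdGe q l x :=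
  le_trans h (WithZero.exp_le_exp.2 (by linarith))

lemma OrdGe.add (hx : OrdGe q k x) (hy : OrdGe q k y) : OrdGe q k (x + y) :=
  (Valuation.map_add _ x y).trans (max_le hx hy)

lemma OrdGe.neg (hx : OrdGe q k x) : OrdGe q k (-x) := by
  rwa [OrdGe, Valuation.map_neg]

lemma OrdGe.sub (hx : OrdGe q k x) (hy : OrdGe q k y) : OrdGe q k (x - y) := by
  rw [sub_eq_add_neg]
  exact hx.add hy.neg

lemma OrdGe.symm (h : OrdGe q k (x - y)) : OrdGe q k (y - x) := by
  rw [← neg_sub]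
  exact h.neg

lemma OrdGe.trans {z : L} (h : OrdGe q k (x - y)) (h' : OrdGe q k (y - z)) : OrdGe q k (x - z) := by
  rw [← sub_add_sub_cancel x y z]
  exact h.add h'

lemma OrdGe.mul (hx : OrdGe q k x) (hy : OrdGe q l y) : OrdGe q (k + l) (x * y) := by
  rw [OrdGe, map_mul, neg_add, WithZero.exp_add]
  exact mul_le_mul' hx hy

lemma OrdGe.mul_left (hx : OrdGe q k x) (hy : OrdGe q 0 y) : OrdGe q k (y * x) := by
  simpa using hy.mul hx

lemma OrdGe.mul_right (hx : OrdGe q k x) (hy : OrdGe q 0 y) : OrdGe q k (x * y) := by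
  simpa using hx.mul hy

lemma OrdGe.pow (hx : OrdGe q k x) (n : ℕ) : OrdGe q (n * k) (x ^ n) := by
  induction n with
  | zero => simp [OrdGe]
  | succ n ih =>
    rw [pow_succ]
    convert ih.mul hx using 1
    push_cast
    ring

lemma OrdGe.sum {ι : Type*} (s : Finset ι) (f : ι → L) (h : ∀ i ∈ s, OrdGe q k (f i)) :
    OrdGe q k (∑ i ∈ s, f i) := by
  classical
  induction s using Finset.induction_on with
  | empty => simpa using ordGe_zero
  | insert a s ha ih =>
    rw [Finset.sum_insert ha]
    exact (h a (Finset.mem_insert_self a s)).add (ih fun i hi => h i (Finset.mem_insert_of_mem hi))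

lemma ordGe_ord (x : L) : OrdGe q (ord q x) x := by
  rcases eq_or_ne x 0 with rfl | hx
  · exact ordGe_zero
  · exact (ordGe_iff hx).2 le_rfl

lemma ordGe_algebraMap (a : 𝓞 L) : OrdGe q 0 (algebraMap (𝓞 L) L a) := by
  simpa [OrdGe] using q.valuation_le_one a

lemma ordGe_intCast (n : ℤ) : OrdGe q 0 (n : L) := by
  simpa using ordGe_algebraMap (q := q) (n : 𝓞 L)

lemma ordGe_natCast (n : ℕ) : OrdGe q 0 (n : L) := by
  simpa using ordGe_algebraMap (q := q) (n : 𝓞 L)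

lemma ordGe_one : OrdGe q 0 (1 : L) := by
  simpa using ordGe_natCast (q := q) 1

lemma ordGe_of_isIntegral (h : IsIntegral ℤ x) : OrdGe q 0 x := by
  obtain ⟨a, rfl⟩ := exists_ringOfIntegers_eq h
  exact ordGe_algebraMap a

lemma ordGe_zero_of_pow_eq_one {n : ℕ} (hn : n ≠ 0) (h : x ^ n = 1) : OrdGe q 0 x := by
  rw [← ord_eq_zero_of_pow_eq_one hn h (q := q)]
  exact ordGe_ord x

lemma ord_unit (u : (𝓞 L)ˣ) : ord q (algebraMap (𝓞 L) L u) = 0 := by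
  have h0 : ∀ w : (𝓞 L)ˣ, algebraMap (𝓞 L) L w ≠ 0 := fun w => by
    rw [Ne, map_eq_zero_iff _ RingOfIntegers.coe_injective]
    exact w.ne_zero
  have h1 := (ordGe_iff (h0 u)).1 (ordGe_algebraMap (q := q) (u : 𝓞 L))
  have h2 := (ordGe_iff (h0 u⁻¹)).1 (ordGe_algebraMap (q := q) ((u⁻¹ : (𝓞 L)ˣ) : 𝓞 L))
  have h3 := ord_mul (q := q) (h0 u) (h0 u⁻¹)
  rw [← map_mul, Units.mul_inv, map_one, ord_one] at h3
  omega

lemma ordGe_one_iff_mem (a : 𝓞 L) : OrdGe q 1 (algebraMap (𝓞 L) L a) ↔ a ∈ q.asIdeal := by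
  rw [OrdGe, HeightOneSpectrum.valuation_of_algebraMap]
  have := q.intValuation_le_pow_iff_mem a 1
  simpa using this

/-- An element that is congruent to `x` to higher order has the same order as `x`. -/
lemma ord_eq_of_ordGe_sub (hx : x ≠ 0) (h : OrdGe q (ord q x + 1) (y - x)) :
    y ≠ 0 ∧ ord q y = ord q x := by
  have hy : y ≠ 0 := by
    rintro rfl
    rw [zero_sub] at h
    have h1 := h.neg
    rw [neg_neg, ordGe_iff hx] at h1
    omega
  refine ⟨hy, le_antisymm ?_ ?_⟩
  · by_contra! hlt
    have h2 : OrdGe q (ord q x + 1) (y - (y - x)) :=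
      ((ordGe_ord y).mono (by omega)).sub h
    rw [sub_sub_cancel, ordGe_iff hx] at h2
    omega
  · have h2 : OrdGe q (ord q x) (y - x + x) := (h.mono (by omega)).add (ordGe_ord x)
    rwa [sub_add_cancel, ordGe_iff hy] at h2

lemma exists_algebraMap_eq_of_ordGe (h : ∀ q : HeightOneSpectrum (𝓞 L), OrdGe q 0 x) :
    ∃ a : 𝓞 L, algebraMap (𝓞 L) L a = x :=
  HeightOneSpectrum.mem_integers_of_valuation_le_one L x fun q => by simpa [OrdGe] using h q

lemma exists_unit_eq_of_ord (hx : x ≠ 0) (h : ∀ q : HeightOneSpectrum (𝓞 L), ord q x = 0) :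
    ∃ u : (𝓞 L)ˣ, algebraMap (𝓞 L) L u = x := by
  obtain ⟨a, ha⟩ := exists_algebraMap_eq_of_ordGe fun q => (ordGe_iff hx).2 (h q).ge
  obtain ⟨b, hb⟩ := exists_algebraMap_eq_of_ordGe fun q =>
    (ordGe_iff (inv_ne_zero hx)).2 (by rw [ord_inv, h q, neg_zero] : ord q x⁻¹ = 0).ge
  have hab : a * b = 1 := by
    apply RingOfIntegers.coe_injective
    rw [map_mul, ha, hb, mul_inv_cancel₀ hx, map_one]
  exact ⟨⟨a, b, hab, by rw [mul_comm, hab]⟩, ha⟩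

end Order

section Regular

/-- An ideal all of whose multiplicities are divisible by `n` is an `n`-th power. -/
lemma exists_pow_eq_of_dvd_count {A : Type*} [CommRing A] [IsDedekindDomain A] {I : Ideal A}
    (hI : I ≠ 0) {n : ℕ} (hn : n ≠ 0) (h : ∀ q : HeightOneSpectrum A,
      n ∣ (Associates.mk q.asIdeal).count (Associates.mk I).factors) :
    ∃ J : Ideal A, J ^ n = I := by
  choose k hk using h
  refine ⟨∏ᶠ q : HeightOneSpectrum A, q.asIdeal ^ k q, ?_⟩
  rw [finprod_pow, ← Ideal.finprod_heightOneSpectrum_factorization hI]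
  · refine finprod_congr fun q => ?_
    rw [HeightOneSpectrum.maxPowDividing, hk q, ← pow_mul, mul_comm]
  · refine Set.Finite.subset (Filter.eventually_cofinite.mp (Associates.finite_factors hI)) ?_
    intro q hq h0
    apply hq
    have h1 := hk q
    rw [Int.natCast_eq_zero.mp h0, eq_comm, mul_eq_zero] at h1
    simp only [h1.resolve_left hn, pow_zero]

variable {L : Type} [Field L] [NumberField L] {p : ℕ}

lemma exists_unit_mul_pow_of_dvd_ord_algebraMap (hp : p.Prime) (hreg : ¬ p ∣ classNumber L)
    {a : 𝓞 L} (ha : a ≠ 0)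
    (h : ∀ q : HeightOneSpectrum (𝓞 L), (p : ℤ) ∣ ord q (algebraMap (𝓞 L) L a)) :
    ∃ (u : (𝓞 L)ˣ) (c : 𝓞 L), a = u * c ^ p := by
  have hI : Ideal.span {a} ≠ 0 := by simpa using ha
  obtain ⟨J, hJ⟩ := exists_pow_eq_of_dvd_count hI hp.ne_zero fun q => by
    have h1 := h q
    rw [ord, HeightOneSpectrum.valuation_of_algebraMap, q.intValuation_if_neg ha,
      WithZero.log_exp, neg_neg] at h1
    exact_mod_cast h1
  have hJ0 : J ≠ ⊥ := by
    rintro rfl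
    rw [← Ideal.zero_eq_bot, zero_pow hp.ne_zero] at hJ
    exact hI hJ.symm
  have hJn : J ∈ nonZeroDivisors (Ideal (𝓞 L)) := mem_nonZeroDivisors_of_ne_zero hJ0
  have h1 : ClassGroup.mk0 ⟨J, hJn⟩ ^ p = 1 := by
    rw [← map_pow, ClassGroup.mk0_eq_one_iff]
    change Submodule.IsPrincipal (J ^ p)
    rw [hJ]
    exact ⟨a, rfl⟩
  have h2 : ClassGroup.mk0 ⟨J, hJn⟩ = 1 := by
    have h3 := orderOf_dvd_of_pow_eq_one h1
    have h4 := orderOf_dvd_card (x := ClassGroup.mk0 ⟨J, hJn⟩)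
    rcases (Nat.dvd_prime hp).1 h3 with h5 | h5
    · exact orderOf_eq_one_iff.1 h5
    · exact absurd (h5 ▸ h4) hreg
  rw [ClassGroup.mk0_eq_one_iff] at h2
  obtain ⟨c, hc⟩ := h2
  have hc' : J = Ideal.span {c} := hc
  rw [hc', Ideal.span_singleton_pow, Ideal.span_singleton_eq_span_singleton] at hJ
  obtain ⟨u, hu⟩ := hJ
  exact ⟨u, c, by rw [← hu, mul_comm]⟩

/-- If `p` does not divide the class number, an element all of whose orders are divisible by `p`
is a unit times a `p`-th power. -/
lemma exists_unit_mul_pow_of_dvd_ord (hp : p.Prime) (hreg : ¬ p ∣ classNumber L) {x : L}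
    (hx : x ≠ 0) (h : ∀ q : HeightOneSpectrum (𝓞 L), (p : ℤ) ∣ ord q x) :
    ∃ (u : (𝓞 L)ˣ) (c : L), c ≠ 0 ∧ x = algebraMap (𝓞 L) L u * c ^ p := by
  obtain ⟨a, b, hb, rfl⟩ := IsFractionRing.div_surjective (A := 𝓞 L) x
  have hb0 : b ≠ 0 := nonZeroDivisors.ne_zero hb
  have hbL : algebraMap (𝓞 L) L b ≠ 0 := by
    rwa [Ne, map_eq_zero_iff _ RingOfIntegers.coe_injective]
  have haL : algebraMap (𝓞 L) L a ≠ 0 := fun h0 => hx (by rw [h0, zero_div])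
  have ha0 : a ≠ 0 := fun h0 => haL (by rw [h0, map_zero])
  have hbp : algebraMap (𝓞 L) L b ^ p = algebraMap (𝓞 L) L b ^ (p - 1) * algebraMap (𝓞 L) L b :=
    (pow_sub_one_mul hp.ne_zero _).symm
  have heq : algebraMap (𝓞 L) L (a * b ^ (p - 1)) =
      algebraMap (𝓞 L) L a / algebraMap (𝓞 L) L b * algebraMap (𝓞 L) L b ^ p := by
    rw [hbp, map_mul, map_pow]
    field_simp
  obtain ⟨u, c, hc⟩ := exists_unit_mul_pow_of_dvd_ord_algebraMap hp hreg
    (mul_ne_zero ha0 (pow_ne_zero (p - 1) hb0)) fun q => by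
      rw [heq, ord_mul hx (pow_ne_zero _ hbL), ord_pow]
      exact dvd_add (h q) (dvd_mul_right _ _)
  have hcL : algebraMap (𝓞 L) L c ≠ 0 := by
    intro h0
    rw [map_eq_zero_iff _ RingOfIntegers.coe_injective] at h0
    rw [h0, zero_pow hp.ne_zero, mul_zero] at hc
    exact mul_ne_zero ha0 (pow_ne_zero (p - 1) hb0) hc
  refine ⟨u, algebraMap (𝓞 L) L c / algebraMap (𝓞 L) L b, div_ne_zero hcL hbL, ?_⟩
  rw [hc, map_mul, map_pow] at heq
  rw [div_pow, mul_div_assoc', heq, mul_div_cancel_right₀ _ (pow_ne_zero _ hbL)]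

end Regular

end

section

open NumberField IsDedekindDomain Polynomial

section Factors

variable {L : Type} [Field L] [NumberField L] {p : ℕ} [hp : Fact p.Prime] {ζ : L}
  {q : HeightOneSpectrum (𝓞 L)}

lemma OrdGe.prod {ι : Type*} (s : Finset ι) (f : ι → L) {k : ℤ} (h : ∀ i ∈ s, OrdGe q k (f i)) :
    OrdGe q (s.card * k) (∏ i ∈ s, f i) := by
  classical
  induction s using Finset.induction_on with
  | empty => simpa using ordGe_one
  | insert a s ha ih =>
    rw [Finset.prod_insert ha, Finset.card_insert_of_notMem ha]
    convert (h a (Finset.mem_insert_self a s)).mul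
      (ih fun i hi => h i (Finset.mem_insert_of_mem hi))
      using 1
    push_cast
    ring

lemma ord_sub_one_le_of_pow (hζ : IsPrimitiveRoot ζ p) {ω : L} (hω : ω ^ p = 1) (h1 : ω ≠ 1) :
    ord q (ζ - 1) ≤ ord q (ω - 1) := by
  obtain ⟨i, -, rfl⟩ := hζ.eq_pow_of_pow_eq_one hω
  rw [← ordGe_iff (sub_ne_zero.2 h1), ← mul_geom_sum]
  refine (ordGe_ord _).mul_right (OrdGe.sum _ _ fun j _ => ?_)
  refine ordGe_zero_of_pow_eq_one hp.out.ne_zero ?_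
  rw [← pow_mul, mul_comm, pow_mul, hζ.pow_eq_one, one_pow]

lemma isPrimitiveRoot_of_pow_eq_one {ω : L} (hω : ω ^ p = 1) (h1 : ω ≠ 1) :
    IsPrimitiveRoot ω p := by
  rw [IsPrimitiveRoot.iff_orderOf]
  exact orderOf_eq_prime hω h1

lemma ord_sub_eq_of_pow_eq_one (hζ : IsPrimitiveRoot ζ p) {ω ω' : L} (hω : ω ^ p = 1)
    (hω' : ω' ^ p = 1) (hne : ω ≠ ω') : ord q (ω - ω') = ord q (ζ - 1) := by
  have h0 : ω' ≠ 0 := by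
    rintro rfl
    simp [hp.out.ne_zero] at hω'
  have h1 : ω / ω' ≠ 1 := fun h => hne (by rwa [div_eq_one_iff_eq h0] at h)
  have h2 : (ω / ω') ^ p = 1 := by rw [div_pow, hω, hω', div_one]
  have h3 : ω - ω' = ω' * (ω / ω' - 1) := by field_simp
  rw [h3, ord_mul h0 (sub_ne_zero.2 h1), ord_eq_zero_of_pow_eq_one hp.out.ne_zero hω', zero_add]
  exact le_antisymm (ord_sub_one_le_of_pow (isPrimitiveRoot_of_pow_eq_one h2 h1) hζ.pow_eq_one
    (hζ.ne_one hp.out.one_lt)) (ord_sub_one_le_of_pow hζ h2 h1)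

lemma pow_sub_one_eq_prod (hζ : IsPrimitiveRoot ζ p) (X : L) :
    X ^ p - 1 = ∏ ω ∈ nthRootsFinset p (1 : L), (X - ω) := by
  have := hζ.pow_sub_pow_eq_prod_sub_mul X 1 hp.out.pos
  simpa using this

lemma sub_ne_zero_of_pow_ne_one {X ω : L} (hX : X ^ p ≠ 1) (hω : ω ^ p = 1) : X - ω ≠ 0 := by
  rw [sub_ne_zero]
  rintro rfl
  exact hX hω

/-- The orders of the factors `X - ω` of `X ^ p - 1` are congruent modulo `p` as soon as the order
of `X ^ p - 1` is divisible by `p`. -/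
lemma dvd_ord_sub_sub_ord_sub (hζ : IsPrimitiveRoot ζ p) {X : L} (hX : X ^ p ≠ 1)
    (h : (p : ℤ) ∣ ord q (X ^ p - 1)) {ω ω' : L} (hω : ω ^ p = 1) (hω' : ω' ^ p = 1) :
    (p : ℤ) ∣ ord q (X - ω) - ord q (X - ω') := by
  classical
  have hmem : ∀ {η : L}, η ∈ nthRootsFinset p (1 : L) ↔ η ^ p = 1 := fun {η} =>
    mem_nthRootsFinset hp.out.pos (1 : L)
  set κ := ord q (ζ - 1) with hκ
  have hne : ∀ {η : L}, η ^ p = 1 → X - η ≠ 0 := sub_ne_zero_of_pow_ne_one hX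
  have hdiff : ∀ {η θ : L}, η ^ p = 1 → θ ^ p = 1 → η ≠ θ → ord q ((X - η) - (X - θ)) = κ := by
    intro η θ hη hθ hηθ
    rw [sub_sub_sub_cancel_left]
    exact ord_sub_eq_of_pow_eq_one hζ hθ hη hηθ.symm
  have hlow : ∀ {η θ : L}, η ^ p = 1 → θ ^ p = 1 → ord q (X - η) < κ →
      ord q (X - θ) = ord q (X - η) := by
    intro η θ hη hθ hlt
    by_cases hηθ : θ = η
    · rw [hηθ]
    refine (ord_eq_of_ordGe_sub (hne hη) ?_).2
    refine (ordGe_ord _).mono ?_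
    rw [hdiff hθ hη hηθ]
    omega
  have hhigh : ∀ {η θ : L}, η ^ p = 1 → θ ^ p = 1 → η ≠ θ → κ < ord q (X - η) →
      ord q (X - θ) ≤ κ := by
    intro η θ hη hθ hηθ hgt
    by_contra! hgt'
    have h1 : OrdGe q (κ + 1) ((X - η) - (X - θ)) :=
      ((ordGe_ord _).mono (by omega)).sub ((ordGe_ord _).mono (by omega))
    rw [ordGe_iff (by rw [sub_sub_sub_cancel_left]; exact sub_ne_zero.2 hηθ.symm),
      hdiff hη hθ hηθ] at h1
    omega
  by_cases hex : ∃ η : L, η ^ p = 1 ∧ ord q (X - η) < κ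
  · obtain ⟨η, hη, hlt⟩ := hex
    rw [hlow hη hω hlt, hlow hη hω' hlt, sub_self]
    exact dvd_zero _
  push Not at hex
  suffices hmain : ∀ {η : L}, η ^ p = 1 → (p : ℤ) ∣ ord q (X - η) - κ by
    have := dvd_sub (hmain hω) (hmain hω')
    rwa [sub_sub_sub_cancel_right] at this
  intro η hη
  rcases (hex η hη).eq_or_lt with heq | hlt
  · rw [← heq, sub_self]
    exact dvd_zero _
  rw [pow_sub_one_eq_prod hζ, ord_prod _ _ fun i hi => hne (hmem.1 hi),
    ← Finset.add_sum_erase _ _ (hmem.2 hη),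
    Finset.sum_congr rfl (g := fun _ => κ) fun θ hθ => le_antisymm
      (hhigh hη (hmem.1 (Finset.mem_of_mem_erase hθ)) (Finset.ne_of_mem_erase hθ).symm hlt)
      (hex θ (hmem.1 (Finset.mem_of_mem_erase hθ))),
    Finset.sum_const, Finset.card_erase_of_mem (hmem.2 hη), hζ.card_nthRootsFinset, nsmul_eq_mul,
    Nat.cast_sub hp.out.one_le] at h
  obtain ⟨k, hk⟩ := h
  refine ⟨k - κ, ?_⟩
  push_cast at hk
  linear_combination hk

/-- If all orders of `X ^ p - 1` are divisible by `p`, the quotient of two factors of `X ^ p - 1`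
is a unit times a `p`-th power. -/
lemma exists_sub_eq_unit_mul_pow_mul_sub (hζ : IsPrimitiveRoot ζ p) (hreg : ¬ p ∣ classNumber L)
    {X : L} (hX : X ^ p ≠ 1) (h : ∀ q : HeightOneSpectrum (𝓞 L), (p : ℤ) ∣ ord q (X ^ p - 1))
    {ω ω' : L} (hω : ω ^ p = 1) (hω' : ω' ^ p = 1) :
    ∃ (u : (𝓞 L)ˣ) (c : L), c ≠ 0 ∧ (X - ω) / (X - ω') = algebraMap (𝓞 L) L u * c ^ p := by
  have h1 := sub_ne_zero_of_pow_ne_one hX hω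
  have h2 := sub_ne_zero_of_pow_ne_one hX hω'
  refine exists_unit_mul_pow_of_dvd_ord hp.out hreg (div_ne_zero h1 h2) fun q => ?_
  rw [ord_div h1 h2]
  exact dvd_ord_sub_sub_ord_sub hζ hX (h q) hω hω'

end Factors

section Local

variable {L : Type} [Field L] [NumberField L] {p : ℕ} [hp : Fact p.Prime] {ζ : L}
  {q : HeightOneSpectrum (𝓞 L)}

/-- `ζ - 1` is a uniformizer at `q` and every residue class at `q` contains an integer. -/
structure GoodAt (ζ : L) (q : HeightOneSpectrum (𝓞 L)) : Prop where
  ord_sub_one : ord q (ζ - 1) = 1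
  exists_int : ∀ x : L, OrdGe q 0 x → ∃ n : ℤ, OrdGe q 1 (x - n)

lemma ord_sub_eq_one (hζ : IsPrimitiveRoot ζ p) (hq : GoodAt ζ q) {ω ω' : L} (hω : ω ^ p = 1)
    (hω' : ω' ^ p = 1) (hne : ω ≠ ω') : ord q (ω - ω') = 1 := by
  rw [ord_sub_eq_of_pow_eq_one hζ hω hω' hne, hq.ord_sub_one]

lemma ordGe_one_sub_of_pow_eq_one (hζ : IsPrimitiveRoot ζ p) (hq : GoodAt ζ q) {ω ω' : L}
    (hω : ω ^ p = 1) (hω' : ω' ^ p = 1) : OrdGe q 1 (ω - ω') := by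
  by_cases hne : ω = ω'
  · rw [hne, sub_self]
    exact ordGe_zero
  · rw [ordGe_iff (sub_ne_zero.2 hne), ord_sub_eq_one hζ hq hω hω' hne]

lemma natCast_prime_ne_zero (L : Type) [Field L] [NumberField L] : (p : L) ≠ 0 :=
  Nat.cast_ne_zero.2 hp.out.ne_zero

lemma ord_natCast_prime (hζ : IsPrimitiveRoot ζ p) (hq : GoodAt ζ q) :
    ord q (p : L) = p - 1 := by
  obtain ⟨u, hu⟩ := associated_pow_sub_one_natCast hp.out hζ.toInteger_isPrimitiveRoot
  have hmap : algebraMap (𝓞 L) L (hζ.toInteger - 1) = ζ - 1 := by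
    rw [map_sub, map_one]
    rfl
  have h1 := congrArg (algebraMap (𝓞 L) L) hu
  rw [map_mul, map_pow, hmap, map_natCast] at h1
  have h0 : (ζ - 1) ^ (p - 1) * algebraMap (𝓞 L) L u ≠ 0 := by
    rw [h1]
    exact natCast_prime_ne_zero L
  rw [← h1, ord_mul (left_ne_zero_of_mul h0) (right_ne_zero_of_mul h0), ord_unit, ord_pow,
    hq.ord_sub_one, Nat.cast_sub hp.out.one_le]
  push_cast
  ring

/-- Raising to the `p`-th power improves congruences. -/
lemma ordGe_pow_sub_pow (hζ : IsPrimitiveRoot ζ p) (hq : GoodAt ζ q) {a b : L}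
    (hb : OrdGe q 0 b) (hab : OrdGe q 1 (a - b)) : OrdGe q p (a ^ p - b ^ p) := by
  rw [hζ.pow_sub_pow_eq_prod_sub_mul a b hp.out.pos]
  have := OrdGe.prod (q := q) (k := 1) (nthRootsFinset p (1 : L))
    (fun ω => a - ω * b) fun ω hω => by
    have h1 : a - ω * b = (a - b) + (1 - ω) * b := by ring
    rw [h1]
    exact hab.add ((ordGe_one_sub_of_pow_eq_one hζ hq (one_pow p)
      ((mem_nthRootsFinset hp.out.pos (1 : L)).1 hω)).mul_right hb)
  rwa [hζ.card_nthRootsFinset, mul_one] at this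

lemma exists_int_ordGe_pow_sub (hζ : IsPrimitiveRoot ζ p) (hq : GoodAt ζ q) {a : L}
    (ha : OrdGe q 0 a) : ∃ n : ℤ, OrdGe q p (a ^ p - n) := by
  obtain ⟨n, hn⟩ := hq.exists_int a ha
  refine ⟨n ^ p, ?_⟩
  push_cast
  exact ordGe_pow_sub_pow hζ hq (ordGe_intCast n) hn

end Local

section Kummer

variable {L : Type} [Field L] [NumberField L] {p : ℕ} [hp : Fact p.Prime] {ζ : L}

/-- A unit that is a `p`-th power modulo `(ζ - 1) ^ p`, where `p`-th powers of elements of `L` are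
allowed, is a `p`-th power. -/
theorem exists_pow_eq_of_ordGe (hp2 : 2 < p) (hζ : IsPrimitiveRoot ζ p)
    (hreg : ¬ p ∣ classNumber L)
    (hgood : ∀ q : HeightOneSpectrum (𝓞 L), OrdGe q 1 (ζ - 1) → GoodAt ζ q)
    (u : (𝓞 L)ˣ) {c : L} (hc : c ≠ 0) (hu : ∀ q : HeightOneSpectrum (𝓞 L), OrdGe q 1 (ζ - 1) →
      OrdGe q p (algebraMap (𝓞 L) L u * c ^ p - 1)) : ∃ v : L, v ^ p = algebraMap (𝓞 L) L u := by
  classical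
  have hζ' := hζ.toInteger_isPrimitiveRoot
  have hmap : algebraMap (𝓞 L) L (hζ.toInteger - 1) = ζ - 1 := by
    rw [map_sub, map_one]
    rfl
  have hζ0 : ζ - 1 ≠ 0 := sub_ne_zero.2 (hζ.ne_one hp.out.one_lt)
  have hspan : Ideal.span {hζ.toInteger - 1} ≠ 0 := by
    rw [Ne, Ideal.zero_eq_bot, Ideal.span_singleton_eq_bot]
    intro h0
    rw [h0, map_zero] at hmap
    exact hζ0 hmap.symm
  let s := (Ideal.finite_factors hspan).toFinset
  have hs : ∀ q, q ∈ s ↔ OrdGe q 1 (ζ - 1) := fun q => by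
    rw [← hmap, ordGe_one_iff_mem]
    simp [s, Ideal.dvd_span_singleton]
  have hu0 : algebraMap (𝓞 L) L u ≠ 0 := by
    rw [Ne, map_eq_zero_iff _ RingOfIntegers.coe_injective]
    exact u.ne_zero
  have hcq : ∀ q ∈ s, ord q c = 0 := fun q hq => by
    have h1 := (ord_eq_of_ordGe_sub one_ne_zero
      ((hu q ((hs q).1 hq)).mono (by rw [ord_one]; have := hp.out.one_lt; omega))).2
    rw [ord_mul hu0 (pow_ne_zero _ hc), ord_unit, zero_add, ord_pow, ord_one, mul_eq_zero] at h1
    exact h1.resolve_left (by exact_mod_cast hp.out.ne_zero)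
  have hn : ∀ q : s, ∃ n : ℤ, OrdGe (q : HeightOneSpectrum (𝓞 L)) 1 (c⁻¹ - n) := fun q =>
    (hgood q ((hs q).1 q.2)).exists_int _
      ((ordGe_iff (inv_ne_zero hc)).2 (by rw [ord_inv, hcq q q.2, neg_zero]))
  choose n hn using hn
  obtain ⟨b, hb⟩ := IsDedekindDomain.exists_forall_sub_mem_ideal (s := s)
    (fun q : HeightOneSpectrum (𝓞 L) => q.asIdeal) (fun _ => 1) (fun q _ => q.prime)
    (fun q _ q' _ hne h => hne (HeightOneSpectrum.ext h)) (fun q => (n q : 𝓞 L))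
  refine exists_pow_eq_of_dvd_sub_pow hp2 hζ' hreg u b ?_
  obtain ⟨e, he⟩ := exists_algebraMap_eq_of_ordGe
    (x := algebraMap (𝓞 L) L (u - b ^ p) / (ζ - 1) ^ p) fun q => by
      by_cases h0 : (u : 𝓞 L) - b ^ p = 0
      · rw [h0, map_zero, zero_div]
        exact ordGe_zero
      have h0' : algebraMap (𝓞 L) L (u - b ^ p) ≠ 0 := by
        rwa [Ne, map_eq_zero_iff _ RingOfIntegers.coe_injective]
      rw [ordGe_iff (div_ne_zero h0' (pow_ne_zero _ hζ0)), ord_div h0' (pow_ne_zero _ hζ0),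
        ord_pow, sub_nonneg, ← ordGe_iff h0']
      by_cases hq : q ∈ s
      · have hgq := hgood q ((hs q).1 hq)
        rw [hgq.ord_sub_one, mul_one, map_sub, map_pow]
        have hbc : OrdGe q 1 (algebraMap (𝓞 L) L b - c⁻¹) := by
          have h1 := hb q hq
          rw [pow_one, ← ordGe_one_iff_mem, map_sub, map_intCast] at h1
          exact h1.trans (hn ⟨q, hq⟩).symm
        have hci : OrdGe q 0 c⁻¹ :=
          (ordGe_iff (inv_ne_zero hc)).2 (by rw [ord_inv, hcq q hq, neg_zero])
        have h2 := ordGe_pow_sub_pow hζ hgq hci hbc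
        have h3 : OrdGe q p ((algebraMap (𝓞 L) L u * c ^ p - 1) * c⁻¹ ^ p) :=
          (hu q ((hs q).1 hq)).mul_right (by simpa using hci.pow p)
        have h4 : algebraMap (𝓞 L) L u - algebraMap (𝓞 L) L b ^ p =
            (algebraMap (𝓞 L) L u * c ^ p - 1) * c⁻¹ ^ p -
              (algebraMap (𝓞 L) L b ^ p - c⁻¹ ^ p) := by
          rw [sub_mul, mul_assoc, ← mul_pow, mul_inv_cancel₀ hc]
          ring
        rw [h4]
        exact h3.sub h2
      · rw [hs, ordGe_iff hζ0, not_le] at hq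
        refine (ordGe_algebraMap _).mono ?_
        exact mul_nonpos_of_nonneg_of_nonpos (by positivity) (by omega)
  refine ⟨e, ?_⟩
  apply RingOfIntegers.coe_injective
  rw [map_mul, map_pow, hmap, he, mul_div_cancel₀ _ (pow_ne_zero _ hζ0)]

end Kummer

end

section

open NumberField IsDedekindDomain Polynomial

/-- The field `L` is generated by a square root `s` of `p * m` and a primitive `p`-th root of unity
`ζ`, where `p` does not divide `m` and `-m` is a square modulo `p`. -/
structure IsQuadCyclo {L : Type} [Field L] [NumberField L] (p : ℕ) (m : ℤ) (s ζ : L) : Prop where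
  isPrimitiveRoot : IsPrimitiveRoot ζ p
  sq_eq : s ^ 2 = p * m
  adjoin_eq_top : IntermediateField.adjoin ℚ ({s, ζ} : Set L) = ⊤
  not_dvd : ¬ (p : ℤ) ∣ m
  exists_dvd_add_sq : ∃ r : ℤ, (p : ℤ) ∣ m + r ^ 2

section Generators

variable {L : Type} [Field L] [NumberField L] {p : ℕ} [hp : Fact p.Prime] {m : ℤ} {s ζ : L}

lemma IsQuadCyclo.ringHom_ext (H : IsQuadCyclo p m s ζ) {F : Type*} [Field F] [CharZero F]
    {f g : L →+* F} (hs : f s = g s) (hζ : f ζ = g ζ) : f = g := by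
  ext x
  have hx : x ∈ IntermediateField.adjoin ℚ ({s, ζ} : Set L) := by
    rw [H.adjoin_eq_top]
    trivial
  induction hx using IntermediateField.adjoin_induction with
  | mem x hx =>
    rcases hx with rfl | rfl
    · exact hs
    · exact hζ
  | algebraMap x => simp
  | add x y _ _ hx hy => rw [map_add, map_add, hx, hy]
  | inv x _ hx => rw [map_inv₀, map_inv₀, hx]
  | mul x y _ _ hx hy => rw [map_mul, map_mul, hx, hy]

lemma IsQuadCyclo.isGalois (H : IsQuadCyclo p m s ζ) : IsGalois ℚ L := by
  let f : ℚ[X] := (X ^ 2 - C (p * m : ℚ)) * (X ^ p - C 1)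
  have hf : f ≠ 0 := mul_ne_zero (X_pow_sub_C_ne_zero two_pos _) (X_pow_sub_C_ne_zero hp.out.pos _)
  have hmap : f.map (algebraMap ℚ L) = ((X - C s) * (X + C s)) * (X ^ p - C 1) := by
    have h2 : (X - C s) * (X + C s) = X ^ 2 - C (p * m : L) := by
      rw [← H.sq_eq, C_pow]
      ring
    rw [h2]
    simp [f]
  have : IsSplittingField ℚ L f := by
    rw [isSplittingField_iff_intermediateField]
    constructor
    · rw [hmap]
      exact ((Splits.X_sub_C s).mul (Splits.X_add_C s)).mul
        (X_pow_sub_one_splits H.isPrimitiveRoot)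
    · rw [eq_top_iff, ← H.adjoin_eq_top]
      refine IntermediateField.adjoin.mono _ _ _ ?_
      rintro x hx
      rw [mem_rootSet, aeval_def, eval₂_eq_eval_map, hmap]
      refine ⟨hf, ?_⟩
      rcases hx with rfl | rfl
      · simp
      · simp [H.isPrimitiveRoot.pow_eq_one]
  have := Normal.of_isSplittingField (F := ℚ) (E := L) f
  exact ⟨⟩

lemma IsQuadCyclo.mem_adjoin_of_fixed (H : IsQuadCyclo p m s ζ) {x : L}
    (hx : ∀ τ : L ≃ₐ[ℚ] L, τ ζ = ζ → τ x = x) :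
    x ∈ IntermediateField.adjoin ℚ ({ζ} : Set L) := by
  have := H.isGalois
  rw [← IsGalois.fixedField_fixingSubgroup (IntermediateField.adjoin ℚ ({ζ} : Set L)),
    IntermediateField.mem_fixedField_iff]
  intro τ hτ
  rw [IntermediateField.mem_fixingSubgroup_iff] at hτ
  exact hx τ (hτ ζ (IntermediateField.mem_adjoin_simple_self ℚ ζ))

/-- Integers of `ℚ(ζ)` are congruent to rational integers modulo `ζ - 1`. -/
lemma exists_int_add_of_mem_adjoin (hζ : IsPrimitiveRoot ζ p) {x : L} (hxint : IsIntegral ℤ x)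
    (hx : x ∈ IntermediateField.adjoin ℚ ({ζ} : Set L)) :
    ∃ (n : ℤ) (b : 𝓞 L), x = n + (ζ - 1) * algebraMap (𝓞 L) L b := by
  let K := IntermediateField.adjoin ℚ ({ζ} : Set L)
  have hcyc : IsCyclotomicExtension {p} ℚ K := hζ.intermediateField_adjoin_isCyclotomicExtension ℚ
  let ζK : K := ⟨ζ, IntermediateField.mem_adjoin_simple_self ℚ ζ⟩
  have hζK : IsPrimitiveRoot ζK p := by
    rw [← IsPrimitiveRoot.coe_submonoidClass_iff]
    exact hζ
  have hcl := IsCyclotomicExtension.Rat.isIntegralClosure_adjoin_singleton_of_prime hζK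
  have hxK : IsIntegral ℤ (⟨x, hx⟩ : K) := by
    rw [← isIntegral_algebraMap_iff (A := K) (B := L) (algebraMap K L).injective]
    exact hxint
  obtain ⟨y, hy⟩ := hcl.isIntegral_iff.1 hxK
  have hy' : ((y : K) : L) = x := congrArg Subtype.val hy
  rw [← hy']
  clear hy' hy
  obtain ⟨y, hy⟩ := y
  induction hy using Algebra.adjoin_induction with
  | mem y hy =>
    obtain rfl : y = ζK := hy
    refine ⟨1, 1, ?_⟩
    simp [ζK]
  | algebraMap n => exact ⟨n, 0, by simp⟩
  | add y z _ _ hy hz =>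
    obtain ⟨n, b, h⟩ := hy
    obtain ⟨n', b', h'⟩ := hz
    refine ⟨n + n', b + b', ?_⟩
    change (y : L) + (z : L) = _
    rw [h, h', map_add, Int.cast_add]
    ring
  | mul y z _ _ hy hz =>
    obtain ⟨n, b, h⟩ := hy
    obtain ⟨n', b', h'⟩ := hz
    refine ⟨n * n', n * b' + b * n' + (hζ.toInteger - 1) * b * b', ?_⟩
    have hmap : algebraMap (𝓞 L) L hζ.toInteger = ζ := rfl
    change (y : L) * (z : L) = _
    rw [h, h', Int.cast_mul, map_add, map_add, map_mul, map_mul, map_mul, map_mul, map_sub, hmap,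
      map_one, map_intCast, map_intCast]
    ring

end Generators

section Uniformizer

variable {L : Type} [Field L] [NumberField L] {p : ℕ} [hp : Fact p.Prime] {ζ : L}

/-- The unit `p / (ζ - 1) ^ (p - 1)` is congruent to `-1` modulo `ζ - 1`. -/
lemma exists_prime_eq_pow_mul (hζ : IsPrimitiveRoot ζ p) (hp2 : 2 < p) :
    ∃ b : 𝓞 L, (p : L) = (ζ - 1) ^ (p - 1) * (-1 + (ζ - 1) * algebraMap (𝓞 L) L b) := by
  have hζ' := hζ.toInteger_isPrimitiveRoot
  set z := hζ.toInteger with hz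
  have hmap : algebraMap (𝓞 L) L z = ζ := rfl
  obtain ⟨n, hn⟩ : ∃ n, p = n + 1 := ⟨p - 1, (Nat.sub_add_cancel hp.out.one_le).symm⟩
  have hev : Even n := by
    have := hp.out.eq_two_or_odd'
    rcases this with h | h
    · omega
    · rw [hn] at h
      exact (Nat.odd_add_one.1 h) |> Nat.not_odd_iff_even.1
  have hprod : (p : 𝓞 L) = (z - 1) ^ n *
      ∏ k ∈ Finset.range n, ∑ j ∈ Finset.range (k + 1), z ^ j := by
    have hζn : IsPrimitiveRoot z (n + 1) := hn ▸ hζ'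
    have h1 := hζn.prod_one_sub_pow_eq_order
    have h2 : ∀ k ∈ Finset.range n, 1 - z ^ (k + 1) =
        -1 * ((z - 1) * ∑ j ∈ Finset.range (k + 1), z ^ j) := fun k _ => by
      rw [mul_geom_sum]
      ring
    rw [Finset.prod_congr rfl h2, Finset.prod_mul_distrib, Finset.prod_mul_distrib,
      Finset.prod_const, Finset.prod_const, Finset.card_range, hev.neg_one_pow, one_mul] at h1
    rw [h1, hn]
    push_cast
    ring
  have hcong : z - 1 ∣ (∏ k ∈ Finset.range n, ∑ j ∈ Finset.range (k + 1), z ^ j) - -1 := by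
    have h0 : Ideal.Quotient.mk (Ideal.span {z - 1}) z = 1 := by
      rw [← map_one (Ideal.Quotient.mk (Ideal.span {z - 1})), Ideal.Quotient.eq,
        Ideal.mem_span_singleton]
    have hpz : z - 1 ∣ (p : 𝓞 L) := by
      rw [hprod]
      exact Dvd.dvd.mul_right (dvd_pow_self _ (by omega)) _
    have hw : ((p : ℤ)) ∣ ((n.factorial : ℤ) + 1) := by
      rw [← ZMod.intCast_zmod_eq_zero_iff_dvd]
      push_cast
      have := ZMod.wilsons_lemma p
      rw [show p - 1 = n by omega] at this
      rw [this]
      ring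
    have hw' : z - 1 ∣ (((n.factorial : ℤ) + 1 : ℤ) : 𝓞 L) := by
      refine hpz.trans ?_
      have := Int.cast_dvd_cast (α := 𝓞 L) _ _ hw
      simpa using this
    rw [← Ideal.mem_span_singleton, ← Ideal.Quotient.eq, map_prod]
    rw [← Ideal.mem_span_singleton] at hw'
    have h3 : Ideal.Quotient.mk (Ideal.span {z - 1}) (n.factorial : 𝓞 L) =
        Ideal.Quotient.mk (Ideal.span {z - 1}) (-1) := by
      rw [Ideal.Quotient.eq]
      convert hw' using 1
      push_cast
      ring
    rw [← h3, ← Finset.prod_range_add_one_eq_factorial, Nat.cast_prod, map_prod]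
    refine Finset.prod_congr rfl fun k _ => ?_
    simp [map_sum, h0]
  obtain ⟨b, hb⟩ := hcong
  refine ⟨b, ?_⟩
  have h1 := congrArg (algebraMap (𝓞 L) L) hprod
  rw [sub_eq_iff_eq_add.1 hb] at h1
  rw [map_natCast, map_mul, map_pow, map_add, map_mul, map_sub, map_neg, map_one, hmap] at h1
  rw [h1, hn, Nat.add_sub_cancel]
  ring

end Uniformizer

end

section

open NumberField IsDedekindDomain Polynomial

section Decomposition

variable {L : Type} [Field L] [NumberField L] {p : ℕ} [hp : Fact p.Prime] {m : ℤ} {s ζ : L}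

/-- The normalization of `s` by a power of `ζ - 1` which is a unit at the primes above `p`. -/
noncomputable def unitSqrt (p : ℕ) (s ζ : L) : L := s / (ζ - 1) ^ ((p - 1) / 2)

lemma two_mul_half_sub_one (hp2 : 2 < p) : 2 * ((p - 1) / 2) = p - 1 := by
  have := hp.out.eq_two_or_odd
  omega

lemma IsQuadCyclo.sub_one_ne_zero (H : IsQuadCyclo p m s ζ) : ζ - 1 ≠ 0 :=
  sub_ne_zero.2 (H.isPrimitiveRoot.ne_one hp.out.one_lt)

lemma IsQuadCyclo.unitSqrt_sq (H : IsQuadCyclo p m s ζ) (hp2 : 2 < p) {e : L}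
    (he : (p : L) = (ζ - 1) ^ (p - 1) * e) : unitSqrt p s ζ ^ 2 = m * e := by
  have h0 := H.sub_one_ne_zero
  rw [unitSqrt, div_pow, ← pow_mul, mul_comm _ 2, two_mul_half_sub_one hp2, H.sq_eq, he,
    div_eq_iff (pow_ne_zero _ h0)]
  ring

lemma IsQuadCyclo.isIntegral_unitSqrt (H : IsQuadCyclo p m s ζ) (hp2 : 2 < p) :
    IsIntegral ℤ (unitSqrt p s ζ) := by
  obtain ⟨b, hb⟩ := exists_prime_eq_pow_mul H.isPrimitiveRoot hp2
  refine IsIntegral.of_pow two_pos ?_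
  rw [H.unitSqrt_sq hp2 hb]
  have h : (m : L) * (-1 + (ζ - 1) * algebraMap (𝓞 L) L b) =
      algebraMap (𝓞 L) L (m * (-1 + (H.isPrimitiveRoot.toInteger - 1) * b)) := by
    have hmap : algebraMap (𝓞 L) L H.isPrimitiveRoot.toInteger = ζ := rfl
    simp only [map_mul, map_add, map_sub, map_neg, map_one, map_intCast, hmap]
  rw [h]
  exact RingOfIntegers.isIntegral_coe _

/-- Up to an element prime to `p`, integers are combinations of `1` and `unitSqrt p s ζ` with
integer coefficients modulo `ζ - 1`. -/
lemma IsQuadCyclo.exists_eq_add (H : IsQuadCyclo p m s ζ) (hp2 : 2 < p) {b₀ : 𝓞 L}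
    (hb₀ : (p : L) = (ζ - 1) ^ (p - 1) * (-1 + (ζ - 1) * algebraMap (𝓞 L) L b₀)) (a : 𝓞 L) :
    ∃ (n₁ n₂ : ℤ) (b : 𝓞 L),
      2 * m * (-1 + (ζ - 1) * algebraMap (𝓞 L) L b₀) * algebraMap (𝓞 L) L a =
        n₁ + n₂ * unitSqrt p s ζ + (ζ - 1) * algebraMap (𝓞 L) L b := by
  have hmap : algebraMap (𝓞 L) L H.isPrimitiveRoot.toInteger = ζ := rfl
  set t := unitSqrt p s ζ with ht
  have ht2 := H.unitSqrt_sq hp2 hb₀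
  rw [← ht] at ht2
  by_cases hfix : ∀ τ : L ≃ₐ[ℚ] L, τ ζ = ζ → τ s = s
  · have h1 : ∀ x : L, x ∈ IntermediateField.adjoin ℚ ({ζ} : Set L) := fun x =>
      H.mem_adjoin_of_fixed fun τ hτ => by
        have := H.ringHom_ext (f := (τ : L →+* L)) (g := RingHom.id L) (hfix τ hτ) hτ
        exact RingHom.congr_fun this x
    obtain ⟨n, b, hb⟩ := exists_int_add_of_mem_adjoin H.isPrimitiveRoot
      (RingOfIntegers.isIntegral_coe
        (2 * (m : 𝓞 L) * (-1 + (H.isPrimitiveRoot.toInteger - 1) * b₀) * a))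
      (h1 _)
    refine ⟨n, 0, b, ?_⟩
    rw [Int.cast_zero, zero_mul, add_zero, ← hb]
    simp only [map_mul, map_add, map_sub, map_neg, map_one, map_intCast, hmap, map_ofNat]
  · push Not at hfix
    obtain ⟨σ, hσζ, hσs⟩ := hfix
    have hsq : ∀ τ : L ≃ₐ[ℚ] L, τ s = s ∨ τ s = -s := fun τ => by
      rw [← sq_eq_sq_iff_eq_or_eq_neg, ← map_pow, H.sq_eq]
      simp
    have hσs' : σ s = -s := (hsq σ).resolve_left hσs
    have hor : ∀ τ : L ≃ₐ[ℚ] L, τ ζ = ζ → (∀ x, τ x = x) ∨ ∀ x, τ x = σ x := fun τ hτ => by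
      rcases hsq τ with h | h
      · exact Or.inl (RingHom.congr_fun
          (H.ringHom_ext (f := (τ : L →+* L)) (g := RingHom.id L) h hτ))
      · exact Or.inr (RingHom.congr_fun
          (H.ringHom_ext (f := (τ : L →+* L)) (g := (σ : L →+* L)) (h.trans hσs'.symm)
            (hτ.trans hσζ.symm)))
    have hσσ : ∀ x, σ (σ x) = x := RingHom.congr_fun
      (H.ringHom_ext (f := (σ : L →+* L).comp (σ : L →+* L)) (g := RingHom.id L)
        (by simp [hσs']) (by simp [hσζ]))
    have hσt : σ t = -t := by
      rw [ht, unitSqrt, map_div₀, hσs', map_pow, map_sub, hσζ, map_one, neg_div]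
    have hσint : IsIntegral ℤ (σ (algebraMap (𝓞 L) L a)) :=
      (RingOfIntegers.isIntegral_coe a).map (σ.toAlgHom.restrictScalars ℤ)
    have haint : IsIntegral ℤ (algebraMap (𝓞 L) L a) := RingOfIntegers.isIntegral_coe a
    have htint := H.isIntegral_unitSqrt hp2
    obtain ⟨t₀, ht₀⟩ := exists_ringOfIntegers_eq htint
    rw [← ht] at ht₀ htint
    obtain ⟨n₁, b₁, h₁⟩ := exists_int_add_of_mem_adjoin H.isPrimitiveRoot (haint.add hσint)
      (H.mem_adjoin_of_fixed fun τ hτ => by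
        rcases hor τ hτ with h | h
        · rw [h]
        · rw [h, map_add, hσσ, add_comm])
    obtain ⟨n₂, b₂, h₂⟩ := exists_int_add_of_mem_adjoin H.isPrimitiveRoot
      ((haint.sub hσint).mul htint)
      (H.mem_adjoin_of_fixed fun τ hτ => by
        rcases hor τ hτ with h | h
        · rw [h]
        · rw [h, map_mul, map_sub, hσσ, hσt]
          ring)
    refine ⟨-m * n₁, n₂,
      m * b₀ * (n₁ + (H.isPrimitiveRoot.toInteger - 1) * b₁) - m * b₁ + b₂ * t₀, ?_⟩
    simp only [map_mul, map_add, map_sub, map_one, map_intCast, hmap, ht₀, Int.cast_mul,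
      Int.cast_neg]
    set e := -1 + (ζ - 1) * algebraMap (𝓞 L) L b₀ with he
    linear_combination (m * e) * h₁ + t * h₂ -
      (algebraMap (𝓞 L) L a - σ (algebraMap (𝓞 L) L a)) * ht2 +
      (m * (n₁ + (ζ - 1) * algebraMap (𝓞 L) L b₁)) * he

end Decomposition

section Primes

variable {L : Type} [Field L] [NumberField L] {p : ℕ} [hp : Fact p.Prime] {m : ℤ} {s ζ : L}
  {q : HeightOneSpectrum (𝓞 L)}

lemma not_ordGe_one_one : ¬ OrdGe q 1 (1 : L) := by
  rw [ordGe_iff one_ne_zero, ord_one]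
  omega

lemma IsQuadCyclo.ordGe_ord_prime (H : IsQuadCyclo p m s ζ) (hp2 : 2 < p)
    (hq : OrdGe q 1 (ζ - 1)) : OrdGe q (ord q (ζ - 1)) (p : L) := by
  obtain ⟨b, hb⟩ := exists_prime_eq_pow_mul H.isPrimitiveRoot hp2
  have h0 := H.sub_one_ne_zero
  rw [ordGe_iff h0] at hq
  rw [hb]
  refine OrdGe.mul_right (((ordGe_ord (ζ - 1)).pow (p - 1)).mono ?_) ?_
  · have : (1 : ℤ) ≤ ((p - 1 : ℕ) : ℤ) := by omega
    nlinarith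
  · exact ordGe_one.neg.add ((ordGe_ord (ζ - 1)).mono (by omega) |>.mul_right (ordGe_algebraMap b))

lemma IsQuadCyclo.dvd_of_ordGe_intCast (H : IsQuadCyclo p m s ζ) (hp2 : 2 < p)
    (hq : OrdGe q 1 (ζ - 1)) {n : ℤ} (hn : OrdGe q 1 (n : L)) : (p : ℤ) ∣ n := by
  by_contra hnd
  have hcop : IsCoprime (p : ℤ) n :=
    (Prime.coprime_iff_not_dvd (Nat.prime_iff_prime_int.1 hp.out)).2 hnd
  obtain ⟨x, y, hxy⟩ := hcop
  have h0 := H.sub_one_ne_zero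
  have h1 : OrdGe q 1 ((x : L) * p + y * n) :=
    (((H.ordGe_ord_prime hp2 hq).mono ((ordGe_iff h0).1 hq)).mul_left (ordGe_intCast x)).add
      (hn.mul_left (ordGe_intCast y))
  rw [show (x : L) * p + y * n = 1 by exact_mod_cast congrArg (Int.cast : ℤ → L) hxy] at h1
  exact not_ordGe_one_one h1

lemma IsQuadCyclo.ordGe_of_dvd (H : IsQuadCyclo p m s ζ) (hp2 : 2 < p)
    (hq : OrdGe q 1 (ζ - 1)) {n : ℤ} (hn : (p : ℤ) ∣ n) : OrdGe q (ord q (ζ - 1)) (n : L) := by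
  obtain ⟨k, rfl⟩ := hn
  push_cast
  exact (H.ordGe_ord_prime hp2 hq).mul_right (ordGe_intCast k)

lemma IsQuadCyclo.ord_intCast_eq_zero (H : IsQuadCyclo p m s ζ) (hp2 : 2 < p)
    (hq : OrdGe q 1 (ζ - 1)) {n : ℤ} (hn : ¬ (p : ℤ) ∣ n) : ord q (n : L) = 0 := by
  have h0 : (n : L) ≠ 0 := by
    rintro h
    rw [Int.cast_eq_zero] at h
    exact hn (h ▸ dvd_zero _)
  have h1 := (ordGe_iff h0).1 (ordGe_intCast (q := q) n)
  have h2 : ¬ OrdGe q 1 (n : L) := fun h => hn (H.dvd_of_ordGe_intCast hp2 hq h)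
  rw [ordGe_iff h0] at h2
  omega

lemma ordGe_or_ordGe_of_mul {x y : L} (hx : OrdGe q 0 x)
    (h : OrdGe q 1 (x * y)) : OrdGe q 1 x ∨ OrdGe q 1 y := by
  by_cases hx0 : x = 0
  · exact Or.inl (hx0 ▸ ordGe_zero)
  by_cases hy0 : y = 0
  · exact Or.inr (hy0 ▸ ordGe_zero)
  rw [ordGe_iff hx0] at hx ⊢
  rw [ordGe_iff hy0]
  rw [ordGe_iff (mul_ne_zero hx0 hy0), ord_mul hx0 hy0] at h
  omega

lemma OrdGe.of_mul_left {x y : L} {k : ℤ} (hx : x ≠ 0) (hx0 : ord q x = 0)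
    (h : OrdGe q k (x * y)) : OrdGe q k y := by
  by_cases hy : y = 0
  · exact hy ▸ ordGe_zero
  rw [ordGe_iff (mul_ne_zero hx hy), ord_mul hx hy, hx0, zero_add] at h
  exact (ordGe_iff hy).2 h

lemma IsQuadCyclo.ordGe_sq_sub_sq (H : IsQuadCyclo p m s ζ) (hp2 : 2 < p) {r : ℤ}
    (hr : (p : ℤ) ∣ m + r ^ 2) (hq : OrdGe q 1 (ζ - 1)) :
    OrdGe q (ord q (ζ - 1)) ((unitSqrt p s ζ + r) * (unitSqrt p s ζ - r)) := by
  obtain ⟨b, hb⟩ := exists_prime_eq_pow_mul H.isPrimitiveRoot hp2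
  have h1 : (unitSqrt p s ζ + r) * (unitSqrt p s ζ - r) =
      (ζ - 1) * (m * algebraMap (𝓞 L) L b) - ((m + r ^ 2 : ℤ) : L) := by
    push_cast
    linear_combination H.unitSqrt_sq hp2 hb
  rw [h1]
  exact ((ordGe_ord _).mul_right ((ordGe_algebraMap b).mul_left (ordGe_intCast m))).sub
    (H.ordGe_of_dvd hp2 hq hr)

lemma IsQuadCyclo.ordGe_unitSqrt_sub_or_add (H : IsQuadCyclo p m s ζ) (hp2 : 2 < p) {r : ℤ}
    (hr : (p : ℤ) ∣ m + r ^ 2) (hq : OrdGe q 1 (ζ - 1)) :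
    OrdGe q 1 (unitSqrt p s ζ + r) ∨ OrdGe q 1 (unitSqrt p s ζ - r) := by
  have ht := ordGe_of_isIntegral (q := q) (H.isIntegral_unitSqrt hp2)
  refine ordGe_or_ordGe_of_mul (ht.add (ordGe_intCast r)) ?_
  exact (H.ordGe_sq_sub_sq hp2 hr hq).mono ((ordGe_iff H.sub_one_ne_zero).1 hq)

lemma IsQuadCyclo.not_dvd_two_mul (H : IsQuadCyclo p m s ζ) (hp2 : 2 < p) {r : ℤ}
    (hr : (p : ℤ) ∣ m + r ^ 2) : ¬ (p : ℤ) ∣ 2 * r := by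
  have hpp := Nat.prime_iff_prime_int.1 hp.out
  intro h
  rcases hpp.dvd_or_dvd h with h | h
  · have := Int.le_of_dvd two_pos h
    omega
  · exact H.not_dvd ((Int.dvd_add_left (dvd_pow h two_ne_zero)).1 hr)

/-- If `unitSqrt p s ζ` is congruent to `r` modulo `q`, it is so modulo `ζ - 1` locally at `q`. -/
lemma IsQuadCyclo.ordGe_unitSqrt_sub (H : IsQuadCyclo p m s ζ) (hp2 : 2 < p) {r : ℤ}
    (hr : (p : ℤ) ∣ m + r ^ 2) (hq : OrdGe q 1 (ζ - 1)) (ht : OrdGe q 1 (unitSqrt p s ζ - r)) :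
    OrdGe q (ord q (ζ - 1)) (unitSqrt p s ζ - r) := by
  have h2r := H.ord_intCast_eq_zero hp2 hq (H.not_dvd_two_mul hp2 hr)
  have h0 : ((2 * r : ℤ) : L) ≠ 0 := by
    intro h
    rw [Int.cast_eq_zero] at h
    exact H.not_dvd_two_mul hp2 hr (h ▸ dvd_zero _)
  have h1 := ord_eq_of_ordGe_sub (q := q) (y := unitSqrt p s ζ + r) h0 (by
    rw [h2r, zero_add]
    convert ht using 1
    push_cast
    ring)
  exact OrdGe.of_mul_left h1.1 (h1.2.trans h2r) (H.ordGe_sq_sub_sq hp2 hr hq)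

lemma IsQuadCyclo.exists_int_forall_ordGe (H : IsQuadCyclo p m s ζ) (hp2 : 2 < p) {r : ℤ}
    (hr : (p : ℤ) ∣ m + r ^ 2) (a : 𝓞 L) : ∃ N : ℤ, ∀ q : HeightOneSpectrum (𝓞 L),
      OrdGe q 1 (ζ - 1) → OrdGe q 1 (unitSqrt p s ζ - r) →
        OrdGe q (ord q (ζ - 1)) (algebraMap (𝓞 L) L a - N) := by
  obtain ⟨b₀, hb₀⟩ := exists_prime_eq_pow_mul H.isPrimitiveRoot hp2
  obtain ⟨n₁, n₂, b, hb⟩ := H.exists_eq_add hp2 hb₀ a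
  have hcop : IsCoprime (p : ℤ) (2 * m) := by
    have hpp := Nat.prime_iff_prime_int.1 hp.out
    refine (Prime.coprime_iff_not_dvd hpp).2 fun h => ?_
    rcases hpp.dvd_or_dvd h with h | h
    · have := Int.le_of_dvd two_pos h
      omega
    · exact H.not_dvd h
  obtain ⟨x, y, hxy⟩ := hcop
  refine ⟨-(y * (n₁ + n₂ * r)), fun q hq hqt => ?_⟩
  have hxy' : (x : L) * p + y * (2 * m) = 1 := by
    exact_mod_cast congrArg (Int.cast : ℤ → L) hxy
  have h1 : algebraMap (𝓞 L) L a - ((-(y * (n₁ + n₂ * r)) : ℤ) : L) =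
      p * (x * algebraMap (𝓞 L) L a) + (ζ - 1) *
        (y * (2 * m * algebraMap (𝓞 L) L b₀ * algebraMap (𝓞 L) L a - algebraMap (𝓞 L) L b)) -
        (unitSqrt p s ζ - r) * (y * n₂) := by
    push_cast
    linear_combination (-algebraMap (𝓞 L) L a) * hxy' - y * hb
  rw [h1]
  refine OrdGe.sub (OrdGe.add ?_ ?_) ?_
  · exact (H.ordGe_ord_prime hp2 hq).mul_right ((ordGe_algebraMap a).mul_left (ordGe_intCast x))
  · refine (ordGe_ord _).mul_right (OrdGe.mul_left ?_ (ordGe_intCast y))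
    have h2 := ordGe_algebraMap (q := q) (2 * m * b₀ * a - b)
    simpa only [map_sub, map_mul, map_ofNat, map_intCast] using h2
  · exact (H.ordGe_unitSqrt_sub hp2 hr hq hqt).mul_right
      ((ordGe_intCast n₂).mul_left (ordGe_intCast y))

lemma IsQuadCyclo.goodAt (H : IsQuadCyclo p m s ζ) (hp2 : 2 < p) (hq : OrdGe q 1 (ζ - 1)) :
    GoodAt ζ q := by
  obtain ⟨r, hr, hrt⟩ : ∃ r : ℤ, (p : ℤ) ∣ m + r ^ 2 ∧ OrdGe q 1 (unitSqrt p s ζ - r) := by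
    obtain ⟨r, hr⟩ := H.exists_dvd_add_sq
    rcases H.ordGe_unitSqrt_sub_or_add hp2 hr hq with h | h
    · refine ⟨-r, by rwa [neg_sq], ?_⟩
      push_cast
      rwa [sub_neg_eq_add]
    · exact ⟨r, hr, h⟩
  have hκ := (ordGe_iff H.sub_one_ne_zero).1 hq
  constructor
  · refine le_antisymm ?_ hκ
    obtain ⟨a, ha⟩ := q.intValuation_exists_uniformizer
    have haL : ord q (algebraMap (𝓞 L) L a) = 1 := by
      rw [ord, HeightOneSpectrum.valuation_of_algebraMap, ha]
      rfl
    have ha0 : algebraMap (𝓞 L) L a ≠ 0 := by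
      intro h0
      rw [h0] at haL
      simp [ord] at haL
    obtain ⟨N, hN⟩ := H.exists_int_forall_ordGe hp2 hr a
    have h1 := hN q hq hrt
    have h2 : OrdGe q 1 (N : L) := by
      have := ((ordGe_iff ha0).2 haL.ge).sub (h1.mono hκ)
      rwa [sub_sub_cancel] at this
    have h3 := h1.add (H.ordGe_of_dvd hp2 hq (H.dvd_of_ordGe_intCast hp2 hq h2))
    rwa [sub_add_cancel, ordGe_iff ha0, haL] at h3
  · intro x hx
    have hx' : q.valuation L x ≤ 1 := by simpa [OrdGe] using hx
    obtain ⟨a, ha⟩ := q.exists_valuation_sub_lt_of_integer hx'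
      (Units.mk0 (WithZero.exp (-1)) WithZero.exp_ne_zero)
    have ha' : OrdGe q 1 (algebraMap (𝓞 L) L a - x) := ha.le
    obtain ⟨N, hN⟩ := H.exists_int_forall_ordGe hp2 hr a
    refine ⟨N, ?_⟩
    exact OrdGe.trans (y := algebraMap (𝓞 L) L a) ha'.symm ((hN q hq hrt).mono hκ)

/-- A prime above `p` is determined by the residue of `unitSqrt p s ζ`. -/
lemma IsQuadCyclo.eq_of_ordGe (H : IsQuadCyclo p m s ζ) (hp2 : 2 < p) {r : ℤ}
    (hr : (p : ℤ) ∣ m + r ^ 2) {q q' : HeightOneSpectrum (𝓞 L)} (hq : OrdGe q 1 (ζ - 1))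
    (hq' : OrdGe q' 1 (ζ - 1)) (ht : OrdGe q 1 (unitSqrt p s ζ - r))
    (ht' : OrdGe q' 1 (unitSqrt p s ζ - r)) : q = q' := by
  suffices h : ∀ {q q' : HeightOneSpectrum (𝓞 L)}, OrdGe q 1 (ζ - 1) → OrdGe q' 1 (ζ - 1) →
      OrdGe q 1 (unitSqrt p s ζ - r) → OrdGe q' 1 (unitSqrt p s ζ - r) →
      q.asIdeal ≤ q'.asIdeal by
    exact HeightOneSpectrum.ext (le_antisymm (h hq hq' ht ht') (h hq' hq ht' ht))
  intro q q' hq hq' ht ht' a ha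
  rw [← ordGe_one_iff_mem] at ha ⊢
  obtain ⟨N, hN⟩ := H.exists_int_forall_ordGe hp2 hr a
  have hκ := (ordGe_iff H.sub_one_ne_zero).1 hq
  have hκ' := (ordGe_iff H.sub_one_ne_zero).1 hq'
  have h2 : OrdGe q 1 (N : L) := by
    have := ha.sub ((hN q hq ht).mono hκ)
    rwa [sub_sub_cancel] at this
  have h3 := (hN q' hq' ht').add (H.ordGe_of_dvd hp2 hq' (H.dvd_of_ordGe_intCast hp2 hq h2))
  rw [sub_add_cancel] at h3
  exact h3.mono hκ'

end Primes

end

section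

open NumberField IsDedekindDomain Polynomial

section Conjugation

variable {L : Type} [Field L] [NumberField L]

/-- Every automorphism of `L` permutes the primes of `L`. -/
lemma exists_prime_valuation_eq (c : L ≃+* L) (q : HeightOneSpectrum (𝓞 L)) :
    ∃ q' : HeightOneSpectrum (𝓞 L), ∀ x, q'.valuation L (c x) = q.valuation L x := by
  let e := RingOfIntegers.mapRingEquiv c
  have he : ∀ a : 𝓞 L, c (algebraMap (𝓞 L) L a) = algebraMap (𝓞 L) L (e a) := fun a => rfl
  let q' := HeightOneSpectrum.equivOfRingEquiv e q
  have hq' : q'.asIdeal = q.asIdeal.map e := (Ideal.map_comap_of_equiv e).symm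
  have hxint : ∀ a : 𝓞 L, q'.intValuation (e a) = q.intValuation a := by
    intro a
    by_cases ha : a = 0
    · rw [ha, map_zero, map_zero, map_zero]
    have ha' : e a ≠ 0 := by simpa using ha
    have key : ∀ n : ℕ, q'.intValuation (e a) ≤ WithZero.exp (-(n : ℤ)) ↔
        q.intValuation a ≤ WithZero.exp (-(n : ℤ)) := by
      intro n
      rw [HeightOneSpectrum.intValuation_le_pow_iff_mem,
        HeightOneSpectrum.intValuation_le_pow_iff_mem, hq', ← Ideal.map_pow,
        ← Ideal.comap_symm, Ideal.mem_comap, RingEquiv.symm_apply_apply]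
    apply le_antisymm
    · rw [q.intValuation_if_neg ha]
      refine (key _).2 ?_
      rw [q.intValuation_if_neg ha]
    · rw [q'.intValuation_if_neg ha']
      refine (key _).1 ?_
      rw [q'.intValuation_if_neg ha']
  refine ⟨q', fun x => ?_⟩
  obtain ⟨a, b, hb, rfl⟩ := IsFractionRing.div_surjective (A := 𝓞 L) x
  rw [map_div₀, map_div₀, map_div₀, he, he, HeightOneSpectrum.valuation_of_algebraMap,
    HeightOneSpectrum.valuation_of_algebraMap, HeightOneSpectrum.valuation_of_algebraMap,
    HeightOneSpectrum.valuation_of_algebraMap, hxint, hxint]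

/-- The automorphism `c` of `L` is complex conjugation for every complex embedding of `L`. -/
structure IsConjAut (c : L ≃+* L) (s ζ : L) : Prop where
  map_sqrt : c s = s
  map_root : c ζ = ζ⁻¹
  map_embedding : ∀ (φ : L →+* ℂ) (x : L), φ (c x) = starRingEnd ℂ (φ x)

variable {p : ℕ} [hp : Fact p.Prime] {m : ℤ} {s ζ : L} {c : L ≃+* L}
  {q : HeightOneSpectrum (𝓞 L)}

lemma IsQuadCyclo.conj_conj (H : IsQuadCyclo p m s ζ) (hc : IsConjAut c s ζ) (x : L) :
    c (c x) = x := by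
  have h := H.ringHom_ext (f := (c : L →+* L).comp (c : L →+* L)) (g := RingHom.id L)
    (by simp [hc.map_sqrt]) (by simp [hc.map_root])
  exact RingHom.congr_fun h x

lemma IsConjAut.map_eq_inv (hc : IsConjAut c s ζ) (hζ : IsPrimitiveRoot ζ p) {ω : L}
    (hω : ω ^ p = 1) : c ω = ω⁻¹ := by
  obtain ⟨i, -, rfl⟩ := hζ.eq_pow_of_pow_eq_one hω
  rw [map_pow, hc.map_root, inv_pow]

/-- An integer of absolute value one at every archimedean place is a root of unity. -/
lemma IsConjAut.exists_pow_eq_one (hc : IsConjAut c s ζ) {w : L} (hw : IsIntegral ℤ w)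
    (h : w * c w = 1) : ∃ n, 0 < n ∧ w ^ n = 1 := by
  simp_rw [← exists_prop]
  refine NumberField.Embeddings.pow_eq_one_of_norm_eq_one L ℂ hw fun φ => ?_
  have h1 : φ w * starRingEnd ℂ (φ w) = 1 := by
    rw [← hc.map_embedding, ← map_mul, h, map_one]
  have h2 := congrArg norm h1
  rw [norm_mul, RCLike.norm_conj, norm_one] at h2
  nlinarith [norm_nonneg (φ w)]

lemma exists_prime_ordGe_sub_one (hζ : IsPrimitiveRoot ζ p) :
    ∃ q : HeightOneSpectrum (𝓞 L), OrdGe q 1 (ζ - 1) := by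
  have hmap : algebraMap (𝓞 L) L hζ.toInteger = ζ := rfl
  have hnu : ¬ IsUnit (hζ.toInteger - 1) := by
    intro hu
    have h1 : IsUnit (p : 𝓞 L) :=
      (associated_pow_sub_one_natCast hp.out hζ.toInteger_isPrimitiveRoot).isUnit (hu.pow _)
    obtain ⟨a, ha⟩ := h1.exists_left_inv
    have h2 : IsIntegral ℤ (algebraMap ℚ L (p : ℚ)⁻¹) := by
      have h3 := congrArg (algebraMap (𝓞 L) L) ha
      rw [map_mul, map_natCast, map_one] at h3
      rw [map_inv₀, map_natCast, ← eq_inv_of_mul_eq_one_left h3]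
      exact RingOfIntegers.isIntegral_coe a
    rw [isIntegral_algebraMap_iff (algebraMap ℚ L).injective] at h2
    obtain ⟨n, hn⟩ := IsIntegrallyClosed.isIntegral_iff.1 h2
    have hp0 : (p : ℚ) ≠ 0 := by exact_mod_cast hp.out.ne_zero
    have h4 : (p : ℤ) * n = 1 := by
      have : (p : ℚ) * n = 1 := by
        rw [show (n : ℚ) = (p : ℚ)⁻¹ from hn, mul_inv_cancel₀ hp0]
      exact_mod_cast this
    exact (Nat.prime_iff_prime_int.1 hp.out).not_isUnit (IsUnit.of_mul_eq_one n h4)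
  obtain ⟨M, hM, hle⟩ := Ideal.exists_le_maximal (Ideal.span {hζ.toInteger - 1})
    (by rwa [Ne, Ideal.span_singleton_eq_top])
  have hmem : hζ.toInteger - 1 ∈ M := hle (Ideal.mem_span_singleton_self _)
  have hne : hζ.toInteger - 1 ≠ 0 := by
    intro h
    have h1 := congrArg (algebraMap (𝓞 L) L) h
    rw [map_sub, map_one, map_zero, hmap, sub_eq_zero] at h1
    exact hζ.ne_one hp.out.one_lt h1
  refine ⟨⟨M, hM.isPrime, fun h => hne (by rwa [h, Ideal.mem_bot] at hmem)⟩, ?_⟩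
  have h1 := (ordGe_one_iff_mem (q := ⟨M, hM.isPrime, fun h => hne
    (by rwa [h, Ideal.mem_bot] at hmem)⟩) (hζ.toInteger - 1)).2 hmem
  rwa [map_sub, map_one, hmap] at h1

lemma IsQuadCyclo.conj_unitSqrt (H : IsQuadCyclo p m s ζ) (hc : IsConjAut c s ζ) :
    c (unitSqrt p s ζ) = (-1) ^ ((p - 1) / 2) * ζ ^ ((p - 1) / 2) * unitSqrt p s ζ := by
  have h0 : ζ ≠ 0 := H.isPrimitiveRoot.ne_zero hp.out.ne_zero
  have h1 := H.sub_one_ne_zero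
  have h2 : ζ⁻¹ - 1 = (-1) * (ζ⁻¹ * (ζ - 1)) := by
    field_simp
    ring
  rw [unitSqrt, map_div₀, map_pow, map_sub, hc.map_sqrt, hc.map_root, map_one, h2, mul_pow,
    mul_pow, inv_pow]
  rcases neg_one_pow_eq_or L ((p - 1) / 2) with h | h <;> rw [h] <;> field_simp

/-- The behaviour of the primes above `p` under complex conjugation. -/
lemma IsQuadCyclo.exists_conj_prime (H : IsQuadCyclo p m s ζ) (hc : IsConjAut c s ζ) (hp2 : 2 < p)
    (hq : OrdGe q 1 (ζ - 1)) : ∃ q' : HeightOneSpectrum (𝓞 L), OrdGe q' 1 (ζ - 1) ∧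
      (∀ k x, OrdGe q' k (c x) ↔ OrdGe q k x) ∧ (Even ((p - 1) / 2) → q' = q) ∧
      (Odd ((p - 1) / 2) → ∀ q'', OrdGe q'' 1 (ζ - 1) → q'' = q ∨ q'' = q') := by
  obtain ⟨q', hq'⟩ := exists_prime_valuation_eq c q
  have hiff : ∀ k x, OrdGe q' k (c x) ↔ OrdGe q k x := fun k x => by rw [OrdGe, OrdGe, hq']
  have hζ := H.isPrimitiveRoot
  have h0 : ζ ≠ 0 := hζ.ne_zero hp.out.ne_zero
  have hq'π : OrdGe q' 1 (ζ - 1) := by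
    have h1 := (hiff 1 (ζ - 1)).2 hq
    rw [map_sub, map_one, hc.map_root] at h1
    have h2 := h1.neg.mul_left (ordGe_zero_of_pow_eq_one hp.out.ne_zero hζ.pow_eq_one)
    convert h2 using 1
    field_simp
    ring
  obtain ⟨r, hr, hrt⟩ : ∃ r : ℤ, (p : ℤ) ∣ m + r ^ 2 ∧ OrdGe q 1 (unitSqrt p s ζ - r) := by
    obtain ⟨r, hr⟩ := H.exists_dvd_add_sq
    rcases H.ordGe_unitSqrt_sub_or_add hp2 hr hq with h | h
    · refine ⟨-r, by rwa [neg_sq], ?_⟩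
      push_cast
      rwa [sub_neg_eq_add]
    · exact ⟨r, hr, h⟩
  have hct : OrdGe q' 1 (unitSqrt p s ζ - (-1) ^ ((p - 1) / 2) * r) := by
    have h1 := (hiff 1 _).2 hrt
    have h2 : OrdGe q' 1 (ζ ^ ((p - 1) / 2) - 1) :=
      ordGe_one_sub_of_pow_eq_one hζ (H.goodAt hp2 hq'π)
        (by rw [← pow_mul, mul_comm, pow_mul, hζ.pow_eq_one, one_pow]) (one_pow p)
    have ht := ordGe_of_isIntegral (q := q') (H.isIntegral_unitSqrt hp2)
    rw [map_sub, H.conj_unitSqrt hc, map_intCast] at h1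
    rcases neg_one_pow_eq_or L ((p - 1) / 2) with h | h
    · rw [h] at h1 ⊢
      convert h1.sub (h2.mul_right ht) using 1
      ring
    · rw [h] at h1 ⊢
      convert h1.neg.sub (h2.mul_right ht) using 1
      ring
  refine ⟨q', hq'π, hiff, fun he => ?_, fun ho q'' hq'' => ?_⟩
  · rw [he.neg_one_pow, one_mul] at hct
    exact H.eq_of_ordGe hp2 hr hq'π hq hct hrt
  · rw [ho.neg_one_pow] at hct
    rcases H.ordGe_unitSqrt_sub_or_add hp2 hr hq'' with h | h
    · refine Or.inr (H.eq_of_ordGe hp2 (r := -r) (by rwa [neg_sq]) hq'' hq'π ?_ ?_)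
      · push_cast
        rwa [sub_neg_eq_add]
      · push_cast
        rwa [neg_one_mul] at hct
    · exact Or.inl (H.eq_of_ordGe hp2 hr hq'' hq h hrt)

end Conjugation

end

section

open NumberField IsDedekindDomain

section Local

variable {L : Type} [Field L] [NumberField L] {p : ℕ} [hp : Fact p.Prime] {m : ℤ} {s ζ : L}
  {c : L ≃+* L} {q : HeightOneSpectrum (𝓞 L)}

lemma OrdGe.pow_sub_pow {a b : L} {k : ℤ} (ha : OrdGe q 0 a) (hb : OrdGe q 0 b)
    (h : OrdGe q k (a - b)) (n : ℕ) : OrdGe q k (a ^ n - b ^ n) := by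
  induction n with
  | zero => simpa using ordGe_zero
  | succ n ih =>
    have h1 : a ^ (n + 1) - b ^ (n + 1) = a * (a ^ n - b ^ n) + b ^ n * (a - b) := by ring
    rw [h1]
    refine (ih.mul_left ha).add (h.mul_left ?_)
    simpa using hb.pow n

lemma ordGe_zero_of_ordGe_pow_sub_one {Y : L} {n : ℕ} (hn : n ≠ 0) (h : OrdGe q 1 (Y ^ n - 1)) :
    Y ≠ 0 ∧ ord q Y = 0 := by
  obtain ⟨h1, h2⟩ := ord_eq_of_ordGe_sub (q := q) (y := Y ^ n) one_ne_zero
    (by rwa [ord_one, zero_add])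
  rw [ord_one, ord_pow, mul_eq_zero] at h2
  exact ⟨fun h0 => h1 (by rw [h0, zero_pow hn]), h2.resolve_left (by exact_mod_cast hn)⟩

lemma ordGe_cube_expansion (hq : OrdGe q 1 (ζ - 1)) (n : ℕ) :
    OrdGe q 4 (6 * ζ ^ n - (6 + 6 * n * (ζ - 1) + 3 * n * (n - 1) * (ζ - 1) ^ 2 +
      n * (n - 1) * (n - 2) * (ζ - 1) ^ 3)) := by
  have hζ : OrdGe q 0 ζ := by
    have := (hq.mono zero_le_one).add ordGe_one
    rwa [sub_add_cancel] at this
  induction n with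
  | zero => simpa using ordGe_zero
  | succ n ih =>
    have h1 := (ih.mul_left hζ).add ((hq.pow 4).mul_left
      (ordGe_intCast (q := q) ((n : ℤ) * (n - 1) * (n - 2))))
    convert h1 using 1
    push_cast
    ring

lemma IsQuadCyclo.ordGe_pow_sub_self (H : IsQuadCyclo p m s ζ) (hp2 : 2 < p)
    (hq : OrdGe q 1 (ζ - 1)) {Y : L}
    (hY : OrdGe q 0 Y) : OrdGe q 1 (Y ^ p - Y) := by
  have hg := H.goodAt hp2 hq
  obtain ⟨N, hN⟩ := hg.exists_int Y hY
  have h1 := hY.pow_sub_pow (ordGe_intCast N) hN p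
  have h2 : (p : ℤ) ∣ N ^ p - N := by
    rw [← ZMod.intCast_zmod_eq_zero_iff_dvd]
    push_cast
    rw [ZMod.pow_card, sub_self]
  have h3 := H.ordGe_of_dvd hp2 hq h2
  rw [hg.ord_sub_one] at h3
  push_cast at h3
  exact (h1.trans h3).trans hN.symm

lemma IsQuadCyclo.ordGe_sub_one_of_pow (H : IsQuadCyclo p m s ζ) (hp2 : 2 < p)
    (hq : OrdGe q 1 (ζ - 1)) {Y : L}
    (h : OrdGe q 1 (Y ^ p - 1)) : OrdGe q 1 (Y - 1) := by
  obtain ⟨h0, h1⟩ := ordGe_zero_of_ordGe_pow_sub_one hp.out.ne_zero h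
  exact (H.ordGe_pow_sub_self hp2 hq ((ordGe_iff h0).2 h1.ge)).symm.trans h

lemma IsQuadCyclo.dvd_coeff_of_ordGe (H : IsQuadCyclo p m s ζ) (hp5 : 5 ≤ p)
    (hq : OrdGe q 1 (ζ - 1)) {ω : L}
    (hω : ω ^ p = 1) (hω1 : ω ≠ 1) {a₀ a₁ a₂ a₃ : ℤ}
    (h : OrdGe q 4 (a₀ + a₁ * (ω - 1) + a₂ * (ω - 1) ^ 2 + a₃ * (ω - 1) ^ 3 : L)) :
    (p : ℤ) ∣ a₀ ∧ (p : ℤ) ∣ a₁ ∧ (p : ℤ) ∣ a₂ ∧ (p : ℤ) ∣ a₃ := by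
  have hp2 : 2 < p := by omega
  have hg := H.goodAt hp2 hq
  have hτ0 : ω - 1 ≠ 0 := sub_ne_zero.2 hω1
  have hτ : ord q (ω - 1) = 1 :=
    ord_sub_eq_one H.isPrimitiveRoot hg hω (one_pow p) hω1
  have hτ' : OrdGe q 1 (ω - 1) := (ordGe_iff hτ0).2 hτ.ge
  have hp4 : ∀ {a : ℤ}, (p : ℤ) ∣ a → OrdGe q 4 (a : L) := by
    rintro a ⟨b, rfl⟩
    push_cast
    refine OrdGe.mul_right ?_ (ordGe_intCast b)
    rw [ordGe_iff (natCast_prime_ne_zero L), ord_natCast_prime H.isPrimitiveRoot hg]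
    omega
  have key : ∀ (k : ℕ) (a : ℤ), OrdGe q (k + 1) (a * (ω - 1) ^ k : L) → (p : ℤ) ∣ a := by
    intro k a hk
    by_cases ha : (a : L) = 0
    · rw [Int.cast_eq_zero.1 ha]
      exact dvd_zero _
    refine H.dvd_of_ordGe_intCast hp2 hq ((ordGe_iff ha).2 ?_)
    rw [ordGe_iff (mul_ne_zero ha (pow_ne_zero _ hτ0)), ord_mul ha (pow_ne_zero _ hτ0), ord_pow,
      hτ] at hk
    omega
  have hi : ∀ (k : ℕ) (a : ℤ), OrdGe q k (a * (ω - 1) ^ k : L) := fun k a => by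
    simpa using (hτ'.pow k).mul_left (ordGe_intCast a)
  have h0 : (p : ℤ) ∣ a₀ := by
    refine key 0 a₀ ?_
    have := (((h.mono (by norm_num : (1 : ℤ) ≤ 4)).sub
      ((hi 1 a₁).mono (by norm_num : (1 : ℤ) ≤ _))).sub
      ((hi 2 a₂).mono (by norm_num : (1 : ℤ) ≤ _))).sub
      ((hi 3 a₃).mono (by norm_num : (1 : ℤ) ≤ _))
    convert this using 1 <;> ring
  have h1 : (p : ℤ) ∣ a₁ := by
    refine key 1 a₁ ?_
    have := ((((h.sub (hp4 h0)).mono (by norm_num : (2 : ℤ) ≤ 4))).sub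
      ((hi 2 a₂).mono (by norm_num : (2 : ℤ) ≤ _))).sub
      ((hi 3 a₃).mono (by norm_num : (2 : ℤ) ≤ _))
    convert this using 1 <;> ring
  have hm : ∀ (k : ℕ) {a : ℤ}, (p : ℤ) ∣ a → OrdGe q 4 (a * (ω - 1) ^ k : L) := fun k a ha =>
    (hp4 ha).mul_right (by simpa using (hτ'.mono zero_le_one).pow k)
  have h2 : (p : ℤ) ∣ a₂ := by
    refine key 2 a₂ ?_
    have := ((((h.sub (hp4 h0)).sub (hm 1 h1)).mono (by norm_num : (3 : ℤ) ≤ 4))).sub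
      ((hi 3 a₃).mono (by norm_num : (3 : ℤ) ≤ _))
    convert this using 1 <;> ring
  refine ⟨h0, h1, h2, key 3 a₃ ?_⟩
  have := ((h.sub (hp4 h0)).sub (hm 1 h1)).sub (hm 2 h2)
  convert this using 1 <;> ring

lemma IsQuadCyclo.exists_root_ordGe (H : IsQuadCyclo p m s ζ) (hp2 : 2 < p) (hq : OrdGe q 1 (ζ - 1))
    {X : L}
    (hX : OrdGe q 1 (X - 1)) : ∃ ω : L, ω ^ p = 1 ∧ OrdGe q 2 (X - ω) := by
  have hg := H.goodAt hp2 hq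
  have h0 := H.sub_one_ne_zero
  have hy : OrdGe q 0 ((X - 1) / (ζ - 1)) := by
    by_cases h : X - 1 = 0
    · rw [h, zero_div]
      exact ordGe_zero
    rw [ordGe_iff h] at hX
    rw [ordGe_iff (div_ne_zero h h0), ord_div h h0, hg.ord_sub_one]
    omega
  obtain ⟨N, hN⟩ := hg.exists_int _ hy
  obtain ⟨n, hn⟩ : ∃ n : ℕ, (p : ℤ) ∣ N - n := by
    have h1 : (0 : ℤ) ≤ N % p := Int.emod_nonneg _ (by exact_mod_cast hp.out.ne_zero)
    refine ⟨(N % p).toNat, ?_⟩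
    rw [Int.toNat_of_nonneg h1]
    exact Int.dvd_self_sub_emod
  have hn' := H.ordGe_of_dvd hp2 hq hn
  rw [hg.ord_sub_one] at hn'
  push_cast at hn'
  refine ⟨ζ ^ n, by rw [← pow_mul, mul_comm, pow_mul, H.isPrimitiveRoot.pow_eq_one, one_pow], ?_⟩
  have hexp : ∀ k : ℕ, OrdGe q 2 (ζ ^ k - 1 - k * (ζ - 1)) := by
    intro k
    induction k with
    | zero => simpa using ordGe_zero
    | succ k ih =>
      have h1 := (ih.mul_left (ordGe_zero_of_pow_eq_one hp.out.ne_zero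
        H.isPrimitiveRoot.pow_eq_one)).add ((hq.pow 2).mul_left (ordGe_natCast (q := q) k))
      convert h1 using 1
      push_cast
      ring
  have h2 := (hq.mul (hN.trans hn')).sub (hexp n)
  have h3 : X - ζ ^ n = (ζ - 1) * ((X - 1) / (ζ - 1) - n) - (ζ ^ n - 1 - n * (ζ - 1)) := by
    rw [mul_sub, mul_div_cancel₀ _ h0]
    ring
  rwa [h3]

/-- A root of unity congruent to `1` modulo `q ^ 2` is trivial. -/
lemma IsQuadCyclo.eq_one_of_pow_eq_one (H : IsQuadCyclo p m s ζ) (hp2 : 2 < p)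
    (hq : OrdGe q 1 (ζ - 1)) {w : L} {n : ℕ}
    (hn : 0 < n) (hw : w ^ n = 1) (h : OrdGe q 2 (w - 1)) : w = 1 := by
  by_contra hw1
  have hord : orderOf w ≠ 1 := fun h => hw1 (orderOf_eq_one_iff.1 h)
  have hpos : 0 < orderOf w := (isOfFinOrder_iff_pow_eq_one.2 ⟨n, hn, hw⟩).orderOf_pos
  obtain ⟨l, hl, k, hk⟩ := Nat.exists_prime_and_dvd hord
  have hk0 : 0 < k := Nat.pos_of_ne_zero (by rintro rfl; omega)
  have hwl : (w ^ k) ^ l = 1 := by rw [← pow_mul, mul_comm, ← hk, pow_orderOf_eq_one]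
  have hwk : w ^ k ≠ 1 := by
    intro h1
    have h2 := Nat.le_of_dvd hk0 (orderOf_dvd_of_pow_eq_one h1)
    have := hl.two_le
    nlinarith
  have h2 : OrdGe q 2 (w ^ k - 1) := by
    simpa using (ordGe_zero_of_pow_eq_one hn.ne' hw).pow_sub_pow ordGe_one h k
  by_cases hlp : l = p
  · rw [hlp] at hwl
    rw [ordGe_iff (sub_ne_zero.2 hwk),
      ord_sub_eq_one H.isPrimitiveRoot (H.goodAt hp2 hq) hwl (one_pow p) hwk] at h2
    omega
  · have h3 : ∑ i ∈ Finset.range l, (w ^ k) ^ i = 0 := by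
      have := mul_neg_geom_sum (w ^ k) l
      rw [hwl, sub_self, mul_eq_zero] at this
      exact this.resolve_left (sub_ne_zero.2 (Ne.symm hwk))
    have h4 : OrdGe q 2 (∑ i ∈ Finset.range l, ((w ^ k) ^ i - 1)) :=
      OrdGe.sum _ _ fun i _ => by
        simpa using (ordGe_zero_of_pow_eq_one hl.ne_zero hwl).pow_sub_pow ordGe_one h2 i
    rw [Finset.sum_sub_distrib, h3, zero_sub, Finset.sum_const, Finset.card_range, nsmul_eq_mul,
      mul_one] at h4
    have h5 := h4.neg.mono (by norm_num : (1 : ℤ) ≤ 2)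
    rw [neg_neg] at h5
    have h6 := H.dvd_of_ordGe_intCast hp2 hq (n := l) (by exact_mod_cast h5)
    exact hlp ((Nat.prime_dvd_prime_iff_eq hp.out hl).1 (by exact_mod_cast h6)).symm

/-- Up to a `p`-th power, every root of unity is a `p`-th root of unity. -/
lemma IsQuadCyclo.exists_root_mul_pow (H : IsQuadCyclo p m s ζ) (hp2 : 2 < p) {w : L} {n : ℕ}
    (hn : 0 < n) (hw : w ^ n = 1) :
    ∃ ω : L, ω ^ p = 1 ∧ w = ω * w ^ p := by
  obtain ⟨q, hq⟩ := exists_prime_ordGe_sub_one H.isPrimitiveRoot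
  have hw0 : w ≠ 0 := by
    rintro rfl
    rw [zero_pow hn.ne'] at hw
    exact zero_ne_one hw
  have hinv : (w⁻¹) ^ n = 1 := by rw [inv_pow, hw, inv_one]
  have h1 := (H.ordGe_pow_sub_self hp2 hq (ordGe_zero_of_pow_eq_one hn.ne' hw)).mul_right
    (ordGe_zero_of_pow_eq_one hn.ne' hinv)
  rw [sub_mul, mul_inv_cancel₀ hw0] at h1
  obtain ⟨ω, hω, h2⟩ := H.exists_root_ordGe hp2 hq h1
  have hω0 : ω ≠ 0 := by
    rintro rfl
    rw [zero_pow hp.out.ne_zero] at hω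
    exact zero_ne_one hω
  have hωi : (ω⁻¹) ^ p = 1 := by rw [inv_pow, hω, inv_one]
  refine ⟨ω⁻¹, hωi, ?_⟩
  have h3 := h2.mul_right (ordGe_zero_of_pow_eq_one hp.out.ne_zero hωi)
  rw [sub_mul, mul_inv_cancel₀ hω0] at h3
  have h4 := H.eq_one_of_pow_eq_one hp2 hq (n := p * n) (Nat.mul_pos hp.out.pos hn) ?_ h3
  · field_simp at h4 ⊢
    exact h4.symm
  · have h5 : (w ^ p * w⁻¹ * ω⁻¹) ^ (p * n) = ((w ^ n) ^ p) ^ p * ((w⁻¹) ^ n) ^ p *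
      ((ω⁻¹) ^ p) ^ n := by
      ring
    rw [h5, hw, hinv, hωi]
    simp

lemma IsQuadCyclo.exists_unit_div_conj_eq (H : IsQuadCyclo p m s ζ) (hc : IsConjAut c s ζ)
    (hp2 : 2 < p) (u : (𝓞 L)ˣ) :
    ∃ ω v : L, ω ^ p = 1 ∧ v ≠ 0 ∧
      algebraMap (𝓞 L) L u / c (algebraMap (𝓞 L) L u) = ω * v ^ p := by
  have hu0 : algebraMap (𝓞 L) L u ≠ 0 := by
    simp
  have hcu0 : c (algebraMap (𝓞 L) L u) ≠ 0 := by simp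
  have hxint : IsIntegral ℤ (algebraMap (𝓞 L) L u / c (algebraMap (𝓞 L) L u)) := by
    have h1 : (c (algebraMap (𝓞 L) L u))⁻¹ =
        algebraMap (𝓞 L) L (RingOfIntegers.mapRingEquiv c (u⁻¹ : (𝓞 L)ˣ)) := by
      change _ = c (algebraMap (𝓞 L) L _)
      rw [← map_inv₀]
      congr 1
      refine inv_eq_of_mul_eq_one_right ?_
      rw [← map_mul]
      simp
    rw [div_eq_mul_inv, h1]
    exact (RingOfIntegers.isIntegral_coe _).mul (RingOfIntegers.isIntegral_coe _)
  obtain ⟨n, hn, hw⟩ := hc.exists_pow_eq_one hxint (by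
    rw [map_div₀, H.conj_conj hc]
    field_simp)
  obtain ⟨ω, hω, h⟩ := H.exists_root_mul_pow hp2 hn hw
  exact ⟨ω, _, hω, div_ne_zero hu0 hcu0, h⟩

end Local

end

section

open NumberField IsDedekindDomain

section Descent

variable {L : Type} [Field L] [NumberField L] {p : ℕ} [hp : Fact p.Prime] {m : ℤ} {s ζ : L}
  {c : L ≃+* L} {q : HeightOneSpectrum (𝓞 L)} {X ω ω' : L}

lemma ne_zero_of_pow_eq_one (hω : ω ^ p = 1) : ω ≠ 0 := by
  rintro rfl
  rw [zero_pow hp.out.ne_zero] at hω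
  exact zero_ne_one hω

/-- `X ^ p - 1` is nonzero and generates the `p`-th power of a fractional ideal. -/
structure IsPowIdeal (p : ℕ) (X : L) : Prop where
  pow_ne_one : X ^ p ≠ 1
  dvd_ord : ∀ q : HeightOneSpectrum (𝓞 L), (p : ℤ) ∣ ord q (X ^ p - 1)

lemma IsPowIdeal.sub_ne_zero (hX : IsPowIdeal p X) (hω : ω ^ p = 1) : X - ω ≠ 0 :=
  sub_ne_zero_of_pow_ne_one hX.pow_ne_one hω

lemma IsPowIdeal.div_root (hX : IsPowIdeal p X) (hω : ω ^ p = 1) : IsPowIdeal p (X / ω) := by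
  have h : (X / ω) ^ p = X ^ p := by rw [div_pow, hω, div_one]
  exact ⟨by rw [h]; exact hX.pow_ne_one, by rw [h]; exact hX.dvd_ord⟩

lemma IsQuadCyclo.ord_sub_root (H : IsQuadCyclo p m s ζ) (hp2 : 2 < p) (hq : OrdGe q 1 (ζ - 1))
    (hω : ω ^ p = 1) (hω' : ω' ^ p = 1) (hne : ω ≠ ω') (hX : OrdGe q 2 (X - ω')) :
    ord q (X - ω) = 1 := by
  have h0 := sub_ne_zero.2 hne.symm
  have h1 := ord_sub_eq_one H.isPrimitiveRoot (H.goodAt hp2 hq) hω' hω hne.symm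
  rw [← h1]
  refine (ord_eq_of_ordGe_sub h0 ?_).2
  rw [h1, sub_sub_sub_cancel_right]
  exact hX

lemma IsQuadCyclo.ord_pow_sub_one (H : IsQuadCyclo p m s ζ) (hp2 : 2 < p)
    (hq : OrdGe q 1 (ζ - 1)) (hX : X ^ p ≠ 1) (hω : ω ^ p = 1) (h : OrdGe q 2 (X - ω)) :
    ord q (X ^ p - 1) = ord q (X - ω) + (p - 1) := by
  classical
  have hmem : ω ∈ Polynomial.nthRootsFinset p (1 : L) :=
    (Polynomial.mem_nthRootsFinset hp.out.pos (1 : L)).2 hω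
  rw [pow_sub_one_eq_prod H.isPrimitiveRoot, ord_prod _ _ fun ω' hω' =>
    sub_ne_zero_of_pow_ne_one hX ((Polynomial.mem_nthRootsFinset hp.out.pos (1 : L)).1 hω'),
    ← Finset.add_sum_erase _ _ hmem, Finset.sum_congr rfl fun ω' hω' => H.ord_sub_root hp2 hq
      ((Polynomial.mem_nthRootsFinset hp.out.pos (1 : L)).1 (Finset.mem_of_mem_erase hω')) hω
      (Finset.ne_of_mem_erase hω') h, Finset.sum_const, Finset.card_erase_of_mem hmem,
    H.isPrimitiveRoot.card_nthRootsFinset, nsmul_eq_mul, mul_one,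
    Nat.cast_sub hp.out.one_le, Nat.cast_one]

lemma IsQuadCyclo.ordGe_sub_root (H : IsQuadCyclo p m s ζ) (hp2 : 2 < p)
    (hq : OrdGe q 1 (ζ - 1)) (hX : IsPowIdeal p X) (hω : ω ^ p = 1) (h : OrdGe q 2 (X - ω)) :
    OrdGe q (p + 1) (X - ω) := by
  have h0 := hX.sub_ne_zero hω
  have h1 := H.ord_pow_sub_one hp2 hq hX.pow_ne_one hω h
  obtain ⟨k, hk⟩ := hX.dvd_ord q
  rw [ordGe_iff h0] at h ⊢
  have hk2 : 2 ≤ k := by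
    by_contra hlt
    have : (p : ℤ) * k ≤ p * 1 := mul_le_mul_of_nonneg_left (by omega) (by positivity)
    omega
  nlinarith

/-- If `X` and `ξ` are close at `q`, then so are the quotients `(X - ω) / (X - ω')` and
`(ξ - ω) / (ξ - ω')`. -/
lemma IsQuadCyclo.ordGe_div_sub_div (H : IsQuadCyclo p m s ζ) (hp2 : 2 < p)
    (hq : OrdGe q 1 (ζ - 1)) (hX : IsPowIdeal p X) {ξ : L} (hξ : ξ ^ p = 1) (hω : ω ^ p = 1)
    (hω' : ω' ^ p = 1) (hne : ω' ≠ ξ) (h : OrdGe q 2 (X - ξ)) :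
    OrdGe q p ((X - ω) / (X - ω') - (ξ - ω) / (ξ - ω')) := by
  have h0 := hX.sub_ne_zero hω'
  have h0' := sub_ne_zero.2 hne.symm
  have h1 : (X - ω) / (X - ω') - (ξ - ω) / (ξ - ω') =
      ((X - ξ) * (ω - ω')) * ((X - ω') * (ξ - ω'))⁻¹ := by
    field_simp
    ring
  have h2 : OrdGe q (-2) ((X - ω') * (ξ - ω'))⁻¹ := by
    rw [ordGe_iff (inv_ne_zero (mul_ne_zero h0 h0')), ord_inv, ord_mul h0 h0',
      H.ord_sub_root hp2 hq hω' hξ hne h,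
      ord_sub_eq_one H.isPrimitiveRoot (H.goodAt hp2 hq) hξ hω' hne.symm]
    norm_num
  rw [h1]
  have h3 := ((H.ordGe_sub_root hp2 hq hX hξ h).mul
    (ordGe_one_sub_of_pow_eq_one H.isPrimitiveRoot (H.goodAt hp2 hq) hω hω')).mul h2
  exact h3.mono (by omega)

/-- The normalized quotient of two factors of `X ^ p - 1` is a `p`-th power. -/
lemma IsQuadCyclo.exists_pow_eq_div (H : IsQuadCyclo p m s ζ) (hp2 : 2 < p)
    (hreg : ¬ p ∣ classNumber L) (hX : IsPowIdeal p X)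
    (hX1 : ∀ q : HeightOneSpectrum (𝓞 L), OrdGe q 1 (ζ - 1) → OrdGe q 2 (X - 1))
    (hω : ω ^ p = 1) (hω1 : ω ≠ 1) (hω' : ω' ^ p = 1) (hω1' : ω' ≠ 1) :
    ∃ γ : L, γ ^ p = (X - ω) / (X - ω') / ((1 - ω) / (1 - ω')) := by
  have hζ := H.isPrimitiveRoot
  obtain ⟨u, a, ha, hu⟩ :=
    exists_sub_eq_unit_mul_pow_mul_sub hζ hreg hX.pow_ne_one hX.dvd_ord hω hω'
  have h0 := sub_ne_zero.2 hω1.symm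
  have h0' := sub_ne_zero.2 hω1'.symm
  obtain ⟨v, hv⟩ := exists_unit_eq_of_ord (div_ne_zero h0' h0) fun q => by
    rw [ord_div h0' h0, ord_sub_eq_of_pow_eq_one hζ (one_pow p) hω hω1.symm,
      ord_sub_eq_of_pow_eq_one hζ (one_pow p) hω' hω1'.symm, sub_self]
  have heq : (X - ω) / (X - ω') / ((1 - ω) / (1 - ω')) =
      algebraMap (𝓞 L) L (u * v : (𝓞 L)ˣ) * a ^ p := by
    rw [Units.val_mul, map_mul, hv, hu]
    field_simp
  obtain ⟨b, hb⟩ := exists_pow_eq_of_ordGe hp2 hζ hreg (fun q hq => H.goodAt hp2 hq) (u * v) ha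
    fun q hq => by
      rw [← heq]
      have h1 := (H.ordGe_div_sub_div hp2 hq hX (one_pow p) hω hω' hω1' (hX1 q hq)).mul_right
        (y := (1 - ω') / (1 - ω)) (by
          rw [ordGe_iff (div_ne_zero h0' h0), ← hv, ord_unit])
      convert h1 using 1
      field_simp
  exact ⟨b * a, by rw [mul_pow, hb, heq]⟩

end Descent

end

section

open NumberField IsDedekindDomain

section SplitDescent

variable {L : Type} [Field L] [NumberField L] {p : ℕ} [hp : Fact p.Prime] {m : ℤ} {s ζ : L}
  {c : L ≃+* L} {q : HeightOneSpectrum (𝓞 L)} {X ω ω' : L}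

lemma not_dvd_twelve (hp5 : 5 ≤ p) : ¬ (p : ℤ) ∣ 12 := by
  intro h
  have h1 : p ∣ 12 := by exact_mod_cast h
  have h2 : p ∣ 2 * (2 * 3) := h1
  rcases hp.out.dvd_mul.1 h2 with h | h
  · have := Nat.le_of_dvd (by norm_num) h
    omega
  · rcases hp.out.dvd_mul.1 h with h | h <;> have := Nat.le_of_dvd (by norm_num) h <;> omega

lemma sq_ne_one_of_pow_eq_one (hp2 : 2 < p) {η : L} (hη : η ^ p = 1) (hη1 : η ≠ 1) : η ^ 2 ≠ 1 := by
  intro h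
  have h1 := (isPrimitiveRoot_of_pow_eq_one hη hη1).dvd_of_pow_eq_one 2 h
  have := Nat.le_of_dvd two_pos h1
  omega

/-- If `η` is a nontrivial `p`-th root of unity, then `(1 + η) ^ 2` is not congruent to a multiple
of a `p`-th root of unity. -/
lemma IsQuadCyclo.not_ordGe_one_add_sq_sub (H : IsQuadCyclo p m s ζ) (hp5 : 5 ≤ p)
    (hq : OrdGe q 1 (ζ - 1)) {η : L} (hη : η ^ p = 1) (hη1 : η ≠ 1) (hω : ω ^ p = 1) (N : ℤ) :
    ¬ OrdGe q 4 ((1 + η) ^ 2 - ω * N) := by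
  intro h
  have hp2 : 2 < p := by omega
  obtain ⟨k, -, rfl⟩ := (isPrimitiveRoot_of_pow_eq_one hη hη1).eq_pow_of_pow_eq_one hω
  have hηq : OrdGe q 1 (η - 1) :=
    ordGe_one_sub_of_pow_eq_one H.isPrimitiveRoot (H.goodAt hp2 hq) hη (one_pow p)
  have h1 := (h.mul_left (ordGe_intCast (q := q) 6)).add
    ((ordGe_cube_expansion hηq k).mul_left (ordGe_intCast (q := q) N))
  have h2 := H.dvd_coeff_of_ordGe hp5 hq hη hη1 (a₀ := 24 - 6 * N) (a₁ := 24 - 6 * N * k)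
    (a₂ := 6 - 3 * N * k * (k - 1)) (a₃ := -N * k * (k - 1) * (k - 2)) (by
      convert h1 using 1
      push_cast
      ring)
  refine not_dvd_twelve hp5 ?_
  have h3 : (12 : ℤ) = k * (24 - 6 * N) - k * (24 - 6 * N * k) +
      2 * (6 - 3 * N * k * (k - 1)) := by ring
  rw [h3]
  exact ((h2.1.mul_left _).sub (h2.2.1.mul_left _)).add (h2.2.2.1.mul_left _)

lemma IsQuadCyclo.exists_div_conj_eq (H : IsQuadCyclo p m s ζ) (hc : IsConjAut c s ζ)
    (hp2 : 2 < p) (hreg : ¬ p ∣ classNumber L) (hX : IsPowIdeal p X) (hω : ω ^ p = 1)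
    (hω' : ω' ^ p = 1) : ∃ θ δ : L, θ ^ p = 1 ∧ δ ≠ 0 ∧
      (X - ω) / (X - ω') / c ((X - ω) / (X - ω')) = θ * δ ^ p := by
  obtain ⟨u, a, ha, hu⟩ := exists_sub_eq_unit_mul_pow_mul_sub H.isPrimitiveRoot hreg hX.pow_ne_one
    hX.dvd_ord hω hω'
  obtain ⟨θ, v, hθ, hv, h⟩ := H.exists_unit_div_conj_eq hc hp2 u
  refine ⟨θ, v * (a / c a), hθ, mul_ne_zero hv (div_ne_zero ha (by simpa using ha)), ?_⟩
  rw [hu, map_mul, map_pow, mul_div_mul_comm, h, mul_pow, div_pow]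
  ring

/-- If the quotient of two local units is a `p`-th power times a root of unity, then it is
congruent to an integer times this root of unity. -/
lemma exists_ordGe_sub_mul (hζ : IsPrimitiveRoot ζ p) (hg : GoodAt ζ q) {A A' B B' θ δ : L}
    (hB0 : B ≠ 0) (hB : ord q B = 0) (hB0' : B' ≠ 0) (hB' : ord q B' = 0)
    (hAB : OrdGe q p (A - B)) (hAB' : OrdGe q p (A' - B')) (hθ : θ ^ p = 1) (hδ : δ ≠ 0)
    (h : A / A' = θ * δ ^ p) : ∃ N : ℤ, OrdGe q p (B - θ * N * B') := by
  have hp1 := hp.out.one_lt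
  have hA := ord_eq_of_ordGe_sub hB0 (hAB.mono (by omega))
  have hA' := ord_eq_of_ordGe_sub hB0' (hAB'.mono (by omega))
  have hθ0 : θ ≠ 0 := ne_zero_of_pow_eq_one hθ
  have hδo : ord q δ = 0 := by
    have h3 := congrArg (ord q) h
    rw [ord_div hA.1 hA'.1, hA.2, hA'.2, hB, hB', ord_mul hθ0 (pow_ne_zero _ hδ),
      ord_eq_zero_of_pow_eq_one hp.out.ne_zero hθ, ord_pow, sub_self, zero_add, eq_comm,
      mul_eq_zero] at h3
    exact h3.resolve_left (by exact_mod_cast hp.out.ne_zero)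
  obtain ⟨N, hN⟩ := exists_int_ordGe_pow_sub hζ hg ((ordGe_iff hδ).2 hδo.ge)
  refine ⟨N, ?_⟩
  have hθq : OrdGe q 0 θ := ordGe_zero_of_pow_eq_one hp.out.ne_zero hθ
  have hA'q : OrdGe q 0 A' := (ordGe_iff hA'.1).2 (by rw [hA'.2, hB'])
  have h1 : OrdGe q p (θ * (δ ^ p - N) * A') := (hN.mul_left hθq).mul_right hA'q
  have h2 : OrdGe q 0 (θ * N) := (ordGe_intCast N).mul_left hθq
  have h3 : OrdGe q p (θ * N * (A' - B')) := hAB'.mul_left h2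
  have h4 : OrdGe q p (B - A) := hAB.symm
  have h6 := (h4.add h1).add h3
  rw [div_eq_iff hA'.1] at h
  have h7 : B - θ * N * B' = B - A + θ * (δ ^ p - N) * A' + θ * N * (A' - B') := by
    linear_combination h
  rw [h7]
  exact h6

/-- If `p` is congruent to `3` modulo `4`, the local `p`-th roots of unity attached to `X` at two
conjugate primes above `p` agree. -/
lemma IsQuadCyclo.eq_one_of_conj (H : IsQuadCyclo p m s ζ) (hc : IsConjAut c s ζ)
    (hp5 : 5 ≤ p) (hreg : ¬ p ∣ classNumber L) (hX : IsPowIdeal p X)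
    {q' : HeightOneSpectrum (𝓞 L)} (hq : OrdGe q 1 (ζ - 1)) (hq' : OrdGe q' 1 (ζ - 1))
    (hiff : ∀ k x, OrdGe q' k (c x) ↔ OrdGe q k x) (h1 : OrdGe q 2 (X - 1)) {η : L}
    (hη : η ^ p = 1) (h2 : OrdGe q' 2 (X - η)) : η = 1 := by
  by_contra hη1
  have hp2 : 2 < p := by omega
  have hζ := H.isPrimitiveRoot
  have hη0 : η ≠ 0 := ne_zero_of_pow_eq_one hη
  have hηsq := sq_ne_one_of_pow_eq_one hp2 hη hη1
  have hη2 : (η ^ 2) ^ p = 1 := by rw [← pow_mul, mul_comm, pow_mul, hη, one_pow]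
  have hηi : (η⁻¹) ^ p = 1 := by rw [inv_pow, hη, inv_one]
  have hηi1 : η⁻¹ ≠ 1 := fun h => hη1 (inv_eq_one.1 h)
  have hηiη : η⁻¹ ≠ η := by
    intro h
    apply hηsq
    rw [sq]
    nth_rewrite 1 [← h]
    exact inv_mul_cancel₀ hη0
  have hA1 := H.ordGe_div_sub_div hp2 hq hX (one_pow p) hη2 hηi hηi1 h1
  have hA2 := H.ordGe_div_sub_div hp2 hq' hX hη hη2 hηi hηiη h2
  obtain ⟨θ, δ, hθ, hδ, h⟩ := H.exists_div_conj_eq hc hp2 hreg hX hη2 hηi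
  have hA2' : OrdGe q p (c ((X - η ^ 2) / (X - η⁻¹)) - (η⁻¹ - η⁻¹ ^ 2) / (η⁻¹ - η)) := by
    rw [← hiff, map_sub, H.conj_conj hc]
    have h3 : c ((η⁻¹ - η⁻¹ ^ 2) / (η⁻¹ - η)) = (η - η ^ 2) / (η - η⁻¹) := by
      rw [map_div₀, map_sub, map_sub, map_pow, map_inv₀, hc.map_eq_inv hζ hη, inv_inv]
    rw [h3]
    exact hA2
  have hg := H.goodAt hp2 hq
  have hone : ∀ {a b : L}, a ^ p = 1 → b ^ p = 1 → a ≠ b → ord q (a - b) = 1 := fun ha hb hab =>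
    ord_sub_eq_one hζ hg ha hb hab
  have hηη2 : η⁻¹ ≠ η⁻¹ ^ 2 := by
    intro h
    apply hη1
    field_simp at h
    exact h
  have hηi2 : (η⁻¹ ^ 2) ^ p = 1 := by rw [← pow_mul, mul_comm, pow_mul, hηi, one_pow]
  have h3 := sub_ne_zero.2 hηsq.symm
  have h4 := sub_ne_zero.2 hηi1.symm
  have h5 := sub_ne_zero.2 hηη2
  have h6 := sub_ne_zero.2 hηiη
  obtain ⟨N, hN⟩ := exists_ordGe_sub_mul hζ hg (div_ne_zero h3 h4)
    (by rw [ord_div h3 h4, hone (one_pow p) hη2 hηsq.symm, hone (one_pow p) hηi hηi1.symm,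
        sub_self])
    (div_ne_zero h5 h6)
    (by rw [ord_div h5 h6, hone hηi hηi2 hηη2, hone hηi hη hηiη, sub_self]) hA1 hA2' hθ hδ h
  have hηq : OrdGe q 0 η := ordGe_zero_of_pow_eq_one hp.out.ne_zero hη
  have hηiq : OrdGe q 0 η⁻¹ := ordGe_zero_of_pow_eq_one hp.out.ne_zero hηi
  have h7 : OrdGe q 0 (η⁻¹ * (1 + η)) := (ordGe_one.add hηq).mul_left hηiq
  have h8 : OrdGe q 4 ((η⁻¹ * (1 + η)) *
      ((1 - η ^ 2) / (1 - η⁻¹) - θ * N * ((η⁻¹ - η⁻¹ ^ 2) / (η⁻¹ - η)))) :=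
    (hN.mul_left h7).mono (by omega)
  have e1 : (1 - η ^ 2) / (1 - η⁻¹) = -η * (1 + η) := by
    rw [div_eq_iff h4]
    field_simp
    ring
  have e2 : (η⁻¹ - η⁻¹ ^ 2) / (η⁻¹ - η) * (1 + η) = -η⁻¹ := by
    rw [div_mul_eq_mul_div, div_eq_iff h6]
    field_simp
    ring
  refine H.not_ordGe_one_add_sq_sub hp5 hq hη hη1 (ω := θ * η⁻¹ ^ 2)
    (by rw [mul_pow, hθ, hηi2, one_mul]) N ?_
  have e3 : (1 + η) ^ 2 - θ * η⁻¹ ^ 2 * (N : L) = -((η⁻¹ * (1 + η)) *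
      ((1 - η ^ 2) / (1 - η⁻¹) - θ * N * ((η⁻¹ - η⁻¹ ^ 2) / (η⁻¹ - η)))) := by
    rw [e1]
    have e4 : η⁻¹ * η = 1 := inv_mul_cancel₀ hη0
    linear_combination -(1 + η) ^ 2 * e4 - η⁻¹ * θ * N * e2
  rw [e3]
  exact h8.neg

end SplitDescent

end

section

open NumberField IsDedekindDomain

section SplitDescent

variable {L : Type} [Field L] [NumberField L] {p : ℕ} [hp : Fact p.Prime] {m : ℤ} {s ζ : L}
  {c : L ≃+* L} {q : HeightOneSpectrum (𝓞 L)} {X ω ω' : L}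

lemma IsPowIdeal.ord_pow_sub_one_of_pow_eq (hX : IsPowIdeal p X) (hζ : IsPrimitiveRoot ζ p)
    (hω : ω ^ p = 1) (hω1 : ω ≠ 1) (hω' : ω' ^ p = 1) (hne : ω ≠ ω') {γ : L}
    (hγ : γ ^ p = (X - ω) / (X - ω') / ((1 - ω) / (1 - ω'))) (hω1' : ω' ≠ 1) :
    γ ^ p ≠ 1 ∧ ∀ q : HeightOneSpectrum (𝓞 L),
      ord q (γ ^ p - 1) = ord q (X - 1) - ord q (X - ω') := by
  have h1 := hX.sub_ne_zero (one_pow p)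
  have h2 := hX.sub_ne_zero hω'
  have h3 := _root_.sub_ne_zero.2 hω1.symm
  have h4 := _root_.sub_ne_zero.2 hne
  have h5 := _root_.sub_ne_zero.2 hω1'.symm
  have h6 : γ ^ p - 1 = (X - 1) * (ω - ω') / ((X - ω') * (1 - ω)) := by
    rw [hγ]
    field_simp
    ring
  have h7 : γ ^ p - 1 ≠ 0 := by
    rw [h6]
    exact div_ne_zero (mul_ne_zero h1 h4) (mul_ne_zero h2 h3)
  refine ⟨_root_.sub_ne_zero.1 h7, fun q => ?_⟩
  rw [h6, ord_div (mul_ne_zero h1 h4) (mul_ne_zero h2 h3), ord_mul h1 h4, ord_mul h2 h3,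
    ord_sub_eq_of_pow_eq_one hζ hω hω' hne, ord_sub_eq_of_pow_eq_one hζ (one_pow p) hω hω1.symm]
  ring

lemma IsPowIdeal.of_ord_eq (hX : IsPowIdeal p X) (hζ : IsPrimitiveRoot ζ p) (hω' : ω' ^ p = 1)
    {γ : L} (hγ : γ ^ p ≠ 1 ∧ ∀ q : HeightOneSpectrum (𝓞 L),
      ord q (γ ^ p - 1) = ord q (X - 1) - ord q (X - ω')) : IsPowIdeal p γ :=
  have h (q : HeightOneSpectrum (𝓞 L)) : (p : ℤ) ∣ ord q (γ ^ p - 1) := by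
    rw [hγ.2]
    exact dvd_ord_sub_sub_ord_sub hζ hX.pow_ne_one (hX.dvd_ord q) (one_pow p) hω'
  ⟨hγ.1, h⟩

/-- If `p` is congruent to `3` modulo `4`, then `X ^ p - 1` cannot generate the `p`-th power of
an ideal when `X` is close to `1` at all primes above `p`. -/
theorem IsQuadCyclo.false_of_odd (H : IsQuadCyclo p m s ζ) (hc : IsConjAut c s ζ)
    (hp5 : 5 ≤ p) (hreg : ¬ p ∣ classNumber L) (hodd : Odd ((p - 1) / 2)) (hX : IsPowIdeal p X)
    (hX1 : ∀ q : HeightOneSpectrum (𝓞 L), OrdGe q 1 (ζ - 1) → OrdGe q 2 (X - 1)) : False := by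
  have hp2 : 2 < p := by omega
  have hζ := H.isPrimitiveRoot
  obtain ⟨q, hq⟩ := exists_prime_ordGe_sub_one hζ
  obtain ⟨q', hq', hiff, -, hall⟩ := H.exists_conj_prime hc hp2 hq
  have hall := hall hodd
  induction hn : (ord q (X ^ p - 1)).toNat using Nat.strong_induction_on generalizing X with
  | _ n ih =>
    have hζ1 : ζ ≠ 1 := sub_ne_zero.1 H.sub_one_ne_zero
    have hζ2 : (ζ ^ 2) ^ p = 1 := by rw [← pow_mul, mul_comm, pow_mul, hζ.pow_eq_one, one_pow]
    have hζ21 := sq_ne_one_of_pow_eq_one hp2 hζ.pow_eq_one hζ1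
    have hne : ζ ≠ ζ ^ 2 := by
      intro h
      apply hζ1
      apply mul_left_cancel₀ (ne_zero_of_pow_eq_one hζ.pow_eq_one)
      rw [mul_one, ← sq, ← h]
    obtain ⟨γ, hγ⟩ := H.exists_pow_eq_div hp2 hreg hX hX1 hζ.pow_eq_one hζ1 hζ2 hζ21
    have hγo := hX.ord_pow_sub_one_of_pow_eq hζ hζ.pow_eq_one hζ1 hζ2 hne hγ hζ21
    have hγI := hX.of_ord_eq hζ hζ2 hγo
    have hord : ∀ q : HeightOneSpectrum (𝓞 L), OrdGe q 1 (ζ - 1) →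
        ord q (γ ^ p - 1) = ord q (X ^ p - 1) - p ∧ p ≤ ord q (γ ^ p - 1) := by
      intro q hq
      have h1 := (ordGe_iff (hX.sub_ne_zero (one_pow p))).1
        (H.ordGe_sub_root hp2 hq hX (one_pow p) (hX1 q hq))
      rw [hγo.2, H.ord_sub_root hp2 hq hζ2 (one_pow p) hζ21 (hX1 q hq),
        H.ord_pow_sub_one hp2 hq hX.pow_ne_one (one_pow p) (hX1 q hq)]
      omega
    have hroot : ∀ q : HeightOneSpectrum (𝓞 L), OrdGe q 1 (ζ - 1) →
        ∃ ω, ω ^ p = 1 ∧ OrdGe q 2 (γ - ω) := fun q hq =>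
      H.exists_root_ordGe hp2 hq (H.ordGe_sub_one_of_pow hp2 hq
        ((ordGe_iff (sub_ne_zero.2 hγo.1)).2 (by have := (hord q hq).2; omega)))
    obtain ⟨ω, hω, h1⟩ := hroot q hq
    obtain ⟨ω', hω', h1'⟩ := hroot q' hq'
    have hω0 := ne_zero_of_pow_eq_one hω
    have hωi : OrdGe q 0 ω⁻¹ := ordGe_zero_of_pow_eq_one hp.out.ne_zero
      (by rw [inv_pow, hω, inv_one] : ω⁻¹ ^ p = 1)
    have hωi' : OrdGe q' 0 ω⁻¹ := ordGe_zero_of_pow_eq_one hp.out.ne_zero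
      (by rw [inv_pow, hω, inv_one] : ω⁻¹ ^ p = 1)
    have h2 : OrdGe q 2 (γ / ω - 1) := by
      have := h1.mul_left hωi
      rwa [mul_sub, inv_mul_cancel₀ hω0, ← div_eq_inv_mul] at this
    have h2' : OrdGe q' 2 (γ / ω - ω' / ω) := by
      have := h1'.mul_left hωi'
      rwa [mul_sub, ← div_eq_inv_mul, ← div_eq_inv_mul] at this
    have hY := hγI.div_root hω
    have h3 := H.eq_one_of_conj hc hp5 hreg hY hq hq' hiff h2
      (by rw [div_pow, hω, hω', div_one]) h2'
    rw [h3] at h2'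
    have h4 := hord q hq
    have h5 : (γ / ω) ^ p = γ ^ p := by rw [div_pow, hω, div_one]
    refine ih _ ?_ hY (fun q'' hq'' => ?_) rfl
    · rw [← hn, h5]
      omega
    · rcases hall q'' hq'' with rfl | rfl
      exacts [h2, h2']

end SplitDescent

end

section

open NumberField IsDedekindDomain

section RealDescent

variable {L : Type} [Field L] [NumberField L] {p : ℕ} [hp : Fact p.Prime] {m : ℤ} {s ζ : L}
  {c : L ≃+* L} {q : HeightOneSpectrum (𝓞 L)} {X ω ω' : L}

lemma finite_setOf_ord_pos (x : L) : {q : HeightOneSpectrum (𝓞 L) | 0 < ord q x}.Finite := by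
  rcases eq_or_ne x 0 with rfl | hx
  · simp [ord]
  · refine (HeightOneSpectrum.Support.finite (𝓞 L) x⁻¹).subset fun q hq => ?_
    have h1 : ¬ OrdGe q 0 x⁻¹ := by
      rw [ordGe_iff (inv_ne_zero hx), ord_inv]
      simp only [Set.mem_ofPred_eq] at hq
      omega
    rw [OrdGe, neg_zero, WithZero.exp_zero, not_le] at h1
    exact h1

lemma ord_sub_eq_zero_of_not_ordGe (hζ : IsPrimitiveRoot ζ p) (hq : ¬ OrdGe q 1 (ζ - 1))
    (hω : ω ^ p = 1) (hω' : ω' ^ p = 1) (hne : ω ≠ ω') : ord q (ω - ω') = 0 := by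
  have h0 := sub_ne_zero.2 hne
  have h1 : OrdGe q 0 (ω - ω') := (ordGe_zero_of_pow_eq_one hp.out.ne_zero hω).sub
    (ordGe_zero_of_pow_eq_one hp.out.ne_zero hω')
  have h2 : ζ - 1 ≠ 0 := sub_ne_zero.2 (hζ.ne_one hp.out.one_lt)
  rw [ordGe_iff h0] at h1
  rw [ordGe_iff h2, ← ord_sub_eq_of_pow_eq_one hζ hω hω' hne] at hq
  omega

lemma ord_sub_eq_zero_of_ord_sub_pos (hζ : IsPrimitiveRoot ζ p) (hq : ¬ OrdGe q 1 (ζ - 1))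
    (hω : ω ^ p = 1) (hω' : ω' ^ p = 1) (hne : ω ≠ ω') (hX : X - ω ≠ 0)
    (h : 0 < ord q (X - ω)) : ord q (X - ω') = 0 := by
  have h1 := ord_sub_eq_zero_of_not_ordGe hζ hq hω hω' hne
  have h2 := (ord_eq_of_ordGe_sub (q := q) (y := X - ω') (sub_ne_zero.2 hne) (by
    rw [show X - ω' - (ω - ω') = X - ω by ring, ordGe_iff hX]
    omega)).2
  exact h2.trans h1

lemma ord_sub_le_ord_sub (hω : ω ^ p = 1) (hω' : ω' ^ p = 1) (hX' : X - ω' ≠ 0)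
    (h : ord q (X - ω) ≤ 0) : ord q (X - ω) ≤ ord q (X - ω') := by
  rw [← ordGe_iff hX', show X - ω' = (X - ω) + (ω - ω') by ring]
  exact (ordGe_ord _).add (((ordGe_zero_of_pow_eq_one hp.out.ne_zero hω).sub
    (ordGe_zero_of_pow_eq_one hp.out.ne_zero hω')).mono h)

lemma ord_pow_sub_one_pos (hω : ω ^ p = 1) (hX : X ^ p ≠ 1) (h : 0 < ord q (X - ω)) :
    0 < ord q (X ^ p - 1) := by
  have h0 : X - ω ≠ 0 := sub_ne_zero_of_pow_ne_one hX hω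
  have h1 : OrdGe q 1 (X - ω) := (ordGe_iff h0).2 h
  have h2 := ordGe_zero_of_pow_eq_one (q := q) hp.out.ne_zero hω
  have h3 : OrdGe q 0 X := by
    have := (h1.mono zero_le_one).add h2
    rwa [sub_add_cancel] at this
  have h4 := h3.pow_sub_pow h2 h1 p
  rw [hω, ordGe_iff (sub_ne_zero.2 hX)] at h4
  omega

/-- If `X` is real and `(X - ζ) / (X - ζ⁻¹)` is a unit, then `X` is not close to `1`. -/
lemma IsQuadCyclo.false_of_ord_eq (H : IsQuadCyclo p m s ζ) (hc : IsConjAut c s ζ) (hp2 : 2 < p)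
    (hX : IsPowIdeal p X) (hcX : c X = X) (hq : OrdGe q 1 (ζ - 1)) (hX1 : OrdGe q 2 (X - 1))
    (h : ∀ q : HeightOneSpectrum (𝓞 L), ord q (X - ζ) = ord q (X - ζ⁻¹)) : False := by
  have hζ := H.isPrimitiveRoot
  have hζ1 : ζ ≠ 1 := sub_ne_zero.1 H.sub_one_ne_zero
  have hζ0 : ζ ≠ 0 := ne_zero_of_pow_eq_one hζ.pow_eq_one
  have hζi : ζ⁻¹ ^ p = 1 := by rw [inv_pow, hζ.pow_eq_one, inv_one]
  have hζi1 : ζ⁻¹ ≠ 1 := fun h => hζ1 (inv_eq_one.1 h)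
  have h1 := hX.sub_ne_zero hζ.pow_eq_one
  have h2 := hX.sub_ne_zero hζi
  obtain ⟨u, hu⟩ := exists_unit_eq_of_ord (div_ne_zero h1 h2) fun q => by
    rw [ord_div h1 h2, h q, sub_self]
  obtain ⟨n, hn, hw⟩ := hc.exists_pow_eq_one (w := (X - ζ) / (X - ζ⁻¹))
    (by rw [← hu]; exact RingOfIntegers.isIntegral_coe _) (by
      rw [map_div₀, map_sub, map_sub, map_inv₀, hc.map_root, hcX, inv_inv,
        div_mul_div_cancel₀ h2, div_self h1])
  have h3 := (H.ordGe_div_sub_div hp2 hq hX (one_pow p) hζ.pow_eq_one hζi hζi1 hX1).mul_left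
    (y := -ζ⁻¹) (ordGe_zero_of_pow_eq_one hp.out.ne_zero hζi).neg
  have h4 : 1 - ζ⁻¹ ≠ 0 := sub_ne_zero.2 hζi1.symm
  have h5 : (1 - ζ) / (1 - ζ⁻¹) = -ζ := by
    rw [div_eq_iff h4]
    field_simp
    ring
  have h6 : -ζ⁻¹ * ((X - ζ) / (X - ζ⁻¹)) = 1 := by
    refine H.eq_one_of_pow_eq_one hp2 hq (n := n * (p * 2))
      (Nat.mul_pos hn (Nat.mul_pos hp.out.pos two_pos)) ?_ ?_
    · rw [mul_pow, pow_mul ((X - ζ) / (X - ζ⁻¹)), hw, one_pow, mul_one, mul_comm n, pow_mul,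
        mul_comm p, pow_mul, neg_sq, pow_right_comm ζ⁻¹, hζi, one_pow, one_pow]
    · rw [h5, mul_sub, neg_mul_neg, inv_mul_cancel₀ hζ0] at h3
      exact h3.mono (by omega)
  have h7 : (1 + ζ) * (X - 1) = 0 := by
    rw [← mul_div_assoc, div_eq_one_iff_eq h2] at h6
    have h8 : ζ * ζ⁻¹ = 1 := mul_inv_cancel₀ hζ0
    linear_combination -ζ * h6 + (-X + ζ + 1) * h8
  rcases mul_eq_zero.1 h7 with h8 | h8
  · refine sq_ne_one_of_pow_eq_one hp2 hζ.pow_eq_one hζ1 ?_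
    linear_combination (ζ - 1) * h8
  · exact hX.sub_ne_zero (one_pow p) h8

lemma mul_quotient_sub_one {K : Type*} [Field K] {X z w : K} (hzw : z * w = 1)
    (h2 : X - z ^ 2 ≠ 0) (h3 : X - w ^ 2 ≠ 0) (h4 : 1 - z ≠ 0) (h5 : 1 - w ≠ 0) :
    (X - z) / (X - z ^ 2) / ((1 - z) / (1 - z ^ 2)) *
      ((X - w) / (X - w ^ 2) / ((1 - w) / (1 - w ^ 2))) - 1 =
    ((X - 1) / (X - z ^ 2) * ((X - 1) / (X - w ^ 2))) * ((z - w ^ 2) / (1 - w)) := by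
  have e1 : (X - z) / (X - z ^ 2) / ((1 - z) / (1 - z ^ 2)) *
      ((X - w) / (X - w ^ 2) / ((1 - w) / (1 - w ^ 2))) =
      ((X - z) * (X - w)) * ((1 - z ^ 2) * (1 - w ^ 2)) /
        (((X - z ^ 2) * (X - w ^ 2)) * ((1 - z) * (1 - w))) := by
    simp only [div_eq_mul_inv, mul_inv, inv_inv]
    ring
  have e2 : (X - 1) / (X - z ^ 2) * ((X - 1) / (X - w ^ 2)) * ((z - w ^ 2) / (1 - w)) =
      (X - 1) ^ 2 * ((1 - z) * (z - w ^ 2)) /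
        (((X - z ^ 2) * (X - w ^ 2)) * ((1 - z) * (1 - w))) := by
    field_simp
  have e3 : (X - z) * (X - w) = (X - 1) ^ 2 + (1 - z) * (1 - w) * X := by
    linear_combination (1 - X) * hzw
  have e4 : (X - z ^ 2) * (X - w ^ 2) = (X - 1) ^ 2 + (1 - z ^ 2) * (1 - w ^ 2) * X := by
    linear_combination (1 - X) * (z * w + 1) * hzw
  have e5 : (1 - z ^ 2) * (1 - w ^ 2) = (1 - z) * (z - w ^ 2) + (1 - z) * (1 - w) := by
    linear_combination (z * w - w) * hzw
  have h6 := mul_ne_zero (mul_ne_zero h2 h3) (mul_ne_zero h4 h5)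
  rw [e1, e2, div_sub_one h6]
  congr 1
  rw [e3, e4]
  linear_combination (X - 1) ^ 2 * e5

/-- The descent step for real `X`. -/
lemma IsQuadCyclo.exists_real_descent (H : IsQuadCyclo p m s ζ) (hc : IsConjAut c s ζ)
    (hp5 : 5 ≤ p) (hreg : ¬ p ∣ classNumber L) (hX : IsPowIdeal p X) (hcX : c X = X)
    (hX1 : ∀ q : HeightOneSpectrum (𝓞 L), OrdGe q 1 (ζ - 1) → OrdGe q 2 (X - 1)) :
    ∃ γ : L, c γ = γ ∧ γ ^ p ≠ 1 ∧ ∀ q : HeightOneSpectrum (𝓞 L),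
      ord q (γ ^ p - 1) = ord q (X - 1) - ord q (X - ζ ^ 2) +
        (ord q (X - 1) - ord q (X - ζ⁻¹ ^ 2)) := by
  have hp2 : 2 < p := by omega
  have hζ := H.isPrimitiveRoot
  have hζ1 : ζ ≠ 1 := sub_ne_zero.1 H.sub_one_ne_zero
  have hζ0 : ζ ≠ 0 := ne_zero_of_pow_eq_one hζ.pow_eq_one
  have hζi : ζ⁻¹ ^ p = 1 := by rw [inv_pow, hζ.pow_eq_one, inv_one]
  have hζi1 : ζ⁻¹ ≠ 1 := fun h => hζ1 (inv_eq_one.1 h)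
  have hζ2 : (ζ ^ 2) ^ p = 1 := by rw [← pow_mul, mul_comm, pow_mul, hζ.pow_eq_one, one_pow]
  have hζ2i : (ζ⁻¹ ^ 2) ^ p = 1 := by rw [← pow_mul, mul_comm, pow_mul, hζi, one_pow]
  have hζ21 := sq_ne_one_of_pow_eq_one hp2 hζ.pow_eq_one hζ1
  have hζ2i1 := sq_ne_one_of_pow_eq_one hp2 hζi hζi1
  have hne : ζ ≠ ζ⁻¹ ^ 2 := by
    intro h
    have h1 : ζ ^ 3 = 1 := by
      rw [pow_succ]
      nth_rewrite 2 [h]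
      rw [inv_pow]
      exact mul_inv_cancel₀ (pow_ne_zero 2 hζ0)
    have h2 := Nat.le_of_dvd (by norm_num) (hζ.dvd_of_pow_eq_one 3 h1)
    omega
  obtain ⟨γ, hγ⟩ := H.exists_pow_eq_div hp2 hreg hX hX1 hζ.pow_eq_one hζ1 hζ2 hζ21
  have hγc : (c γ) ^ p = (X - ζ⁻¹) / (X - ζ⁻¹ ^ 2) / ((1 - ζ⁻¹) / (1 - ζ⁻¹ ^ 2)) := by
    rw [← map_pow, hγ, map_div₀, map_div₀, map_div₀, map_sub, map_sub, map_sub, map_sub, map_pow,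
      hc.map_root, hcX, map_one]
  have h1 := hX.sub_ne_zero (one_pow p)
  have h2 := hX.sub_ne_zero hζ2
  have h3 := hX.sub_ne_zero hζ2i
  have h4 := sub_ne_zero.2 hζ1.symm
  have h5 := sub_ne_zero.2 hζi1.symm
  have h8 := sub_ne_zero.2 hne
  have h9 : (γ * c γ) ^ p - 1 =
      ((X - 1) / (X - ζ ^ 2) * ((X - 1) / (X - ζ⁻¹ ^ 2))) * ((ζ - ζ⁻¹ ^ 2) / (1 - ζ⁻¹)) := by
    rw [mul_pow, hγ, hγc, mul_quotient_sub_one (mul_inv_cancel₀ hζ0) h2 h3 h4 h5]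
  have h10 : (X - 1) / (X - ζ ^ 2) * ((X - 1) / (X - ζ⁻¹ ^ 2)) ≠ 0 :=
    mul_ne_zero (div_ne_zero h1 h2) (div_ne_zero h1 h3)
  have h11 : (ζ - ζ⁻¹ ^ 2) / (1 - ζ⁻¹) ≠ 0 := div_ne_zero h8 h5
  refine ⟨γ * c γ, by rw [map_mul, H.conj_conj hc, mul_comm],
    sub_ne_zero.1 (by rw [h9]; exact mul_ne_zero h10 h11), fun q => ?_⟩
  rw [h9, ord_mul h10 h11, ord_mul (div_ne_zero h1 h2) (div_ne_zero h1 h3), ord_div h1 h2,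
    ord_div h1 h3, ord_div h8 h5, ord_sub_eq_of_pow_eq_one hζ hζ.pow_eq_one hζ2i hne,
    ord_sub_eq_of_pow_eq_one hζ (one_pow p) hζi hζi1.symm]
  ring

/-- If `p` is congruent to `1` modulo `4`, then `X ^ p - 1` cannot generate the `p`-th power of
an ideal when `X` is real and close to `1` at all primes above `p`. -/
theorem IsQuadCyclo.false_of_even (H : IsQuadCyclo p m s ζ) (hc : IsConjAut c s ζ)
    (hp5 : 5 ≤ p) (hreg : ¬ p ∣ classNumber L) (heven : Even ((p - 1) / 2)) (hX : IsPowIdeal p X)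
    (hcX : c X = X)
    (hX1 : ∀ q : HeightOneSpectrum (𝓞 L), OrdGe q 1 (ζ - 1) → OrdGe q 2 (X - 1)) : False := by
  have hp2 : 2 < p := by omega
  have hζ := H.isPrimitiveRoot
  have hζ1 : ζ ≠ 1 := sub_ne_zero.1 H.sub_one_ne_zero
  have hζ0 : ζ ≠ 0 := ne_zero_of_pow_eq_one hζ.pow_eq_one
  have hζi : ζ⁻¹ ^ p = 1 := by rw [inv_pow, hζ.pow_eq_one, inv_one]
  have hζi1 : ζ⁻¹ ≠ 1 := fun h => hζ1 (inv_eq_one.1 h)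
  have hζ2 : (ζ ^ 2) ^ p = 1 := by rw [← pow_mul, mul_comm, pow_mul, hζ.pow_eq_one, one_pow]
  have hζ2i : (ζ⁻¹ ^ 2) ^ p = 1 := by rw [← pow_mul, mul_comm, pow_mul, hζi, one_pow]
  have hζ21 := sq_ne_one_of_pow_eq_one hp2 hζ.pow_eq_one hζ1
  have hζ2i1 := sq_ne_one_of_pow_eq_one hp2 hζi hζi1
  induction hn : {q : HeightOneSpectrum (𝓞 L) | ¬ OrdGe q 1 (ζ - 1) ∧
      0 < ord q (X ^ p - 1)}.ncard using Nat.strong_induction_on generalizing X with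
  | _ n ih =>
    obtain ⟨γ, hcγ, hγ1, hγ⟩ := H.exists_real_descent hc hp5 hreg hX hcX hX1
    have h1 := hX.sub_ne_zero (one_pow p)
    have h2 := hX.sub_ne_zero hζ2
    have h3 := hX.sub_ne_zero hζ2i
    have hγI : IsPowIdeal p γ := ⟨hγ1, fun q => by
      rw [hγ]
      exact dvd_add
        (dvd_ord_sub_sub_ord_sub hζ hX.pow_ne_one (hX.dvd_ord q) (one_pow p) hζ2)
        (dvd_ord_sub_sub_ord_sub hζ hX.pow_ne_one (hX.dvd_ord q) (one_pow p) hζ2i)⟩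
    have hγX1 : ∀ q : HeightOneSpectrum (𝓞 L), OrdGe q 1 (ζ - 1) → OrdGe q 2 (γ - 1) := by
      intro q hq
      have h4 := (ordGe_iff h1).1 (H.ordGe_sub_root hp2 hq hX (one_pow p) (hX1 q hq))
      have h5 : 1 ≤ ord q (γ ^ p - 1) := by
        rw [hγ, H.ord_sub_root hp2 hq hζ2 (one_pow p) hζ21 (hX1 q hq),
          H.ord_sub_root hp2 hq hζ2i (one_pow p) hζ2i1 (hX1 q hq)]
        omega
      obtain ⟨ω, hω, h6⟩ := H.exists_root_ordGe hp2 hq (H.ordGe_sub_one_of_pow hp2 hq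
        ((ordGe_iff (sub_ne_zero.2 hγ1)).2 h5))
      obtain ⟨q', -, hiff, hqq, -⟩ := H.exists_conj_prime hc hp2 hq
      obtain rfl := hqq heven
      have h7 : OrdGe q' 2 (γ - ω⁻¹) := by
        rw [← hcγ, ← hc.map_eq_inv hζ hω, ← map_sub, hiff]
        exact h6
      have hω1 : ω = 1 := by
        by_contra hω1
        have hωi : ω⁻¹ ^ p = 1 := by rw [inv_pow, hω, inv_one]
        have hne : ω ≠ ω⁻¹ := by
          intro h
          apply sq_ne_one_of_pow_eq_one hp2 hω hω1
          rw [sq]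
          nth_rewrite 2 [h]
          exact mul_inv_cancel₀ (ne_zero_of_pow_eq_one hω)
        have h8 := h7.sub h6
        rw [show γ - ω⁻¹ - (γ - ω) = ω - ω⁻¹ by ring, ordGe_iff (sub_ne_zero.2 hne),
          ord_sub_eq_one hζ (H.goodAt hp2 hq) hω hωi hne] at h8
        omega
      rwa [hω1] at h6
    have hpos : ∀ q : HeightOneSpectrum (𝓞 L), 0 < ord q (γ ^ p - 1) → 0 < ord q (X - 1) := by
      intro q hq
      by_contra hle
      have h4 := ord_sub_le_ord_sub (one_pow p) hζ2 h2 (not_lt.1 hle)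
      have h5 := ord_sub_le_ord_sub (one_pow p) hζ2i h3 (not_lt.1 hle)
      rw [hγ] at hq
      omega
    have hsub : {q : HeightOneSpectrum (𝓞 L) | ¬ OrdGe q 1 (ζ - 1) ∧ 0 < ord q (γ ^ p - 1)} ⊆
        {q : HeightOneSpectrum (𝓞 L) | ¬ OrdGe q 1 (ζ - 1) ∧ 0 < ord q (X ^ p - 1)} :=
      fun q hq => ⟨hq.1, ord_pow_sub_one_pos (one_pow p) hX.pow_ne_one (hpos q hq.2)⟩
    by_cases heq : {q : HeightOneSpectrum (𝓞 L) | ¬ OrdGe q 1 (ζ - 1) ∧ 0 < ord q (γ ^ p - 1)} =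
        {q : HeightOneSpectrum (𝓞 L) | ¬ OrdGe q 1 (ζ - 1) ∧ 0 < ord q (X ^ p - 1)}
    · obtain ⟨q₀, hq₀⟩ := exists_prime_ordGe_sub_one hζ
      refine H.false_of_ord_eq hc hp2 hX hcX hq₀ (hX1 q₀ hq₀) fun q => ?_
      by_cases hq : OrdGe q 1 (ζ - 1)
      · rw [H.ord_sub_root hp2 hq hζ.pow_eq_one (one_pow p) hζ1 (hX1 q hq),
          H.ord_sub_root hp2 hq hζi (one_pow p) hζi1 (hX1 q hq)]
      · have hle : ∀ ω : L, ω ^ p = 1 → ω ≠ 1 → ord q (X - ω) ≤ 0 := by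
          intro ω hω hω1
          by_contra hlt
          have h4 : q ∈ {q : HeightOneSpectrum (𝓞 L) | ¬ OrdGe q 1 (ζ - 1) ∧
            0 < ord q (X ^ p - 1)} :=
            ⟨hq, ord_pow_sub_one_pos hω hX.pow_ne_one (not_le.1 hlt)⟩
          rw [← heq] at h4
          exact hlt (ord_sub_eq_zero_of_ord_sub_pos hζ hq (one_pow p) hω hω1.symm h1
            (hpos q h4.2)).le
        have h4 := hX.sub_ne_zero hζ.pow_eq_one
        have h5 := hX.sub_ne_zero hζi
        exact le_antisymm
          (ord_sub_le_ord_sub hζ.pow_eq_one hζi h5 (hle ζ hζ.pow_eq_one hζ1))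
          (ord_sub_le_ord_sub hζi hζ.pow_eq_one h4 (hle ζ⁻¹ hζi hζi1))
    · refine ih _ ?_ hγI hcγ hγX1 rfl
      rw [← hn]
      exact Set.ncard_lt_ncard (hsub.ssubset_of_ne heq)
        ((finite_setOf_ord_pos (X ^ p - 1)).subset fun q hq => hq.2)

end RealDescent

end

section

open NumberField IsDedekindDomain

section Cases

variable {L : Type} [Field L] [NumberField L] {p : ℕ} [hp : Fact p.Prime] {m : ℤ} {s ζ : L}
  {c : L ≃+* L} {q : HeightOneSpectrum (𝓞 L)} {a b a₁ b₁ a₂ b₂ a₃ b₃ : ℤ}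

lemma IsQuadCyclo.intCast_ne_zero (H : IsQuadCyclo p m s ζ) : (m : L) ≠ 0 := by
  have h := H.not_dvd
  intro h0
  rw [Int.cast_eq_zero] at h0
  simp [h0] at h

lemma IsQuadCyclo.sqrt_ne_zero (H : IsQuadCyclo p m s ζ) : s ≠ 0 := by
  intro h
  have h1 := H.sq_eq
  rw [h, zero_pow two_ne_zero, eq_comm, mul_eq_zero] at h1
  exact h1.elim (natCast_prime_ne_zero L) H.intCast_ne_zero

lemma IsQuadCyclo.ord_sqrt (H : IsQuadCyclo p m s ζ) (hp2 : 2 < p) (hq : OrdGe q 1 (ζ - 1)) :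
    2 * ord q s = p - 1 := by
  have h1 := congrArg (ord q) H.sq_eq
  rw [ord_pow, ord_mul (natCast_prime_ne_zero L) H.intCast_ne_zero,
    H.ord_intCast_eq_zero hp2 hq H.not_dvd,
    ord_natCast_prime H.isPrimitiveRoot (H.goodAt hp2 hq), add_zero] at h1
  exact_mod_cast h1

lemma IsQuadCyclo.ordGe_intCast_mul_sqrt (H : IsQuadCyclo p m s ζ) {k : ℤ} (hp2 : 2 < p)
    (hq : OrdGe q 1 (ζ - 1)) (hk : 2 * k ≤ p - 1) (b : ℤ) : OrdGe q k (b * s) := by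
  refine OrdGe.mul_left ?_ (ordGe_intCast b)
  rw [ordGe_iff H.sqrt_ne_zero]
  have := H.ord_sqrt hp2 hq
  omega

lemma IsQuadCyclo.ordGe_intCast_of_dvd (H : IsQuadCyclo p m s ζ) (hp2 : 2 < p)
    (hq : OrdGe q 1 (ζ - 1)) (ha : (p : ℤ) ∣ a) : OrdGe q (p - 1) (a : L) := by
  obtain ⟨k, rfl⟩ := ha
  rw [Int.cast_mul, Int.cast_natCast]
  refine OrdGe.mul_right ?_ (ordGe_intCast k)
  rw [ordGe_iff (natCast_prime_ne_zero L), ord_natCast_prime H.isPrimitiveRoot (H.goodAt hp2 hq)]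

lemma IsQuadCyclo.ordGe_quad (H : IsQuadCyclo p m s ζ) (hp5 : 5 ≤ p)
    (hq : OrdGe q 1 (ζ - 1)) (ha : (p : ℤ) ∣ a) (b : ℤ) : OrdGe q 2 (a + b * s) :=
  ((H.ordGe_intCast_of_dvd (by omega) hq ha).mono (by omega)).add
    (H.ordGe_intCast_mul_sqrt (by omega) hq (by omega) b)

lemma IsQuadCyclo.ordGe_zero_quad (H : IsQuadCyclo p m s ζ) (hp2 : 2 < p)
    (hq : OrdGe q 1 (ζ - 1)) (a b : ℤ) : OrdGe q 0 (a + b * s : L) :=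
  (ordGe_intCast a).add (H.ordGe_intCast_mul_sqrt hp2 hq (by omega) b)

lemma IsQuadCyclo.ord_quad (H : IsQuadCyclo p m s ζ) (hp2 : 2 < p)
    (hq : OrdGe q 1 (ζ - 1)) (ha : ¬ (p : ℤ) ∣ a) (b : ℤ) :
    (a + b * s : L) ≠ 0 ∧ ord q (a + b * s : L) = 0 := by
  have ha0 : (a : L) ≠ 0 := by
    intro h
    rw [Int.cast_eq_zero] at h
    simp [h] at ha
  have h := H.ord_intCast_eq_zero hp2 hq ha
  rw [← h]
  refine ord_eq_of_ordGe_sub ha0 ?_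
  rw [h, add_sub_cancel_left]
  exact H.ordGe_intCast_mul_sqrt hp2 hq (by omega) b

lemma IsConjAut.map_quad (hc : IsConjAut c s ζ) (a b : ℤ) : c (a + b * s) = a + b * s := by
  rw [map_add, map_mul, map_intCast, map_intCast, hc.map_sqrt]

lemma IsQuadCyclo.dvd_add_sub (H : IsQuadCyclo p m s ζ) (hp2 : 2 < p)
    (h : (a₁ + b₁ * s) ^ p + (a₂ + b₂ * s) ^ p = (a₃ + b₃ * s) ^ p) :
    (p : ℤ) ∣ a₁ + a₂ - a₃ := by
  obtain ⟨q, hq⟩ := exists_prime_ordGe_sub_one H.isPrimitiveRoot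
  refine H.dvd_of_ordGe_intCast hp2 hq ?_
  have h1 := fun a b : ℤ => H.ordGe_pow_sub_self hp2 hq (H.ordGe_zero_quad hp2 hq a b)
  have h2 := H.ordGe_intCast_mul_sqrt (k := 1) hp2 hq (by omega) (b₁ + b₂ - b₃)
  have h3 := (((h1 a₃ b₃).sub (h1 a₁ b₁)).sub (h1 a₂ b₂)).sub h2
  convert h3 using 1
  push_cast
  linear_combination h

lemma isPowIdeal_neg_div (hpo : Odd p) {x y z : L} (h : x ^ p + y ^ p = z ^ p) (hy : y ≠ 0)
    (hz : z ≠ 0) : IsPowIdeal p (-x / y) := by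
  have h1 : (-x / y) ^ p - 1 = -(z / y) ^ p := by
    rw [div_pow, div_pow, hpo.neg_pow, ← h]
    field_simp
    ring
  have h2 : (-x / y) ^ p - 1 ≠ 0 := by
    rw [h1]
    exact neg_ne_zero.2 (pow_ne_zero _ (div_ne_zero hz hy))
  exact ⟨sub_ne_zero.1 h2, fun q => by
    rw [h1, ord_neg, ord_pow]
    exact dvd_mul_right _ _⟩

lemma neg_div_sub_eq {K : Type*} [Field K] {x y w : K} (hy : y ≠ 0) :
    -x / y - w = -(x + w * y) / y := by
  field_simp
  ring

/-- The case where exactly one of the three elements is divisible by the primes above `p`. -/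
lemma IsQuadCyclo.false_of_dvd (H : IsQuadCyclo p m s ζ) (hc : IsConjAut c s ζ) (hp5 : 5 ≤ p)
    (hreg : ¬ p ∣ classNumber L)
    (h : (a₁ + b₁ * s) ^ p + (a₂ + b₂ * s) ^ p = (a₃ + b₃ * s) ^ p)
    (h3 : (a₃ + b₃ * s : L) ≠ 0) (hd : (p : ℤ) ∣ a₃) (hnd : ¬ (p : ℤ) ∣ a₂) : False := by
  have hp2 : 2 < p := by omega
  have hpo : Odd p := hp.out.odd_of_ne_two (by omega)
  obtain ⟨q₀, hq₀⟩ := exists_prime_ordGe_sub_one H.isPrimitiveRoot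
  have hy := (H.ord_quad hp2 hq₀ hnd b₂).1
  have hX := isPowIdeal_neg_div hpo h hy h3
  have hX1 : ∀ q : HeightOneSpectrum (𝓞 L), OrdGe q 1 (ζ - 1) →
      OrdGe q 2 (-(a₁ + b₁ * s) / (a₂ + b₂ * s) - 1) := by
    intro q hq
    have h4 : (p : ℤ) ∣ a₁ + a₂ := by
      have := (H.dvd_add_sub hp2 h).add hd
      rwa [sub_add_cancel] at this
    have h5 := (H.ordGe_quad hp5 hq h4 (b₁ + b₂)).neg.mul_right
      (y := (a₂ + b₂ * s)⁻¹) (by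
        rw [ordGe_iff (inv_ne_zero hy), ord_inv, (H.ord_quad hp2 hq hnd b₂).2, neg_zero])
    rw [neg_div_sub_eq hy, div_eq_mul_inv]
    convert h5 using 1
    push_cast
    ring
  rcases Nat.even_or_odd ((p - 1) / 2) with he | ho
  · refine H.false_of_even hc hp5 hreg he hX ?_ hX1
    rw [map_div₀, map_neg, hc.map_quad, hc.map_quad]
  · exact H.false_of_odd hc hp5 hreg ho hX hX1

lemma IsQuadCyclo.exists_ordGe_first_case (H : IsQuadCyclo p m s ζ) (hc : IsConjAut c s ζ)
    (hp2 : 2 < p) (hreg : ¬ p ∣ classNumber L) (hq : OrdGe q 1 (ζ - 1))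
    (h : (a₁ + b₁ * s) ^ p + (a₂ + b₂ * s) ^ p = (a₃ + b₃ * s) ^ p)
    (h2 : ¬ (p : ℤ) ∣ a₂) (h3 : ¬ (p : ℤ) ∣ a₃) : ∃ θ : L, θ ^ p = 1 ∧
      OrdGe q (p - 1) (a₁ + b₁ * s + ζ * (a₂ + b₂ * s) -
        θ * (a₁ + b₁ * s + ζ⁻¹ * (a₂ + b₂ * s))) := by
  have hpo : Odd p := hp.out.odd_of_ne_two (by omega)
  have hζ := H.isPrimitiveRoot
  have hζi : ζ⁻¹ ^ p = 1 := by rw [inv_pow, hζ.pow_eq_one, inv_one]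
  have hg := H.goodAt hp2 hq
  have hy := (H.ord_quad hp2 hq h2 b₂).1
  have hX := isPowIdeal_neg_div hpo h hy (H.ord_quad hp2 hq h3 b₃).1
  have h12 : ¬ (p : ℤ) ∣ a₁ + a₂ := by
    intro h4
    have := h4.sub (H.dvd_add_sub hp2 h)
    rw [sub_sub_cancel] at this
    exact h3 this
  have hxy := H.ord_quad hp2 hq h12 (b₁ + b₂)
  have hone : ∀ ω : L, ω ^ p = 1 → OrdGe q 1 (ω - 1) := fun ω hω =>
    ordGe_one_sub_of_pow_eq_one hζ hg hω (one_pow p)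
  have hclose : ∀ ω : L, ω ^ p = 1 → OrdGe q 1 (a₁ + b₁ * s + ω * (a₂ + b₂ * s) -
      (((a₁ + a₂ : ℤ) : L) + ((b₁ + b₂ : ℤ) : L) * s)) := by
    intro ω hω
    have h4 := (hone ω hω).mul_right (H.ordGe_zero_quad hp2 hq a₂ b₂)
    convert h4 using 1
    push_cast
    ring
  have hB : ∀ ω : L, ω ^ p = 1 → (a₁ + b₁ * s + ω * (a₂ + b₂ * s) : L) ≠ 0 ∧
      ord q (a₁ + b₁ * s + ω * (a₂ + b₂ * s)) = 0 := by
    intro ω hω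
    have h4 := ord_eq_of_ordGe_sub hxy.1 (by rw [hxy.2, zero_add]; exact hclose ω hω)
    exact ⟨h4.1, h4.2.trans hxy.2⟩
  obtain ⟨θ, δ, hθ, hδ, hdiv⟩ := H.exists_div_conj_eq hc hp2 hreg hX hζ.pow_eq_one (one_pow p)
  have hX1 := hX.sub_ne_zero (one_pow p)
  have hcX : c (-(a₁ + b₁ * s) / (a₂ + b₂ * s)) = -(a₁ + b₁ * s) / (a₂ + b₂ * s) := by
    rw [map_div₀, map_neg, hc.map_quad, hc.map_quad]
  have hsub : ∀ ω : L, -(a₁ + b₁ * s) / (a₂ + b₂ * s) - ω =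
      -(a₁ + b₁ * s + ω * (a₂ + b₂ * s)) / (a₂ + b₂ * s) := fun ω => neg_div_sub_eq hy
  rw [map_div₀, map_sub, map_sub, hcX, hc.map_root, map_one, div_div_div_cancel_right₀ hX1, hsub,
    hsub, div_div_div_cancel_right₀ hy, neg_div_neg_eq] at hdiv
  have hz : ∀ A : L, OrdGe q p (A - A) := fun A => by
    rw [sub_self]
    exact ordGe_zero
  obtain ⟨N, hN⟩ := exists_ordGe_sub_mul hζ hg (hB ζ hζ.pow_eq_one).1 (hB ζ hζ.pow_eq_one).2
    (hB ζ⁻¹ hζi).1 (hB ζ⁻¹ hζi).2 (hz _) (hz _) hθ hδ hdiv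
  have hθ0 := ordGe_zero_of_pow_eq_one (q := q) hp.out.ne_zero hθ
  have hB0 : OrdGe q 0 (a₁ + b₁ * s + ζ⁻¹ * (a₂ + b₂ * s)) :=
    (ordGe_iff (hB ζ⁻¹ hζi).1).2 (hB ζ⁻¹ hζi).2.ge
  have hN1 : (p : ℤ) ∣ N - 1 := by
    refine H.dvd_of_ordGe_intCast hp2 hq ?_
    refine OrdGe.of_mul_left hxy.1 hxy.2 ?_
    have e1 := (hclose ζ hζ.pow_eq_one).sub (hN.mono (by omega : (1 : ℤ) ≤ p))
    have e2 := ((hclose ζ⁻¹ hζi).mul_left ((ordGe_intCast N).mul_left hθ0))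
    have e3 := ((hone θ hθ).mul_right ((ordGe_intCast N).mul_right
      (H.ordGe_zero_quad hp2 hq (a₁ + a₂) (b₁ + b₂))))
    have e4 := (e1.sub e2).sub e3
    convert e4 using 1
    push_cast
    ring
  refine ⟨θ, hθ, ?_⟩
  have e5 := (hN.mono (by omega : (p : ℤ) - 1 ≤ p)).add
    ((((H.ordGe_intCast_of_dvd hp2 hq hN1).mul_left hθ0)).mul_right hB0)
  convert e5 using 1
  push_cast
  ring

lemma IsQuadCyclo.ordGe_first_case_intCast (H : IsQuadCyclo p m s ζ) (hp7 : 7 ≤ p)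
    (hq : OrdGe q 1 (ζ - 1)) {θ : L} (hθ : θ ^ p = 1)
    (h : OrdGe q (p - 1) (a₁ + b₁ * s + ζ * (a₂ + b₂ * s) -
      θ * (a₁ + b₁ * s + ζ⁻¹ * (a₂ + b₂ * s)))) :
    OrdGe q 4 (a₁ * (ζ - ζ * θ) + a₂ * (ζ ^ 2 - θ)) := by
  have hp2 : 2 < p := by omega
  have hζ := H.isPrimitiveRoot
  have hζ2 : (ζ ^ 2) ^ p = 1 := by rw [← pow_mul, mul_comm, pow_mul, hζ.pow_eq_one, one_pow]
  have hg := H.goodAt hp2 hq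
  have hζ0 : ζ ≠ 0 := ne_zero_of_pow_eq_one hζ.pow_eq_one
  have hζq : OrdGe q 0 ζ := ordGe_zero_of_pow_eq_one hp.out.ne_zero hζ.pow_eq_one
  have h1 : OrdGe q 4 (ζ * (a₁ + b₁ * s + ζ * (a₂ + b₂ * s) -
      θ * (a₁ + b₁ * s + ζ⁻¹ * (a₂ + b₂ * s)))) := (h.mul_left hζq).mono (by omega)
  have h2 := (H.ordGe_intCast_mul_sqrt hp2 hq (by omega : 2 * (3 : ℤ) ≤ p - 1) b₁).mul
    (ordGe_one_sub_of_pow_eq_one hζ hg hζ.pow_eq_one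
      (by rw [mul_pow, hζ.pow_eq_one, hθ, one_mul] : (ζ * θ) ^ p = 1))
  have h3 := (H.ordGe_intCast_mul_sqrt hp2 hq (by omega : 2 * (3 : ℤ) ≤ p - 1) b₂).mul
    (ordGe_one_sub_of_pow_eq_one hζ hg hζ2 hθ)
  have h4 := (h1.sub h2).sub h3
  have h5 : ζ * ζ⁻¹ = 1 := mul_inv_cancel₀ hζ0
  have h6 : a₁ * (ζ - ζ * θ) + a₂ * (ζ ^ 2 - θ) = ζ * (a₁ + b₁ * s + ζ * (a₂ + b₂ * s) -
      θ * (a₁ + b₁ * s + ζ⁻¹ * (a₂ + b₂ * s))) - b₁ * s * (ζ - ζ * θ) - b₂ * s * (ζ ^ 2 - θ) := by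
    linear_combination θ * (a₂ + b₂ * s) * h5
  rw [h6]
  exact h4

lemma IsQuadCyclo.dvd_sub_of_ordGe (H : IsQuadCyclo p m s ζ) (hp5 : 5 ≤ p)
    (hq : OrdGe q 1 (ζ - 1)) {θ : L} (hθ : θ ^ p = 1)
    (h : OrdGe q 4 (a₁ * (ζ - ζ * θ) + a₂ * (ζ ^ 2 - θ))) (h1 : ¬ (p : ℤ) ∣ a₁)
    (h2 : ¬ (p : ℤ) ∣ a₂) : (p : ℤ) ∣ a₁ - a₂ := by
  have hζ := H.isPrimitiveRoot
  have hpp : Prime (p : ℤ) := Nat.prime_iff_prime_int.1 hp.out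
  have h12 := not_dvd_twelve hp5
  obtain ⟨k, -, rfl⟩ := hζ.eq_pow_of_pow_eq_one hθ
  have hE := fun n => ordGe_cube_expansion hq n
  have e1 := (((h.mul_left (ordGe_intCast (q := q) 6)).sub
    ((hE 1).mul_left (ordGe_intCast (q := q) a₁))).add
    ((hE (k + 1)).mul_left (ordGe_intCast (q := q) a₁))).sub
    ((hE 2).mul_left (ordGe_intCast (q := q) a₂))
  have e2 := e1.add ((hE k).mul_left (ordGe_intCast (q := q) a₂))
  have e3 := H.dvd_coeff_of_ordGe hp5 hq hζ.pow_eq_one (sub_ne_zero.1 H.sub_one_ne_zero) (a₀ := 0)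
    (a₁ := 6 * (-k * a₁ + (2 - k) * a₂)) (a₂ := 3 * (-(k + 1) * k * a₁ + (2 - k * (k - 1)) * a₂))
    (a₃ := -(k + 1) * k * (k - 1) * a₁ - k * (k - 1) * (k - 2) * a₂) (by
      convert e2 using 1
      push_cast
      ring)
  have h6 : (p : ℤ) ∣ -k * a₁ + (2 - k) * a₂ :=
    (hpp.dvd_or_dvd e3.2.1).resolve_left fun h => h12 (h.mul_left 2)
  have h7 : (p : ℤ) ∣ (k - 1) * ((2 - k) * a₂) := by
    have := (e3.2.2.2.sub (h6.mul_left ((k + 1) * (k - 1)))).neg_right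
    refine this.trans (dvd_of_eq ?_)
    ring
  rcases hpp.dvd_or_dvd h7 with h8 | h8
  · have := (h6.neg_right.sub (h8.mul_left (a₁ + a₂)))
    refine this.trans (dvd_of_eq ?_)
    ring
  · rcases hpp.dvd_or_dvd h8 with h9 | h9
    · exfalso
      have := (h6.sub (h9.mul_left (a₁ + a₂))).neg_right
      have h10 : (p : ℤ) ∣ 2 * a₁ := by
        refine this.trans (dvd_of_eq ?_)
        ring
      rcases hpp.dvd_or_dvd h10 with h11 | h11
      · exact h12 (h11.mul_left 6)
      · exact h1 h11
    · exact absurd h9 h2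

lemma IsQuadCyclo.dvd_sub_of_not_dvd (H : IsQuadCyclo p m s ζ) (hc : IsConjAut c s ζ)
    (hp7 : 7 ≤ p) (hreg : ¬ p ∣ classNumber L)
    (h : (a₁ + b₁ * s) ^ p + (a₂ + b₂ * s) ^ p = (a₃ + b₃ * s) ^ p)
    (h1 : ¬ (p : ℤ) ∣ a₁) (h2 : ¬ (p : ℤ) ∣ a₂) (h3 : ¬ (p : ℤ) ∣ a₃) : (p : ℤ) ∣ a₁ - a₂ := by
  obtain ⟨q, hq⟩ := exists_prime_ordGe_sub_one H.isPrimitiveRoot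
  obtain ⟨θ, hθ, h4⟩ := H.exists_ordGe_first_case hc (by omega) hreg hq h h2 h3
  exact H.dvd_sub_of_ordGe (by omega) hq hθ (H.ordGe_first_case_intCast hp7 hq hθ h4) h1 h2

lemma false_of_fifth_powers {a b c : ℤ} (h : (25 : ℤ) ∣ a ^ 5 + b ^ 5 - c ^ 5) (ha : ¬ (5 : ℤ) ∣ a)
    (hb : ¬ (5 : ℤ) ∣ b) (hc : ¬ (5 : ℤ) ∣ c) : False := by
  have key : ∀ n : ℤ, ¬ (5 : ℤ) ∣ n → (n : ZMod 25) ^ 5 = 1 ∨ (n : ZMod 25) ^ 5 = -1 ∨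
      (n : ZMod 25) ^ 5 = 7 ∨ (n : ZMod 25) ^ 5 = -7 := by
    intro n hn
    have h5 : (5 : ZMod 25) * n ≠ 0 := by
      intro h
      have h6 : ((5 * n : ℤ) : ZMod 25) = 0 := by
        push_cast
        exact h
      rw [ZMod.intCast_zmod_eq_zero_iff_dvd] at h6
      push_cast at h6
      omega
    generalize (n : ZMod 25) = t at *
    revert t
    decide
  have h0 : (a : ZMod 25) ^ 5 + (b : ZMod 25) ^ 5 - (c : ZMod 25) ^ 5 = 0 := by
    have := (ZMod.intCast_zmod_eq_zero_iff_dvd (a ^ 5 + b ^ 5 - c ^ 5) 25).2 (by exact_mod_cast h)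
    push_cast at this
    exact this
  rcases key a ha with h1 | h1 | h1 | h1 <;> rcases key b hb with h2 | h2 | h2 | h2 <;>
    rcases key c hc with h3 | h3 | h3 | h3 <;> rw [h1, h2, h3] at h0 <;> revert h0 <;> decide

/-- If `U ^ 2 = 5 * m * V ^ 2` with `m` prime to `5`, then `U` is divisible by `25`. -/
lemma dvd_of_sq_eq {U V m : ℤ} (h : U ^ 2 = 5 * m * V ^ 2) (hm : ¬ (5 : ℤ) ∣ m) :
    (25 : ℤ) ∣ U := by
  have h5 : Prime (5 : ℤ) := by norm_num
  obtain ⟨U', rfl⟩ := h5.dvd_of_dvd_pow (⟨m * V ^ 2, by rw [h]; ring⟩ : (5 : ℤ) ∣ U ^ 2)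
  obtain ⟨V', rfl⟩ := h5.dvd_of_dvd_pow ((h5.dvd_or_dvd
    (⟨U' ^ 2, by linarith⟩ : (5 : ℤ) ∣ m * V ^ 2)).resolve_left hm)
  obtain ⟨W, rfl⟩ := h5.dvd_of_dvd_pow (⟨m * V' ^ 2, by linarith⟩ : (5 : ℤ) ∣ U' ^ 2)
  exact ⟨W, by ring⟩

lemma false_of_five {s : L} (hs : s ^ 2 = 5 * m) (hm : ¬ (5 : ℤ) ∣ m)
    (h : (a₁ + b₁ * s) ^ 5 + (a₂ + b₂ * s) ^ 5 = (a₃ + b₃ * s) ^ 5)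
    (h1 : ¬ (5 : ℤ) ∣ a₁) (h2 : ¬ (5 : ℤ) ∣ a₂) (h3 : ¬ (5 : ℤ) ∣ a₃) : False := by
  have expand : ∀ a b : ℤ, (a + b * s : L) ^ 5 =
      ((a ^ 5 + 25 * (2 * a ^ 3 * b ^ 2 * m + 5 * a * b ^ 4 * m ^ 2) : ℤ) : L) +
      ((5 * a ^ 4 * b + 50 * a ^ 2 * b ^ 3 * m + 25 * b ^ 5 * m ^ 2 : ℤ) : L) * s := by
    intro a b
    push_cast
    linear_combination (10 * a ^ 3 * b ^ 2 + 10 * a ^ 2 * b ^ 3 * s +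
      5 * a * b ^ 4 * (s ^ 2 + 5 * m) + b ^ 5 * s * (s ^ 2 + 5 * m)) * hs
  rw [expand, expand, expand] at h
  set A₁ := 2 * a₁ ^ 3 * b₁ ^ 2 * m + 5 * a₁ * b₁ ^ 4 * m ^ 2
  set A₂ := 2 * a₂ ^ 3 * b₂ ^ 2 * m + 5 * a₂ * b₂ ^ 4 * m ^ 2
  set A₃ := 2 * a₃ ^ 3 * b₃ ^ 2 * m + 5 * a₃ * b₃ ^ 4 * m ^ 2
  generalize 5 * a₁ ^ 4 * b₁ + 50 * a₁ ^ 2 * b₁ ^ 3 * m + 25 * b₁ ^ 5 * m ^ 2 = B₁ at h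
  generalize 5 * a₂ ^ 4 * b₂ + 50 * a₂ ^ 2 * b₂ ^ 3 * m + 25 * b₂ ^ 5 * m ^ 2 = B₂ at h
  generalize 5 * a₃ ^ 4 * b₃ + 50 * a₃ ^ 2 * b₃ ^ 3 * m + 25 * b₃ ^ 5 * m ^ 2 = B₃ at h
  have h4 : (a₁ ^ 5 + 25 * A₁ + (a₂ ^ 5 + 25 * A₂) - (a₃ ^ 5 + 25 * A₃)) ^ 2 =
      5 * m * (B₁ + B₂ - B₃) ^ 2 := by
    have h5 : (((a₁ ^ 5 + 25 * A₁ + (a₂ ^ 5 + 25 * A₂) - (a₃ ^ 5 + 25 * A₃)) ^ 2 : ℤ) : L) =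
        ((5 * m * (B₁ + B₂ - B₃) ^ 2 : ℤ) : L) := by
      push_cast at h ⊢
      linear_combination (a₁ ^ 5 + 25 * A₁ + (a₂ ^ 5 + 25 * A₂) - (a₃ ^ 5 + 25 * A₃) -
        (B₁ + B₂ - B₃) * s) * h + (B₁ + B₂ - B₃) ^ 2 * hs
    exact_mod_cast h5
  refine false_of_fifth_powers ?_ h1 h2 h3
  have h6 := (dvd_of_sq_eq h4 hm).sub (Dvd.intro (A₁ + A₂ - A₃) rfl)
  refine h6.trans (dvd_of_eq ?_)
  ring

/-- The case where none of the three elements is divisible by the primes above `p`. -/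
lemma IsQuadCyclo.false_of_not_dvd (H : IsQuadCyclo p m s ζ) (hc : IsConjAut c s ζ)
    (hp5 : 5 ≤ p) (hreg : ¬ p ∣ classNumber L)
    (h : (a₁ + b₁ * s) ^ p + (a₂ + b₂ * s) ^ p = (a₃ + b₃ * s) ^ p)
    (h1 : ¬ (p : ℤ) ∣ a₁) (h2 : ¬ (p : ℤ) ∣ a₂) (h3 : ¬ (p : ℤ) ∣ a₃) : False := by
  have hpo : Odd p := hp.out.odd_of_ne_two (by omega)
  rcases hp5.eq_or_lt with rfl | hlt
  · exact false_of_five (by simpa using H.sq_eq) H.not_dvd h h1 h2 h3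
  · have hp7 : 7 ≤ p := by
      rcases hpo with ⟨k, hk⟩
      omega
    have hpp : Prime (p : ℤ) := Nat.prime_iff_prime_int.1 hp.out
    have h4 := H.dvd_sub_of_not_dvd hc hp7 hreg h h1 h2 h3
    have h5 := H.dvd_sub_of_not_dvd (a₁ := a₂) (b₁ := b₂) (a₂ := -a₃) (b₂ := -b₃) (a₃ := -a₁)
      (b₃ := -b₁) hc hp7 hreg (by
        push_cast
        rw [neg_mul, neg_mul, ← neg_add, ← neg_add, hpo.neg_pow, hpo.neg_pow]
        linear_combination h) h2 (by rwa [dvd_neg]) (by rwa [dvd_neg])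
    have h6 := H.dvd_add_sub (by omega) h
    have h7 : (p : ℤ) ∣ 3 * a₂ := by
      have := (h6.add h5).sub h4
      refine this.trans (dvd_of_eq ?_)
      ring
    rcases hpp.dvd_or_dvd h7 with h8 | h8
    · exact not_dvd_twelve hp5 (h8.mul_left 4)
    · exact h2 h8

end Cases

end

section

open NumberField IsDedekindDomain

section Reduction

variable {L : Type} [Field L] [NumberField L] {p : ℕ} [hp : Fact p.Prime] {m : ℤ} {s ζ : L}
  {c : L ≃+* L} {a b a₁ b₁ a₂ b₂ a₃ b₃ : ℤ}

lemma IsQuadCyclo.quad_eq_div (H : IsQuadCyclo p m s ζ) (k b : ℤ) :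
    ((m * b : ℤ) + (k : ℤ) * s : L) = (((p * k : ℤ) : L) + b * s) * (m / s) := by
  have h0 := H.sqrt_ne_zero
  push_cast
  field_simp
  linear_combination k * H.sq_eq

lemma IsQuadCyclo.false_of_pow_add_pow (H : IsQuadCyclo p m s ζ) (hc : IsConjAut c s ζ)
    (hp5 : 5 ≤ p) (hreg : ¬ p ∣ classNumber L)
    (h : (a₁ + b₁ * s) ^ p + (a₂ + b₂ * s) ^ p = (a₃ + b₃ * s) ^ p)
    (h1 : (a₁ + b₁ * s : L) ≠ 0) (h2 : (a₂ + b₂ * s : L) ≠ 0) (h3 : (a₃ + b₃ * s : L) ≠ 0) :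
    False := by
  have hp2 : 2 < p := by omega
  have hpo : Odd p := hp.out.odd_of_ne_two (by omega)
  obtain ⟨q, hq⟩ := exists_prime_ordGe_sub_one H.isPrimitiveRoot
  induction hn : (ord q (a₁ + b₁ * s)).toNat using Nat.strong_induction_on
    generalizing a₁ b₁ a₂ b₂ a₃ b₃ with
  | _ n ih =>
    have hneg : ∀ a b : ℤ, ((-a : ℤ) : L) + ((-b : ℤ) : L) * s = -(a + b * s) := by
      intro a b
      push_cast
      ring
    have hdvd := H.dvd_add_sub hp2 h
    by_cases hd1 : (p : ℤ) ∣ a₁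
    · by_cases hd2 : (p : ℤ) ∣ a₂
      · have hd3 : (p : ℤ) ∣ a₃ := by
          have := (hd1.add hd2).sub hdvd
          rwa [sub_sub_cancel] at this
        obtain ⟨k₁, rfl⟩ := hd1
        obtain ⟨k₂, rfl⟩ := hd2
        obtain ⟨k₃, rfl⟩ := hd3
        have h0 : (m / s : L) ≠ 0 := div_ne_zero H.intCast_ne_zero H.sqrt_ne_zero
        refine ih _ ?_ (a₁ := m * b₁) (b₁ := k₁) (a₂ := m * b₂) (b₂ := k₂) (a₃ := m * b₃)
          (b₃ := k₃) ?_ ?_ ?_ ?_ rfl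
        · have h4 : 0 ≤ ord q ((m * b₁ : ℤ) + (k₁ : ℤ) * s) := by
            rw [← ordGe_iff (by rw [H.quad_eq_div]; exact mul_ne_zero h1 h0)]
            exact H.ordGe_zero_quad hp2 hq _ _
          have h5 := H.ord_sqrt hp2 hq
          have h6 : ord q ((m * b₁ : ℤ) + (k₁ : ℤ) * s) =
              ord q (((p * k₁ : ℤ) : L) + b₁ * s) - ord q s := by
            rw [H.quad_eq_div, ord_mul h1 h0, ord_div H.intCast_ne_zero H.sqrt_ne_zero,
              H.ord_intCast_eq_zero hp2 hq H.not_dvd]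
            ring
          omega
        · rw [H.quad_eq_div, H.quad_eq_div, H.quad_eq_div, mul_pow, mul_pow, mul_pow, ← add_mul, h]
        · rw [H.quad_eq_div]
          exact mul_ne_zero h1 h0
        · rw [H.quad_eq_div]
          exact mul_ne_zero h2 h0
        · rw [H.quad_eq_div]
          exact mul_ne_zero h3 h0
      · refine H.false_of_dvd (a₁ := -a₃) (b₁ := -b₃) (a₂ := a₂) (b₂ := b₂) (a₃ := -a₁) (b₃ := -b₁)
          hc hp5 hreg ?_ ?_ (hd1.neg_right) hd2
        · rw [hneg, hneg, hpo.neg_pow, hpo.neg_pow]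
          linear_combination h
        · rw [hneg]
          exact neg_ne_zero.2 h1
    · by_cases hd2 : (p : ℤ) ∣ a₂
      · refine H.false_of_dvd (a₁ := -a₃) (b₁ := -b₃) (a₂ := a₁) (b₂ := b₁) (a₃ := -a₂) (b₃ := -b₂)
          hc hp5 hreg ?_ ?_ (hd2.neg_right) hd1
        · rw [hneg, hneg, hpo.neg_pow, hpo.neg_pow]
          linear_combination h
        · rw [hneg]
          exact neg_ne_zero.2 h2
      · by_cases hd3 : (p : ℤ) ∣ a₃
        · exact H.false_of_dvd hc hp5 hreg h h3 hd3 hd2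
        · exact H.false_of_not_dvd hc hp5 hreg h hd1 hd2 hd3

end Reduction

end

section Concrete

variable {p : ℕ} [hp : Fact p.Prime] {m : ℤ} {S Z : ℂ}

lemma adjoin_coe_eq_top {K E : Type*} [Field K] [Field E] [Algebra K E] (a b : E) :
    IntermediateField.adjoin K
      ({⟨a, subset_adjoin K {a, b} (by simp)⟩, ⟨b, subset_adjoin K {a, b} (by simp)⟩} :
        Set (IntermediateField.adjoin K ({a, b} : Set E))) = ⊤ := by
  apply IntermediateField.map_injective (IntermediateField.adjoin K ({a, b} : Set E)).val
  rw [IntermediateField.adjoin_map, ← AlgHom.fieldRange_eq_map, IntermediateField.fieldRange_val,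
    Set.image_pair]
  rfl

lemma IsQuadCyclo.isConjAut_of_pos {L : Type} [Field L] [NumberField L] {s ζ : L}
    (H : IsQuadCyclo p m s ζ) (hm : 0 < m) {c : L ≃+* L} (hs : c s = s) (hζ : c ζ = ζ⁻¹) :
    IsConjAut c s ζ := by
  refine ⟨hs, hζ, fun φ x ↦ ?_⟩
  have h : φ.comp (c : L →+* L) = (starRingEnd ℂ).comp φ := by
    apply H.ringHom_ext
    · have h1 : (φ s) ^ 2 = (((p : ℝ) * m : ℝ) : ℂ) := by
        rw [← map_pow, H.sq_eq]
        simp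
      have h2 : (φ s) ^ 2 = ((√((p : ℝ) * m) : ℝ) : ℂ) ^ 2 := by
        rw [h1, ← Complex.ofReal_pow, Real.sq_sqrt (by positivity)]
      simp only [RingHom.comp_apply, RingHom.coe_coe, hs]
      rcases sq_eq_sq_iff_eq_or_eq_neg.1 h2 with h3 | h3 <;> rw [h3] <;> simp
    · have h1 : (φ ζ) ^ p = 1 := by
        rw [← map_pow, H.isPrimitiveRoot.pow_eq_one, map_one]
      simp only [RingHom.comp_apply, RingHom.coe_coe, hζ, map_inv₀]
      exact Complex.inv_eq_conj (Complex.norm_eq_one_of_pow_eq_one h1 hp.out.ne_zero)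
  exact RingHom.congr_fun h x

lemma exists_conj_adjoin (hS : starRingEnd ℂ S = S) (hZ : starRingEnd ℂ Z = Z⁻¹) :
    ∃ c : adjoin ℚ ({S, Z} : Set ℂ) ≃+* adjoin ℚ ({S, Z} : Set ℂ),
      ∀ x, (c x : ℂ) = starRingEnd ℂ x := by
  have hmap : (adjoin ℚ ({S, Z} : Set ℂ)).map (Complex.conjAe.restrictScalars ℚ).toAlgHom =
      adjoin ℚ ({S, Z} : Set ℂ) := by
    rw [IntermediateField.adjoin_map, Set.image_pair]
    have h1 : (Complex.conjAe.restrictScalars ℚ).toAlgHom S = S := hS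
    have h2 : (Complex.conjAe.restrictScalars ℚ).toAlgHom Z = Z⁻¹ := hZ
    rw [h1, h2]
    apply le_antisymm <;> rw [adjoin_le_iff, Set.pair_subset_iff]
    · exact ⟨subset_adjoin ℚ _ (by simp), inv_mem (subset_adjoin ℚ _ (by simp))⟩
    · refine ⟨subset_adjoin ℚ _ (by simp), ?_⟩
      rw [← inv_inv Z]
      exact inv_mem (subset_adjoin ℚ _ (by simp))
  exact ⟨((intermediateFieldMap (Complex.conjAe.restrictScalars ℚ) _).trans
    (equivOfEq hmap)).toRingEquiv, fun x ↦ rfl⟩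

lemma false_of_int_pow_add_pow {d : ℤ} (hd : 1 < d) (hsf : Squarefree d) (hp5 : 5 ≤ p)
    (hdm : d = (p : ℤ) * m) (hreg : IsRegularFor d p) (hsq : IsSquare ((-m : ℤ) : ZMod p))
    {a₁ b₁ a₂ b₂ a₃ b₃ : ℤ}
    (h : (a₁ + b₁ * √(d : ℝ)) ^ p + (a₂ + b₂ * √(d : ℝ)) ^ p = (a₃ + b₃ * √(d : ℝ)) ^ p)
    (h1 : (a₁ + b₁ * √(d : ℝ)) ≠ 0) (h2 : (a₂ + b₂ * √(d : ℝ)) ≠ 0)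
    (h3 : (a₃ + b₃ * √(d : ℝ)) ≠ 0) : False := by
  have hm : 0 < m := by
    by_contra hm
    have : (p : ℤ) * m ≤ 0 := mul_nonpos_of_nonneg_of_nonpos (by positivity) (by omega)
    omega
  set S : ℂ := ((√(d : ℝ) : ℝ) : ℂ) with hSdef
  set Z : ℂ := Complex.exp (2 * Real.pi * Complex.I / p) with hZdef
  have hS2 : S ^ 2 = (d : ℂ) := by
    rw [hSdef, ← Complex.ofReal_pow, Real.sq_sqrt (by exact_mod_cast (by omega : 0 ≤ d))]
    simp
  have hZ : IsPrimitiveRoot Z p := Complex.isPrimitiveRoot_exp p hp.out.ne_zero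
  have hSint : IsIntegral ℚ S := by
    refine IsIntegral.of_pow two_pos ?_
    rw [hS2]
    simpa using isIntegral_algebraMap (R := ℚ) (A := ℂ) (x := (d : ℚ))
  have hZint : IsIntegral ℚ Z := (hZ.isIntegral hp.out.pos).tower_top
  have : FiniteDimensional ℚ (adjoin ℚ ({S, Z} : Set ℂ)) :=
    finiteDimensional_adjoin_pair hSint hZint
  have : NumberField (adjoin ℚ ({S, Z} : Set ℂ)) := ⟨⟩
  set s : adjoin ℚ ({S, Z} : Set ℂ) := ⟨S, subset_adjoin ℚ {S, Z} (by simp)⟩ with hs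
  set ζ : adjoin ℚ ({S, Z} : Set ℂ) := ⟨Z, subset_adjoin ℚ {S, Z} (by simp)⟩ with hζ
  have hs2 : s ^ 2 = (d : adjoin ℚ ({S, Z} : Set ℂ)) := Subtype.ext (by simpa using hS2)
  have hζp : IsPrimitiveRoot ζ p :=
    IsPrimitiveRoot.of_map_of_injective (f := algebraMap (adjoin ℚ ({S, Z} : Set ℂ)) ℂ) hZ
      (algebraMap (adjoin ℚ ({S, Z} : Set ℂ)) ℂ).injective
  have H : IsQuadCyclo p m s ζ := by
    refine ⟨hζp, ?_, adjoin_coe_eq_top S Z, fun hpm ↦ ?_, ?_⟩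
    · rw [hs2, hdm]
      push_cast
      rfl
    · have hu : IsUnit (p : ℤ) := hsf p (hdm ▸ mul_dvd_mul_left _ hpm)
      exact (Nat.prime_iff_prime_int.1 hp.out).not_isUnit hu
    · obtain ⟨r, hr⟩ := hsq
      obtain ⟨r, rfl⟩ := ZMod.intCast_surjective r
      refine ⟨r, (ZMod.intCast_zmod_eq_zero_iff_dvd _ p).1 ?_⟩
      push_cast at hr ⊢
      linear_combination -hr
  obtain ⟨c, hc⟩ := exists_conj_adjoin (S := S) (Z := Z) (Complex.conj_ofReal _)
    (Complex.inv_eq_conj (Complex.norm_eq_one_of_pow_eq_one hZ.pow_eq_one hp.out.ne_zero)).symm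
  have hc' : IsConjAut c s ζ := by
    refine H.isConjAut_of_pos hm (Subtype.ext ?_) (Subtype.ext ?_)
    · rw [hc]
      exact Complex.conj_ofReal _
    · rw [hc]
      exact (Complex.inv_eq_conj
        (Complex.norm_eq_one_of_pow_eq_one hZ.pow_eq_one hp.out.ne_zero)).symm
  have hval : ∀ a b : ℤ, ((a + b * s : adjoin ℚ ({S, Z} : Set ℂ)) : ℂ) =
      ((a + b * √(d : ℝ) : ℝ) : ℂ) := by
    intro a b
    simp [hs, hSdef]
  have hne : ∀ a b : ℤ, (a + b * √(d : ℝ)) ≠ 0 → (a + b * s : adjoin ℚ ({S, Z} : Set ℂ)) ≠ 0 := by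
    intro a b hab h0
    apply hab
    have := hval a b
    rw [h0] at this
    exact Complex.ofReal_eq_zero.1 this.symm
  refine H.false_of_pow_add_pow hc' hp5 (hreg _ s ζ hs2 hζp (adjoin_coe_eq_top S Z))
    (Subtype.ext ?_) (hne _ _ h1) (hne _ _ h2) (hne _ _ h3)
  rw [IntermediateField.coe_add, IntermediateField.coe_pow, IntermediateField.coe_pow,
    IntermediateField.coe_pow, hval, hval, hval]
  exact_mod_cast h

lemma exists_mul_eq_of_mem_adjoin_sqrt {d : ℤ} (hd : 0 ≤ d) {x : ℝ} (hx : x ∈ ℚ⟮√(d : ℝ)⟯) :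
    ∃ n a b : ℤ, n ≠ 0 ∧ n * x = a + b * √(d : ℝ) := by
  have hd2 : √(d : ℝ) ^ 2 = d := Real.sq_sqrt (by exact_mod_cast hd)
  have hxint : IsIntegral ℚ √(d : ℝ) := by
    refine IsIntegral.of_pow two_pos ?_
    rw [hd2]
    simpa using isIntegral_algebraMap (R := ℚ) (A := ℝ) (x := (d : ℚ))
  rw [← mem_toSubalgebra, adjoin_simple_toSubalgebra_of_isAlgebraic hxint.isAlgebraic] at hx
  induction hx using Algebra.adjoin_induction with
  | mem x hx => exact ⟨1, 0, 1, one_ne_zero, by simp [Set.mem_singleton_iff.1 hx]⟩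
  | algebraMap q =>
    refine ⟨q.den, q.num, 0, by exact_mod_cast q.den_ne_zero, ?_⟩
    have := Rat.den_mul_eq_num q
    simp only [eq_ratCast, Int.cast_natCast, Int.cast_zero, zero_mul, add_zero]
    exact_mod_cast this
  | add x y _ _ hx hy =>
    obtain ⟨n, a, b, hn, h⟩ := hx
    obtain ⟨n', a', b', hn', h'⟩ := hy
    refine ⟨n * n', n' * a + n * a', n' * b + n * b', mul_ne_zero hn hn', ?_⟩
    push_cast
    linear_combination n' * h + n * h'
  | mul x y _ _ hx hy =>
    obtain ⟨n, a, b, hn, h⟩ := hx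
    obtain ⟨n', a', b', hn', h'⟩ := hy
    refine ⟨n * n', a * a' + d * (b * b'), a * b' + a' * b, mul_ne_zero hn hn', ?_⟩
    push_cast
    linear_combination n' * y * h + (a + b * √(d : ℝ)) * h' + b * b' * hd2

end Concrete

/-- For a squarefree integer `d = p·m > 1` and a `d`-regular prime `p ≥ 5` such that `−m` is a
square modulo `p`, the Fermat equation `x^p + y^p = z^p` has no non-trivial solutions
over `ℚ(√d)`. -/
theorem fermat_quad_of_regular_dvd
    (d m : ℤ) (hd : 1 < d) (hsf : Squarefree d)
    (p : ℕ) (hp : p.Prime) (hp5 : 5 ≤ p)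
    (hdm : d = (p : ℤ) * m)
    (hreg : IsRegularFor d p)
    (hsq : IsSquare ((-m : ℤ) : ZMod p))
    (x y z : ℚ⟮Real.sqrt (d : ℝ)⟯)
    (h : x ^ p + y ^ p = z ^ p) :
    x * y * z = 0 := by
  have : Fact p.Prime := ⟨hp⟩
  by_contra h0
  simp only [mul_eq_zero, not_or] at h0
  obtain ⟨⟨hx, hy⟩, hz⟩ := h0
  obtain ⟨n₁, a₁, b₁, hn₁, h₁⟩ := exists_mul_eq_of_mem_adjoin_sqrt (by omega) x.2
  obtain ⟨n₂, a₂, b₂, hn₂, h₂⟩ := exists_mul_eq_of_mem_adjoin_sqrt (by omega) y.2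
  obtain ⟨n₃, a₃, b₃, hn₃, h₃⟩ := exists_mul_eq_of_mem_adjoin_sqrt (by omega) z.2
  have hr : (x : ℝ) ^ p + (y : ℝ) ^ p = (z : ℝ) ^ p := by exact_mod_cast congrArg Subtype.val h
  have hn : (n₁ * n₂ * n₃ : ℝ) ≠ 0 := by
    exact_mod_cast mul_ne_zero (mul_ne_zero hn₁ hn₂) hn₃
  have e₁ : ((n₂ * n₃ * a₁ : ℤ) + (n₂ * n₃ * b₁ : ℤ) * √(d : ℝ)) = n₁ * n₂ * n₃ * (x : ℝ) := by
    push_cast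
    linear_combination -(n₂ * n₃ * h₁)
  have e₂ : ((n₁ * n₃ * a₂ : ℤ) + (n₁ * n₃ * b₂ : ℤ) * √(d : ℝ)) = n₁ * n₂ * n₃ * (y : ℝ) := by
    push_cast
    linear_combination -(n₁ * n₃ * h₂)
  have e₃ : ((n₁ * n₂ * a₃ : ℤ) + (n₁ * n₂ * b₃ : ℤ) * √(d : ℝ)) = n₁ * n₂ * n₃ * (z : ℝ) := by
    push_cast
    linear_combination -(n₁ * n₂ * h₃)
  refine false_of_int_pow_add_pow hd hsf hp5 hdm hreg hsq (a₁ := n₂ * n₃ * a₁)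
    (b₁ := n₂ * n₃ * b₁) (a₂ := n₁ * n₃ * a₂) (b₂ := n₁ * n₃ * b₂) (a₃ := n₁ * n₂ * a₃)
    (b₃ := n₁ * n₂ * b₃) ?_ ?_ ?_ ?_
  · rw [e₁, e₂, e₃, mul_pow _ (x : ℝ), mul_pow _ (y : ℝ), mul_pow _ (z : ℝ), ← mul_add, hr]
  · rw [e₁]
    exact mul_ne_zero hn (by simpa using hx)
  · rw [e₂]
    exact mul_ne_zero hn (by simpa using hy)
  · rw [e₃]
    exact mul_ne_zero hn (by simpa using hz)
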